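/- arXiv:1311.4524 — 2 statements merged into one kernel-verified Lean document; each statement's English description precedes it below -/
import Mathlib

section
/- The linear Chacon map T has minimal self-joinings of order 2: every ergodic self-joining ν of T is either the product measure μ ⊗ μ or one of the off-diagonal measures Δ^i for some i ∈ ℤ, where Δ^i is determined by Δ^i(A × B) = μ(A ∩ T^iB). -/
open MeasureTheory Filter Topology
open scoped symmDiff

/-- A Chacon-type rank-one map (cutting into 3, spacer sequence `s` over the middle
column), acting on a probability space `(X, μ)`. -/
structure ChaconMap {X : Type*} [MeasurableSpace X]
    (μ : Measure X) (s : ℕ → ℕ) : Type _ where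
  /-- The transformation, an invertible bimeasurable map. -/
  T : X ≃ᵐ X
  measurePreserving : MeasurePreserving T μ μ
  /-- The tower heights (number of levels is `h j + 1`). -/
  h : ℕ → ℕ
  h_one : h 1 = 1
  h_succ : ∀ j, 1 ≤ j → h (j + 1) = 3 * h j + 2 + s j
  /-- The base of the `j`-th tower. -/
  E : ℕ → Set X
  E1 : ℕ → Set X
  E2 : ℕ → Set X
  E3 : ℕ → Set X
  measE : ∀ j, MeasurableSet (E j)
  measE1 : ∀ j, MeasurableSet (E1 j)
  measE2 : ∀ j, MeasurableSet (E2 j)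
  measE3 : ∀ j, MeasurableSet (E3 j)
  /-- (i) the levels of the `j`-th tower are pairwise disjoint. -/
  tower_disjoint : ∀ j, 1 ≤ j → ∀ i ≤ h j, ∀ i' ≤ h j, i ≠ i' →
    Disjoint ((⇑T)^[i] '' E j) ((⇑T)^[i'] '' E j)
  /-- (ii) the base is cut into three pieces of equal measure. -/
  E_union : ∀ j, 1 ≤ j → E j = E1 j ∪ E2 j ∪ E3 j
  E_disj12 : ∀ j, 1 ≤ j → Disjoint (E1 j) (E2 j)
  E_disj13 : ∀ j, 1 ≤ j → Disjoint (E1 j) (E3 j)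
  E_disj23 : ∀ j, 1 ≤ j → Disjoint (E2 j) (E3 j)
  E_meas12 : ∀ j, 1 ≤ j → μ (E1 j) = μ (E2 j)
  E_meas23 : ∀ j, 1 ≤ j → μ (E2 j) = μ (E3 j)
  E_next : ∀ j, 1 ≤ j → E (j + 1) = E1 j
  /-- (iii) stacking: the top of the first column is sent to the base of the second. -/
  stack1 : ∀ j, 1 ≤ j → μ (((⇑T)^[h j + 1] '' E1 j) ∆ E2 j) = 0
  /-- (iii) stacking: the top spacer over the second column is sent to the third base. -/
  stack2 : ∀ j, 1 ≤ j → μ (((⇑T)^[h j + 1 + s j] '' E2 j) ∆ E3 j) = 0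
  /-- (iii) the spacer levels are disjoint from the `j`-th tower. -/
  spacer_disjoint : ∀ j, 1 ≤ j → ∀ i, 1 ≤ i → i ≤ s j → ∀ i' ≤ h j,
    Disjoint ((⇑T)^[h j + i] '' E2 j) ((⇑T)^[i'] '' E j)
  /-- (iv) the towers fill up the whole space. -/
  tower_full : Tendsto (fun j => μ (⋃ i ∈ Finset.range (h j + 1), (⇑T)^[i] '' E j))
    atTop (𝓝 1)
  /-- (iv) the levels of the towers generate the full σ-algebra mod `μ`. -/
  generates : ∀ A : Set X, MeasurableSet A → ∃ B : Set X,
    MeasurableSet[MeasurableSpace.generateFrom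
      {S : Set X | ∃ j, 1 ≤ j ∧ ∃ i ≤ h j, S = (⇑T)^[i] '' E j}] B ∧ μ (A ∆ B) = 0

/-- The `n`-th power (`n : ℤ`) of an invertible measurable map. -/
def MeasurableEquiv.iterZ {X : Type*} [MeasurableSpace X] (T : X ≃ᵐ X) : ℤ → X → X
  | Int.ofNat n => (⇑T)^[n]
  | Int.negSucc n => (⇑T.symm)^[n + 1]


/-- partial maxima of Birkhoff sums -/
noncomputable def bmax {Ω : Type*} (S : Ω → Ω) (f : Ω → ℝ) : ℕ → Ω → ℝ
  | 0 => f
  | n + 1 => fun x => f x + max 0 (bmax S f n (S x))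

lemma bmax_measurable {Ω : Type*} [MeasurableSpace Ω] {S : Ω → Ω} {f : Ω → ℝ}
    (hS : Measurable S) (hf : Measurable f) (n : ℕ) : Measurable (bmax S f n) := by
  induction n with
  | zero => exact hf
  | succ n ih => exact hf.add (measurable_const.max (ih.comp hS))

lemma bmax_ge {Ω : Type*} {S : Ω → Ω} {f : Ω → ℝ} (n : ℕ) (x : Ω) : f x ≤ bmax S f n x := by
  cases n with
  | zero => exact le_rfl
  | succ n =>
    have := le_max_left 0 (bmax S f n (S x))
    simp only [bmax]; linarith

lemma bmax_succ {Ω : Type*} {S : Ω → Ω} {f : Ω → ℝ} (n : ℕ) :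
    ∀ x : Ω, bmax S f n x ≤ bmax S f (n + 1) x := by
  induction n with
  | zero => intro x; exact bmax_ge 1 x
  | succ n ih =>
    intro x
    have := max_le_max (le_refl (0 : ℝ)) (ih (S x))
    simp only [bmax] at *; linarith

lemma bmax_abs {Ω : Type*} {S : Ω → Ω} {f : Ω → ℝ} {M : ℝ} (hM : ∀ x, |f x| ≤ M) (n : ℕ) :
    ∀ x : Ω, |bmax S f n x| ≤ (n + 1) * M := by
  induction n with
  | zero => intro x; simpa [bmax] using hM x
  | succ n ih =>
    intro x
    have h1 := abs_le.1 (hM x)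
    have h2 := abs_le.1 (ih (S x))
    have hM0 : 0 ≤ M := (abs_nonneg _).trans (hM x)
    have h4 : max 0 (bmax S f n (S x)) ≤ (n + 1) * M := max_le (by positivity) h2.2
    have h5 := le_max_left 0 (bmax S f n (S x))
    simp only [bmax]
    push_cast
    have : 0 ≤ (n : ℝ) * M := by positivity
    rw [abs_le]; constructor <;> nlinarith

lemma bmax_sum {Ω : Type*} {S : Ω → Ω} {f : Ω → ℝ} (n : ℕ) :
    ∀ x : Ω, ∑ k ∈ Finset.range (n + 1), f (S^[k] x) ≤ bmax S f n x := by
  induction n with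
  | zero => intro x; simp [bmax]
  | succ n ih =>
    intro x
    rw [Finset.sum_range_succ']
    have h1 := ih (S x)
    have h2 := le_max_right 0 (bmax S f n (S x))
    simp only [Function.iterate_succ, Function.comp, Function.iterate_zero, id, bmax] at *
    linarith

lemma birkhoff_bdd {Ω : Type*} [MeasurableSpace Ω] {ν : Measure Ω} [IsProbabilityMeasure ν]
    {S : Ω → Ω} (hS : Ergodic S ν) {f : Ω → ℝ} (hf : Measurable f) {M : ℝ}
    (hM : ∀ x, |f x| ≤ M) (hneg : ∫ x, f x ∂ν < 0) :
    ∀ᵐ x ∂ν, ∃ K : ℝ, ∀ n, ∑ k ∈ Finset.range n, f (S^[k] x) ≤ K := by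
  have hmeas := fun n => bmax_measurable hS.measurable hf n
  set A : Set Ω := {x | ∀ K : ℕ, ∃ n, (K : ℝ) < bmax S f n x} with hA
  have hAm : MeasurableSet A := by
    have : A = ⋂ K : ℕ, ⋃ n, {x | (K : ℝ) < bmax S f n x} := by ext; simp [hA]
    rw [this]
    exact MeasurableSet.iInter fun K => MeasurableSet.iUnion fun n =>
      measurableSet_lt measurable_const (hmeas n)
  have hinv : S ⁻¹' A = A := by
    ext x
    simp only [hA, Set.mem_preimage, Set.mem_ofPred_eq]
    have hx := abs_le.1 (hM x)
    constructor
    · intro h K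
      obtain ⟨L, hL⟩ := exists_nat_ge (K + M)
      obtain ⟨n, hn⟩ := h L
      refine ⟨n + 1, ?_⟩
      have := le_max_right 0 (bmax S f n (S x))
      simp only [bmax]; linarith
    · intro h K
      obtain ⟨L, hL⟩ := exists_nat_ge (K + M)
      obtain ⟨n, hn⟩ := h L
      have hn' := hn.trans_le (bmax_succ n x)
      refine ⟨n, ?_⟩
      simp only [bmax] at hn'
      rcases max_cases 0 (bmax S f n (S x)) with ⟨h1, h2⟩ | ⟨h1, h2⟩
      · rw [h1] at hn'
        have : (0:ℝ) ≤ K := Nat.cast_nonneg K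
        linarith
      · rw [h1] at hn'; linarith
  have hbint : ∀ n, Integrable (bmax S f n) ν := fun n =>
    Integrable.of_bound (hmeas n).aestronglyMeasurable ((n + 1) * M)
      (Eventually.of_forall fun x => by simpa using bmax_abs hM n x)
  rcases hS.toPreErgodic.ae_mem_or_ae_notMem hAm hinv with h | h
  · exfalso
    have hS' := hS.toMeasurePreserving
    have hcomp : ∀ n, ∫ x, bmax S f n (S x) ∂ν = ∫ x, bmax S f n x ∂ν := by
      intro n
      have := integral_map (μ := ν) hS.measurable.aemeasurable
        (f := bmax S f n) (hmeas n).aestronglyMeasurable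
      rw [hS'.map_eq] at this
      exact this.symm
    have hintc : ∀ n, Integrable (fun x => bmax S f n (S x)) ν := fun n =>
      hS'.integrable_comp_of_integrable (hbint n)
    have hpos : ∀ n, 0 ≤ ∫ x, (bmax S f (n + 1) x - bmax S f n (S x)) ∂ν := by
      intro n
      rw [integral_sub (hbint _) (hintc n), hcomp n]
      have := integral_mono (hbint n) (hbint (n + 1)) (bmax_succ n)
      linarith
    have hlim : Tendsto (fun n => ∫ x, (bmax S f (n + 1) x - bmax S f n (S x)) ∂ν) atTop
        (𝓝 (∫ x, f x ∂ν)) := by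
      refine tendsto_integral_of_dominated_convergence (fun _ => M + M) ?_ (integrable_const _) ?_ ?_
      · intro n
        exact ((hmeas (n+1)).sub ((hmeas n).comp hS.measurable)).aestronglyMeasurable
      · intro n
        refine Eventually.of_forall fun x => ?_
        have h1 := abs_le.1 (hM x)
        have h2 := abs_le.1 (hM (S x))
        have h3 := bmax_ge (S := S) (f := f) n (S x)
        simp only [bmax, Real.norm_eq_abs]
        rcases max_cases 0 (bmax S f n (S x)) with ⟨h1, h2⟩ | ⟨h1, h2⟩ <;> rw [h1, abs_le] <;>
          constructor <;> linarith
      · filter_upwards [h] with x hx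
        have hx' : S x ∈ A := by rw [← hinv] at hx; exact hx
        obtain ⟨n0, hn0⟩ := hx' 0
        apply tendsto_const_nhds.congr'
        filter_upwards [eventually_ge_atTop n0] with n hn
        have hmono : Monotone fun n => bmax S f n (S x) :=
          monotone_nat_of_le_succ fun n => bmax_succ n (S x)
        have h1 : 0 < bmax S f n (S x) := by
          have := hmono hn
          simp only [Nat.cast_zero] at hn0
          exact hn0.trans_le this
        simp only [bmax, max_eq_right h1.le]; ring
    have := ge_of_tendsto' hlim hpos
    linarith
  · filter_upwards [h] with x hx
    simp only [hA, Set.mem_ofPred_eq, not_forall, not_exists, not_lt] at hx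
    obtain ⟨K, hK⟩ := hx
    refine ⟨K, fun n => ?_⟩
    cases n with
    | zero => simp
    | succ n => exact (bmax_sum n x).trans (hK n)

/-- Pointwise ergodic theorem for a set. -/
lemma birkhoff_set {Ω : Type*} [MeasurableSpace Ω] {ν : Measure Ω} [IsProbabilityMeasure ν]
    {S : Ω → Ω} (hS : Ergodic S ν) {D : Set Ω} (hD : MeasurableSet D) :
    ∀ᵐ x ∂ν, ∀ ε : ℝ, 0 < ε → ∃ K : ℝ, ∀ n : ℕ,
      |∑ k ∈ Finset.range n, D.indicator (fun _ => (1:ℝ)) (S^[k] x) - n * ν.real D|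
        ≤ ε * n + K := by
  set g : Ω → ℝ := D.indicator (fun _ => (1:ℝ)) with hg
  have hgm : Measurable g := measurable_const.indicator hD
  have hg01 : ∀ x, 0 ≤ g x ∧ g x ≤ 1 := by
    intro x; by_cases hx : x ∈ D <;> simp [hg, hx]
  have hgi : Integrable g ν := (integrable_const (1:ℝ)).indicator hD
  have hgint : ∫ x, g x ∂ν = ν.real D := by
    rw [hg, integral_indicator hD]; simp
  have hr0 : 0 ≤ ν.real D := measureReal_nonneg
  have hr1 : ν.real D ≤ 1 := measureReal_le_one
  have key : ∀ (s : ℝ), (s = 1 ∨ s = -1) → ∀ m : ℕ, ∀ᵐ x ∂ν, ∃ K : ℝ, ∀ n,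
      ∑ k ∈ Finset.range n, (s * (g (S^[k] x) - ν.real D) - 1 / ((m:ℝ) + 1)) ≤ K := by
    intro s hs m
    have hm : (0:ℝ) < 1 / ((m:ℝ) + 1) := by positivity
    have hm1 : 1 / ((m:ℝ) + 1) ≤ 1 := by
      rw [div_le_one (by positivity)]; have : (0:ℝ) ≤ m := Nat.cast_nonneg m; linarith
    apply birkhoff_bdd hS (f := fun x => s * (g x - ν.real D) - 1 / ((m:ℝ) + 1)) (M := 2)
    · exact ((hgm.sub_const _).const_mul _).sub_const _
    · intro x
      have := hg01 x
      rcases hs with rfl | rfl <;> rw [abs_le] <;> constructor <;> linarith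
    · have hi : Integrable (fun x => s * (g x - ν.real D)) ν :=
        (hgi.sub (integrable_const _)).const_mul _
      rw [integral_sub hi (integrable_const _), integral_const_mul, integral_sub hgi (integrable_const _), hgint]
      simp
      positivity
  have h1 := ae_all_iff.2 (key 1 (Or.inl rfl))
  have h2 := ae_all_iff.2 (key (-1) (Or.inr rfl))
  filter_upwards [h1, h2] with x h1 h2 ε hε
  obtain ⟨m, hm⟩ := exists_nat_one_div_lt hε
  obtain ⟨K1, hK1⟩ := h1 m
  obtain ⟨K2, hK2⟩ := h2 m
  refine ⟨max K1 K2, fun n => ?_⟩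
  have e1 := hK1 n
  have e2 := hK2 n
  rw [Finset.sum_sub_distrib, ← Finset.mul_sum, Finset.sum_sub_distrib] at e1 e2
  simp only [Finset.sum_const, Finset.card_range, nsmul_eq_mul] at e1 e2
  have hn : (0:ℝ) ≤ n := Nat.cast_nonneg n
  have h3 : (n:ℝ) * (1 / ((m:ℝ) + 1)) ≤ ε * n := by nlinarith
  have h4 := le_max_left K1 K2
  have h5 := le_max_right K1 K2
  rw [abs_le]; constructor <;> linarith

/-- Structure of the visit times of an orbit to the tower bases. -/
structure Vis (H : ℕ → ℤ) (V : ℕ → Set ℤ) : Prop where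
  s0a : ∀ j, 1 ≤ j → ∀ n, n ∈ V (j + 1) → n ∈ V j
  s0b : ∀ j, 1 ≤ j → ∀ n, n ∈ V (j + 1) → n + H j ∈ V j
  s0c : ∀ j, 1 ≤ j → ∀ n, n ∈ V (j + 1) → n + (2 * H j + j) ∈ V j
  s1 : ∀ j, 1 ≤ j → ∀ n, n ∈ V j →
    n ∈ V (j + 1) ∨ n - H j ∈ V (j + 1) ∨ n - (2 * H j + j) ∈ V (j + 1)
  s2 : ∀ j, 1 ≤ j → ∀ n n', n ∈ V j → n' ∈ V j → n < n' → n + H j ≤ n'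

/-- Offset of the `c`-th column (`c = 0, 1, 2`). -/
def off (H : ℕ → ℤ) (j c : ℕ) : ℤ := if c = 0 then 0 else if c = 1 then H j else 2 * H j + j

/-- Position of the `i`-th stage `j` block in the stage `j + k` block. -/
def pos (H : ℕ → ℤ) : ℕ → ℕ → ℕ → ℤ
  | j, 0, i => i * H j
  | j, k + 1, i => pos H (j + 1) k (i / 3) + off H j (i % 3)


lemma H_sq {H : ℕ → ℤ} (h1 : H 1 = 2)
    (hH : ∀ j : ℕ, 1 ≤ j → H (j + 1) = 3 * H j + j) (j : ℕ) (hj : 1 ≤ j) : (j : ℤ) * j ≤ H j := by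
  induction j, hj using Nat.le_induction with
  | base => simp [h1]
  | succ j hj ih =>
    rw [hH j hj]; push_cast
    have : (1 : ℤ) ≤ j := by exact_mod_cast hj
    nlinarith

lemma H_big {H : ℕ → ℤ} (h1 : H 1 = 2)
    (hH : ∀ j : ℕ, 1 ≤ j → H (j + 1) = 3 * H j + j) (j : ℕ) (hj : 1001 ≤ j) : 1000 * ((j : ℤ) + 1) ≤ H j := by
  have := H_sq h1 hH j (by omega)
  have : (1001 : ℤ) ≤ j := by exact_mod_cast hj
  nlinarith

lemma H_pos {H : ℕ → ℤ} (h1 : H 1 = 2)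
    (hH : ∀ j : ℕ, 1 ≤ j → H (j + 1) = 3 * H j + j) (j : ℕ) (hj : 1 ≤ j) : 1 ≤ H j := by
  have := H_sq h1 hH j (by omega)
  have : (1 : ℤ) ≤ j := by exact_mod_cast hj
  nlinarith

lemma pos_gap {H : ℕ → ℤ}
    (hH : ∀ j : ℕ, 1 ≤ j → H (j + 1) = 3 * H j + j) (k : ℕ) : ∀ j : ℕ, 1 ≤ j → ∀ i : ℕ, ∃ σ : ℤ, 0 ≤ σ ∧ σ ≤ j + k ∧
    pos H j k (i + 1) = pos H j k i + H j + σ := by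
  induction k with
  | zero => intro j hj i; exact ⟨0, le_rfl, by positivity, by simp only [pos]; push_cast; ring⟩
  | succ k ih =>
    intro j hj i
    have h3 : i % 3 = 0 ∨ i % 3 = 1 ∨ i % 3 = 2 := by omega
    rcases h3 with h | h | h
    · refine ⟨0, le_rfl, by positivity, ?_⟩
      simp only [pos, show (i + 1) / 3 = i / 3 by omega, show (i + 1) % 3 = 1 by omega, h, off]
      simp
    · refine ⟨j, by positivity, by push_cast; linarith, ?_⟩
      simp only [pos, show (i + 1) / 3 = i / 3 by omega, show (i + 1) % 3 = 2 by omega, h, off]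
      simp; ring
    · obtain ⟨σ, a, b, c⟩ := ih (j + 1) (by omega) (i / 3)
      refine ⟨σ, a, by push_cast at *; linarith, ?_⟩
      simp only [pos, show (i + 1) / 3 = i / 3 + 1 by omega, show (i + 1) % 3 = 0 by omega, h, off,
        c, hH j hj]
      simp; ring

lemma pos_gap1 {H : ℕ → ℤ} (k j i : ℕ) (hi : i % 3 = 1) :
    pos H j (k + 1) (i + 1) = pos H j (k + 1) i + H j + j := by
  simp only [pos, show (i + 1) / 3 = i / 3 by omega, show (i + 1) % 3 = 2 by omega, hi, off]
  simp; ring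

lemma pos_gap2 {H : ℕ → ℤ}
    (hH : ∀ j : ℕ, 1 ≤ j → H (j + 1) = 3 * H j + j) (k j i : ℕ) (hj : 1 ≤ j) (hi : i % 9 = 5) :
    pos H j (k + 2) (i + 1) = pos H j (k + 2) i + H j + (j + 1) := by
  have := pos_gap1 (H := H) k (j + 1) (i / 3) (by omega)
  rw [show k + 2 = (k + 1) + 1 from rfl, pos.eq_2 H j (i + 1) (k + 1), pos.eq_2 H j i (k + 1),
    show (i + 1) / 3 = i / 3 + 1 by omega, this]
  simp only [show (i + 1) % 3 = 0 by omega, show i % 3 = 2 by omega, off, hH j hj]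
  simp; ring

lemma pos_pow {H : ℕ → ℤ} (k : ℕ) : ∀ j, pos H j k (3 ^ k) = H (j + k) := by
  induction k with
  | zero => intro j; simp [pos]
  | succ k ih =>
    intro j
    rw [pos, show 3 ^ (k + 1) / 3 = 3 ^ k by omega, show 3 ^ (k + 1) % 3 = 0 by omega, ih]
    simp [off, show j + 1 + k = j + (k + 1) by omega]

lemma pos_mono {H : ℕ → ℤ} (h1 : H 1 = 2)
    (hH : ∀ j : ℕ, 1 ≤ j → H (j + 1) = 3 * H j + j) (k j i n : ℕ) (hj : 1 ≤ j) : pos H j k i + n * H j ≤ pos H j k (i + n) := by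
  induction n with
  | zero => simp
  | succ n ih =>
    obtain ⟨σ, a, b, c⟩ := pos_gap hH k j hj (i + n)
    rw [← add_assoc, c]; push_cast; linarith

lemma pos_upper {H : ℕ → ℤ} (h1 : H 1 = 2)
    (hH : ∀ j : ℕ, 1 ≤ j → H (j + 1) = 3 * H j + j) (k j i n : ℕ) (hj : 1 ≤ j) :
    pos H j k (i + n) ≤ pos H j k i + n * (H j + j + k) := by
  induction n with
  | zero => simp
  | succ n ih =>
    obtain ⟨σ, a, b, c⟩ := pos_gap hH k j hj (i + n)
    rw [← add_assoc, c]; push_cast; linarith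

lemma pos_mem {H : ℕ → ℤ} {V : ℕ → Set ℤ} (hV : Vis H V) (k : ℕ) : ∀ j, 1 ≤ j → ∀ i, i < 3 ^ k → ∀ n,
    n ∈ V (j + k) → n + pos H j k i ∈ V j := by
  induction k with
  | zero => intro j hj i hi n hn; simp at hi; subst hi; simpa [pos] using hn
  | succ k ih =>
    intro j hj i hi n hn
    have h2 := ih (j + 1) (by omega) (i / 3) (by omega) n
      (by rwa [show j + 1 + k = j + (k + 1) by omega])
    rw [pos, ← add_assoc]
    have h3 : i % 3 = 0 ∨ i % 3 = 1 ∨ i % 3 = 2 := by omega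
    rcases h3 with h | h | h <;> simp only [h, off] <;> simp
    · exact hV.s0a j hj _ h2
    · exact hV.s0b j hj _ h2
    · exact hV.s0c j hj _ h2

lemma pos_exists {H : ℕ → ℤ} {V : ℕ → Set ℤ} (hV : Vis H V) (k : ℕ) : ∀ j, 1 ≤ j → ∀ n, n ∈ V j →
    ∃ p, p < 3 ^ k ∧ n - pos H j k p ∈ V (j + k) := by
  induction k with
  | zero => intro j hj n hn; exact ⟨0, by simp, by simpa [pos] using hn⟩
  | succ k ih =>
    intro j hj n hn
    have key : ∀ c, c < 3 → n - off H j c ∈ V (j + 1) →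
        ∃ p, p < 3 ^ (k + 1) ∧ n - pos H j (k + 1) p ∈ V (j + (k + 1)) := by
      intro c hc h
      obtain ⟨p, hp, hm⟩ := ih (j + 1) (by omega) _ h
      refine ⟨3 * p + c, by omega, ?_⟩
      rw [pos, show (3 * p + c) / 3 = p by omega, show (3 * p + c) % 3 = c by omega,
        show j + (k + 1) = j + 1 + k by omega]
      convert hm using 1; ring
    rcases hV.s1 j hj n hn with h | h | h
    · exact key 0 (by omega) (by simpa [off] using h)
    · exact key 1 (by omega) (by simpa [off] using h)
    · exact key 2 (by omega) (by simpa [off] using h)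

/-- the shift window -/
def Win (H : ℕ → ℤ) (V W : ℕ → Set ℤ) (j : ℕ) (gx gy : ℤ) : Prop :=
  ∃ tx ty u l : ℤ, tx ∈ V j ∧ tx + H j + gx ∈ V j ∧ ty ∈ W j ∧ ty + H j + gy ∈ W j ∧
    tx + gx ≤ u ∧ ty + gy ≤ u ∧ u + l ≤ tx + H j ∧ u + l ≤ ty + H j ∧ H j ≤ 8 * l ∧
    gx ≤ u ∧ gy ≤ u ∧ u ≤ 40 * H j

lemma Win.swap {H : ℕ → ℤ} {V W : ℕ → Set ℤ} {j : ℕ} {gx gy : ℤ} (h : Win H V W j gx gy) :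
    Win H W V j gy gx := by
  obtain ⟨tx, ty, u, l, a1, a2, a3, a4, a5, a6, a7, a8, a9, a10, a11, a12⟩ := h
  exact ⟨ty, tx, u, l, a3, a4, a1, a2, a6, a5, a8, a7, a9, a11, a10, a12⟩

lemma win_of_mismatch {H : ℕ → ℤ} (h1 : H 1 = 2)
    (hH : ∀ j : ℕ, 1 ≤ j → H (j + 1) = 3 * H j + j) {V W : ℕ → Set ℤ} (hV : Vis H V) (hW : Vis H W) {j : ℕ} (hj : 1001 ≤ j)
    {nV nW : ℤ} (hnV : nV ∈ V (j + j)) (hnW : nW ∈ W (j + j)) {p q : ℕ}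
    (hp : p + 10 < 3 ^ j) (hq : q + 10 < 3 ^ j) (hpq : q % 3 = (p + 1) % 3)
    (hx0 : - H j ≤ nV + pos H j j p) (hx1 : nV + pos H j j p ≤ 2 * H j)
    (hy0 : - H j ≤ nW + pos H j j q) (hy1 : nW + pos H j j q ≤ 2 * H j)
    (hxy : 2 * |(nV + pos H j j p) - (nW + pos H j j q)| ≤ H j + 4 * j) :
    Win H V W j j (j + 1) := by
  have hbig := H_big h1 hH j hj
  have hj0 : (0 : ℤ) ≤ j := by positivity
  have hj1 : 1 ≤ j := by omega
  obtain ⟨n, hn1, hn9, hn5⟩ : ∃ n, 1 ≤ n ∧ n ≤ 9 ∧ (q + n) % 9 = 5 := by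
    refine ⟨(13 - q % 9) % 9 + 1, by omega, by omega, by omega⟩
  obtain ⟨k, hk⟩ : ∃ k, j = k + 2 := ⟨j - 2, by omega⟩
  have gx : pos H j j (p + n + 1) = pos H j j (p + n) + H j + j := by
    have := pos_gap1 (H := H) (k + 1) j (p + n) (by omega)
    rwa [show k + 1 + 1 = j by omega] at this
  have gy : pos H j j (q + n + 1) = pos H j j (q + n) + H j + (j + 1) := by
    have := pos_gap2 hH k j (q + n) hj1 hn5
    rwa [show k + 2 = j by omega] at this
  have mx := pos_mem hV j j hj1 (p + n) (by omega) nV hnV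
  have mx' := pos_mem hV j j hj1 (p + n + 1) (by omega) nV hnV
  have my := pos_mem hW j j hj1 (q + n) (by omega) nW hnW
  have my' := pos_mem hW j j hj1 (q + n + 1) (by omega) nW hnW
  have lx := pos_mono h1 hH j j p n hj1
  have ly := pos_mono h1 hH j j q n hj1
  have ux := pos_upper h1 hH j j p n hj1
  have uy := pos_upper h1 hH j j q n hj1
  rw [gx] at mx'
  rw [gy] at my'
  have hab := abs_le.1 (show |(nV + pos H j j p) - (nW + pos H j j q)| ≤ (H j + 4 * j) / 2 by omega)
  generalize pos H j j (p + n) = px at *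
  generalize pos H j j (q + n) = py at *
  generalize pos H j j p = p0 at *
  generalize pos H j j q = q0 at *
  have hn1' : (1 : ℤ) ≤ n := by exact_mod_cast hn1
  have hn9' : (n : ℤ) ≤ 9 := by exact_mod_cast hn9
  have nH1 : H j ≤ n * H j := by nlinarith
  have nH9 : n * H j ≤ 9 * H j := by nlinarith
  have nj9 : (n:ℤ) * j ≤ 9 * j := by nlinarith
  have ux' : px ≤ p0 + n * H j + 2 * (n * j) := by linarith
  have uy' : py ≤ q0 + n * H j + 2 * (n * j) := by linarith
  refine ⟨nV + px, nW + py, max (nV + px) (nW + py) + (j + 1),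
    min (nV + px) (nW + py) + H j - (max (nV + px) (nW + py) + (j + 1)), mx, ?_, my, ?_,
    ?_, ?_, ?_, ?_, ?_, ?_, ?_, ?_⟩
  · convert mx' using 1; ring
  · convert my' using 1; ring
  all_goals omega

/-- Local alternative at stage `j`. -/
lemma core {H : ℕ → ℤ} (h1 : H 1 = 2)
    (hH : ∀ j : ℕ, 1 ≤ j → H (j + 1) = 3 * H j + j) {V W : ℕ → Set ℤ} (hV : Vis H V) (hW : Vis H W) {j : ℕ} (hj : 1001 ≤ j)
    (tV : ∀ A : ℤ, 0 ≤ A → A < H (j + j) → -A ∈ V (j + j) → A + 50 * H j < H (j + j))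
    (tW : ∀ A : ℤ, 0 ≤ A → A < H (j + j) → -A ∈ W (j + j) → A + 50 * H j < H (j + j))
    {a b : ℤ} (ha0 : 0 ≤ a) (ha : a < H j) (hb0 : 0 ≤ b) (hb : b < H j)
    (haV : -a ∈ V j) (hbW : -b ∈ W j) :
    Win H V W j j (j + 1) ∨ Win H V W j (j + 1) j ∨
    ∃ c c', c < 3 ∧ c' < 3 ∧ -(a + off H j c) ∈ V (j + 1) ∧ -(b + off H j c') ∈ W (j + 1) ∧
      ((2 * |a - b| ≤ H j ∧ c = c') ∨ (H j < 2 * (b - a) ∧ c = (c' + 1) % 3) ∨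
        (H j < 2 * (a - b) ∧ c' = (c + 1) % 3)) := by
  have hbig := H_big h1 hH j hj
  have hj0 : (0 : ℤ) ≤ j := by positivity
  have hj1 : 1 ≤ j := by omega
  have aux : ∀ {V : ℕ → Set ℤ} (hV : Vis H V)
      (tV : ∀ A : ℤ, 0 ≤ A → A < H (j + j) → -A ∈ V (j + j) → A + 50 * H j < H (j + j))
      {a : ℤ} (ha0 : 0 ≤ a) (ha : a < H j) (haV : -a ∈ V j),
      ∃ p, p + 20 < 3 ^ j ∧ -(a + pos H j j p) ∈ V (j + j) ∧ 
        -(a + off H j (p % 3)) ∈ V (j + 1) := by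
    intro V hV tV a ha0 ha haV
    obtain ⟨p, hp, hm⟩ := pos_exists hV j j hj1 _ haV
    have hm' : -(a + pos H j j p) ∈ V (j + j) := by convert hm using 1; ring
    have hpp := pos_pow (H := H) j j
    have hpos0 : 0 ≤ pos H j j p := by
      have := pos_mono h1 hH j j 0 p hj1
      rw [zero_add] at this
      have h00 : ∀ k j, pos H j k 0 = 0 := by
        intro k
        induction k with
        | zero => intro j; simp [pos]
        | succ k ih => intro j; simp [pos, ih, off]
      rw [h00] at this
      have : (0:ℤ) ≤ p * H j := by apply mul_nonneg <;> omega
      linarith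
    have hlt : a + pos H j j p < H (j + j) := by
      have := pos_mono h1 hH j j p (3 ^ j - p) hj1
      rw [show p + (3 ^ j - p) = 3 ^ j by omega, hpp] at this
      have h1 : (1:ℤ) ≤ ((3 ^ j - p : ℕ) : ℤ) := by
        have : 1 ≤ 3 ^ j - p := by omega
        exact_mod_cast this
      nlinarith
    have ht := tV _ (by omega) hlt hm'
    refine ⟨p, ?_, hm', ?_⟩
    · by_contra hcon
      have := pos_upper h1 hH j j p (3 ^ j - p) hj1
      rw [show p + (3 ^ j - p) = 3 ^ j by omega, hpp] at this
      have h1 : ((3 ^ j - p : ℕ) : ℤ) ≤ 20 := by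
        have : 3 ^ j - p ≤ 20 := by omega
        exact_mod_cast this
      nlinarith
    · obtain ⟨k, hk⟩ : ∃ k, j = k + 1 := ⟨j - 1, by omega⟩
      have h3 : p / 3 < 3 ^ k := by
        have : 3 ^ j = 3 * 3 ^ k := by rw [hk]; ring
        omega
      have h4 := pos_mem hV k (j + 1) (by omega) (p / 3) h3 (-(a + pos H j j p))
        (by rwa [show j + 1 + k = j + j by omega])
      have h5 : pos H j j p = pos H (j + 1) k (p / 3) + off H j (p % 3) := by
        conv_lhs => rw [show pos H j j p = pos H j (k + 1) p by rw [← hk]]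
        rw [pos]
      convert h4 using 1
      rw [h5]; ring
  obtain ⟨p, hp, hpm, hp'⟩ := aux hV tV ha0 ha haV
  obtain ⟨q, hq, hqm, hq'⟩ := aux hW tW hb0 hb hbW
  have gap : ∀ i, pos H j j i + H j ≤ pos H j j (i + 1) ∧
      pos H j j (i + 1) ≤ pos H j j i + H j + 2 * j := by
    intro i
    obtain ⟨σ, s0, s1, s2⟩ := pos_gap hH j j hj1 i
    constructor <;> linarith
  -- general mismatch
  have mis : ∀ p0 q0, p0 + 10 < 3 ^ j → q0 + 10 < 3 ^ j → p0 % 3 ≠ q0 % 3 →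
      - H j ≤ -(a + pos H j j p) + pos H j j p0 → -(a + pos H j j p) + pos H j j p0 ≤ 2 * H j →
      - H j ≤ -(b + pos H j j q) + pos H j j q0 → -(b + pos H j j q) + pos H j j q0 ≤ 2 * H j →
      2 * |(-(a + pos H j j p) + pos H j j p0) - (-(b + pos H j j q) + pos H j j q0)|
        ≤ H j + 4 * j →
      Win H V W j j (j + 1) ∨ Win H V W j (j + 1) j := by
    intro p0 q0 hp0 hq0 hne a1 a2 a3 a4 a5
    have : q0 % 3 = (p0 + 1) % 3 ∨ p0 % 3 = (q0 + 1) % 3 := by omega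
    rcases this with h | h
    · left
      exact win_of_mismatch h1 hH hV hW hj hpm hqm hp0 hq0 h a1 a2 a3 a4 a5
    · right
      rw [abs_sub_comm] at a5
      exact (win_of_mismatch h1 hH hW hV hj hqm hpm hq0 hp0 h a3 a4 a1 a2 a5).swap
  by_cases c1 : 2 * |a - b| ≤ H j
  · by_cases he : p % 3 = q % 3
    · right; right
      exact ⟨p % 3, q % 3, by omega, by omega, hp', hq', Or.inl ⟨c1, he⟩⟩
    · rcases mis p q (by omega) (by omega) he (by omega) (by omega) (by omega) (by omega)
        (by
          rw [show (-(a + pos H j j p) + pos H j j p) - (-(b + pos H j j q) + pos H j j q)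
            = -(a - b) by ring, abs_neg]; omega) with h | h
      · exact Or.inl h
      · exact Or.inr (Or.inl h)
  · have c2 : H j < 2 * (b - a) ∨ H j < 2 * (a - b) := by
      rcases abs_cases (a - b) with ⟨h, _⟩ | ⟨h, _⟩ <;> rw [h] at c1
      · right; omega
      · left; omega
    rcases c2 with c2 | c2
    · by_cases he : p % 3 = (q + 1) % 3
      · right; right
        exact ⟨p % 3, q % 3, by omega, by omega, hp', hq', Or.inr (Or.inl ⟨c2, by omega⟩)⟩
      · have g := gap q
        rcases mis p (q + 1) (by omega) (by omega) he (by omega) (by omega) (by omega) (by omega)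
          (by
            generalize pos H j j (q + 1) = z at *
            generalize pos H j j q = z0 at *
            generalize pos H j j p = z1 at *
            have : |-(a + z1) + z1 - (-(b + z0) + z)| ≤ (H j + 4 * j) / 2 := by
              rw [abs_le]; constructor <;> omega
            omega) with h | h
        · exact Or.inl h
        · exact Or.inr (Or.inl h)
    · by_cases he : q % 3 = (p + 1) % 3
      · right; right
        exact ⟨p % 3, q % 3, by omega, by omega, hp', hq', Or.inr (Or.inr ⟨c2, by omega⟩)⟩
      · have g := gap p
        rcases mis (p + 1) q (by omega) (by omega) (Ne.symm he) (by omega) (by omega) (by omega)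
          (by omega)
          (by
            generalize pos H j j (p + 1) = z at *
            generalize pos H j j q = z0 at *
            generalize pos H j j p = z1 at *
            have : |-(a + z1) + z - (-(b + z0) + z0)| ≤ (H j + 4 * j) / 2 := by
              rw [abs_le]; constructor <;> omega
            omega) with h | h
        · exact Or.inl h
        · exact Or.inr (Or.inl h)


/-- Visit sets of a generic point. -/
structure Gen (H : ℕ → ℤ) (V : ℕ → Set ℤ) : Prop where
  vis : Vis H V
  g1 : ∃ j0 : ℕ, ∀ j ≥ j0, ∃ a : ℤ, 0 ≤ a ∧ a < H j ∧ -a ∈ V j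
  g2 : ∃ j0 : ℕ, ∀ j ≥ j0, ∀ A : ℤ, 0 ≤ A → A < H (j + j) → -A ∈ V (j + j) →
    A + 50 * H j < H (j + j)
  g3 : ∀ a : ℤ, ∀ j1 : ℕ, ∃ j ≥ j1, -a ∉ V j

/-- Two generic points have eventually constant offset, or see a shift window infinitely often. -/
lemma trichotomy {H : ℕ → ℤ} (h1 : H 1 = 2)
    (hH : ∀ j : ℕ, 1 ≤ j → H (j + 1) = 3 * H j + j) {V W : ℕ → Set ℤ}
    (hV : Gen H V) (hW : Gen H W) :
    (∃ d : ℤ, ∃ j1 : ℕ, ∀ j ≥ j1, ∃ a : ℤ, 0 ≤ a ∧ a < H j ∧ 0 ≤ a + d ∧ a + d < H j ∧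
      -a ∈ V j ∧ -(a + d) ∈ W j) ∨
    (∃ᶠ j : ℕ in atTop, Win H V W j j (j + 1)) ∨ (∃ᶠ j : ℕ in atTop, Win H V W j (j + 1) j) := by
  by_contra hcon
  simp only [not_or, not_frequently] at hcon
  obtain ⟨hI, hw1, hw2⟩ := hcon
  obtain ⟨J1, hw1⟩ := eventually_atTop.1 hw1
  obtain ⟨J2, hw2⟩ := eventually_atTop.1 hw2
  obtain ⟨J3, hv1⟩ := hV.g1
  obtain ⟨J4, hv2⟩ := hV.g2
  obtain ⟨J5, hv3⟩ := hW.g1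
  obtain ⟨J6, hv4⟩ := hW.g2
  obtain ⟨J, hJ⟩ : ∃ J, J = J1 + J2 + J3 + J4 + J5 + J6 + 1001 := ⟨_, rfl⟩
  have core' : ∀ j ≥ J, ∀ a b : ℤ, 0 ≤ a → a < H j → 0 ≤ b → b < H j → -a ∈ V j → -b ∈ W j →
      ∃ c c', c < 3 ∧ c' < 3 ∧ -(a + off H j c) ∈ V (j + 1) ∧ -(b + off H j c') ∈ W (j + 1) ∧
      ((2 * |a - b| ≤ H j ∧ c = c') ∨ (H j < 2 * (b - a) ∧ c = (c' + 1) % 3) ∨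
        (H j < 2 * (a - b) ∧ c' = (c + 1) % 3)) := by
    intro j hj a b a1 a2 a3 a4 a5 a6
    rcases core h1 hH hV.vis hW.vis (by omega) (hv2 j (by omega)) (hv4 j (by omega))
      a1 a2 a3 a4 a5 a6 with h | h | h
    · exact absurd h (hw1 j (by omega))
    · exact absurd h (hw2 j (by omega))
    · exact h
  have off0 : ∀ j ≥ J, ∀ c, c < 3 → 0 ≤ off H j c ∧ off H j c ≤ 2 * H j + j := by
    intro j hj c hc
    have := H_pos h1 hH j (by omega)
    have : c = 0 ∨ c = 1 ∨ c = 2 := by omega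
    rcases this with rfl | rfl | rfl <;> simp [off] <;> omega
  -- once the offset is small it is constant
  have claim1 : ∀ j ≥ J, ∀ a b : ℤ, 0 ≤ a → a < H j → 0 ≤ b → b < H j → -a ∈ V j → -b ∈ W j →
      2 * |a - b| ≤ H j → False := by
    intro j hj a b a1 a2 a3 a4 a5 a6 a7
    refine hI ⟨b - a, j, ?_⟩
    intro i hi
    have : ∃ a' : ℤ, (0 ≤ a' ∧ a' < H i ∧ 0 ≤ a' + (b - a) ∧ a' + (b - a) < H i ∧
      -a' ∈ V i ∧ -(a' + (b - a)) ∈ W i) ∧ 2 * |a - b| ≤ H i := by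
      induction i, hi using Nat.le_induction with
      | base => exact ⟨a, ⟨a1, a2, by linarith, by linarith, a5, by convert a6 using 2; ring⟩, a7⟩
      | succ i hi ih =>
        obtain ⟨a', ⟨b1, b2, b3, b4, b5, b6⟩, b7⟩ := ih
        have hab : |a' - (a' + (b - a))| = |a - b| := by congr 1; ring
        obtain ⟨c, c', hc, hc', m1, m2, m3⟩ := core' i (by omega) _ _ b1 b2 b3 b4 b5 b6
        have hsm := abs_le.1 (show |a - b| ≤ H i / 2 by omega)
        have hcc : c = c' := by
          rcases m3 with m3 | m3 | m3
          · exact m3.2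
          · omega
          · omega
        subst hcc
        have ho := off0 i (by omega) c hc
        have hh := hH i (by omega)
        have hp := H_pos h1 hH i (by omega)
        refine ⟨a' + off H i c, ⟨by omega, by omega, by omega, by omega, m1, ?_⟩, by omega⟩
        convert m2 using 2; ring
    obtain ⟨a', h, _⟩ := this
    exact ⟨a', h⟩
  have offv : ∀ j, off H j 0 = 0 ∧ off H j 1 = H j ∧ off H j 2 = 2 * H j + j := by
    intro j; simp [off]
  obtain ⟨a, a1, a2, a3⟩ := hv1 J (by omega)
  obtain ⟨b, b1, b2, b3⟩ := hv3 J (by omega)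
  by_cases hsmall : 2 * |a - b| ≤ H J
  · exact claim1 J le_rfl a b a1 a2 b1 b2 a3 b3 hsmall
  have c2 : H J < 2 * (b - a) ∨ H J < 2 * (a - b) := by
    rcases abs_cases (a - b) with ⟨h, _⟩ | ⟨h, _⟩ <;> rw [h] at hsmall
    · right; omega
    · left; omega
  rcases c2 with c2 | c2
  · have : ∀ i ≥ J, a < H i ∧ -a ∈ V i ∧ ∃ b' : ℤ, 0 ≤ b' ∧ b' < H i ∧ -b' ∈ W i ∧
        H i < 2 * (b' - a) := by
      intro i hi
      induction i, hi using Nat.le_induction with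
      | base => exact ⟨a2, a3, b, b1, b2, b3, c2⟩
      | succ i hi ih =>
        obtain ⟨e1, e2, b', e3, e4, e5, e6⟩ := ih
        obtain ⟨c, c', hc, hc', m1, m2, m3⟩ := core' i hi _ _ a1 e1 e3 e4 e2 e5
        have hp := H_big h1 hH i (by omega)
        have hh := hH i (by omega)
        have ho := off0 i (by omega) c hc
        have ho' := off0 i (by omega) c' hc'
        obtain ⟨o0, o1, o2⟩ := offv i
        have hcc : c = (c' + 1) % 3 := by
          rcases m3 with m3 | m3 | m3
          · have := neg_abs_le (a - b'); omega
          · exact m3.2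
          · omega
        have h3 : c' = 0 ∨ c' = 1 ∨ c' = 2 := by omega
        rcases h3 with rfl | rfl | rfl
        · obtain rfl : c = 1 := by omega
          exfalso
          refine claim1 (i + 1) (by omega) _ _ (by omega) (by omega) (by omega) (by omega) m1 m2 ?_
          have : |a + off H i 1 - (b' + off H i 0)| ≤ H (i + 1) / 2 := by
            rw [abs_le]; constructor <;> omega
          omega
        · obtain rfl : c = 2 := by omega
          exfalso
          refine claim1 (i + 1) (by omega) _ _ (by omega) (by omega) (by omega) (by omega) m1 m2 ?_
          have : |a + off H i 2 - (b' + off H i 1)| ≤ H (i + 1) / 2 := by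
            rw [abs_le]; constructor <;> omega
          omega
        · obtain rfl : c = 0 := by omega
          rw [o0, add_zero] at m1
          exact ⟨by omega, m1, b' + off H i 2, by omega, by omega, m2, by omega⟩
    obtain ⟨i, hi, hni⟩ := hV.g3 a J
    exact hni (this i hi).2.1
  · have : ∀ i ≥ J, b < H i ∧ -b ∈ W i ∧ ∃ a' : ℤ, 0 ≤ a' ∧ a' < H i ∧ -a' ∈ V i ∧
        H i < 2 * (a' - b) := by
      intro i hi
      induction i, hi using Nat.le_induction with
      | base => exact ⟨b2, b3, a, a1, a2, a3, c2⟩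
      | succ i hi ih =>
        obtain ⟨e1, e2, a', e3, e4, e5, e6⟩ := ih
        obtain ⟨c, c', hc, hc', m1, m2, m3⟩ := core' i hi _ _ e3 e4 b1 e1 e5 e2
        have hp := H_big h1 hH i (by omega)
        have hh := hH i (by omega)
        have ho := off0 i (by omega) c hc
        have ho' := off0 i (by omega) c' hc'
        obtain ⟨o0, o1, o2⟩ := offv i
        have hcc : c' = (c + 1) % 3 := by
          rcases m3 with m3 | m3 | m3
          · have := le_abs_self (a' - b); omega
          · omega
          · exact m3.2
        have h3 : c = 0 ∨ c = 1 ∨ c = 2 := by omega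
        rcases h3 with rfl | rfl | rfl
        · obtain rfl : c' = 1 := by omega
          exfalso
          refine claim1 (i + 1) (by omega) _ _ (by omega) (by omega) (by omega) (by omega) m1 m2 ?_
          have : |a' + off H i 0 - (b + off H i 1)| ≤ H (i + 1) / 2 := by
            rw [abs_le]; constructor <;> omega
          omega
        · obtain rfl : c' = 2 := by omega
          exfalso
          refine claim1 (i + 1) (by omega) _ _ (by omega) (by omega) (by omega) (by omega) m1 m2 ?_
          have : |a' + off H i 1 - (b + off H i 2)| ≤ H (i + 1) / 2 := by
            rw [abs_le]; constructor <;> omega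
          omega
        · obtain rfl : c' = 0 := by omega
          rw [o0, add_zero] at m2
          exact ⟨by omega, m2, a' + off H i 2, by omega, by omega, m1, by omega⟩
    obtain ⟨i, hi, hni⟩ := hW.g3 b J
    exact hni (this i hi).2.1

/-- Whether a point in level `r` of the stage `j` tower lies in level `α` of the stage `m` tower
depends only on `r`. -/
lemma level_iff {H : ℕ → ℤ} (h1 : H 1 = 2)
    (hH : ∀ j : ℕ, 1 ≤ j → H (j + 1) = 3 * H j + j) {V : ℕ → Set ℤ}
    (hV : Vis H V) {m j : ℕ} (hm : 1 ≤ m) (hmj : m ≤ j) {α r n : ℤ}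
    (hα0 : 0 ≤ α) (hα : α < H m) (hr0 : 0 ≤ r) (hr : r < H j) (hn : n ∈ V j) :
    n + r - α ∈ V m ↔ ∃ p, p < 3 ^ (j - m) ∧ r = α + pos H m (j - m) p := by
  have hj : m + (j - m) = j := by omega
  constructor
  · intro h
    obtain ⟨p, hp, hp'⟩ := pos_exists hV (j - m) m hm _ h
    rw [hj] at hp'
    refine ⟨p, hp, ?_⟩
    have hpos0 : 0 ≤ pos H m (j - m) p := by
      have := pos_mono h1 hH (j - m) m 0 p hm
      rw [zero_add] at this
      have h00 : ∀ k j, pos H j k 0 = 0 := by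
        intro k
        induction k with
        | zero => intro j; simp [pos]
        | succ k ih => intro j; simp [pos, ih, off]
      rw [h00] at this
      have : (0:ℤ) ≤ p * H m := by apply mul_nonneg <;> omega
      linarith
    have hlt : α + pos H m (j - m) p < H j := by
      have := pos_mono h1 hH (j - m) m p (3 ^ (j - m) - p) hm
      rw [show p + (3 ^ (j - m) - p) = 3 ^ (j - m) by omega, pos_pow, hj] at this
      have h1 : (1:ℤ) ≤ ((3 ^ (j - m) - p : ℕ) : ℤ) := by
        have : 1 ≤ 3 ^ (j - m) - p := by omega
        exact_mod_cast this
      nlinarith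
    rcases lt_trichotomy n (n + r - α - pos H m (j - m) p) with h | h | h
    · have := hV.s2 j (by omega) _ _ hn hp' h; omega
    · omega
    · have := hV.s2 j (by omega) _ _ hp' hn h; omega
  · rintro ⟨p, hp, rfl⟩
    have := pos_mem hV (j - m) m hm p hp n (by rwa [hj])
    convert this using 1; ring


/-- The transformation as a permutation. -/
def ChaconMap.perm {X : Type*} [MeasurableSpace X] {μ : Measure X} {s : ℕ → ℕ}
    (C : ChaconMap μ s) : Equiv.Perm X := C.T.toEquiv

/-- The number of levels of the `j`-th tower. -/
def ChaconMap.ht {X : Type*} [MeasurableSpace X] {μ : Measure X} {s : ℕ → ℕ}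
    (C : ChaconMap μ s) (j : ℕ) : ℤ := (C.h j : ℤ) + 1

/-- The visit times of `x` to the base of the `j`-th tower. -/
def ChaconMap.vs {X : Type*} [MeasurableSpace X] {μ : Measure X} {s : ℕ → ℕ}
    (C : ChaconMap μ s) (x : X) (j : ℕ) : Set ℤ := {n | (C.perm ^ n) x ∈ C.E j}

section part3a
variable {X : Type*} [MeasurableSpace X] {μ : Measure X}

lemma perm_coe_iterZ (T : X ≃ᵐ X) (n : ℤ) : T.iterZ n = ⇑((T.toEquiv : Equiv.Perm X) ^ n) := by
  cases n with
  | ofNat n =>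
    ext x
    simp only [MeasurableEquiv.iterZ, Int.ofNat_eq_natCast, zpow_natCast]
    rw [← Equiv.Perm.iterate_eq_pow]; rfl
  | negSucc n =>
    ext x
    simp only [MeasurableEquiv.iterZ, zpow_negSucc]
    rw [← inv_pow, ← Equiv.Perm.iterate_eq_pow]; rfl

lemma perm_nat {s : ℕ → ℕ} (C : ChaconMap μ s) (n : ℕ) :
    (⇑C.T)^[n] = ⇑(C.perm ^ (n : ℤ)) := (perm_coe_iterZ C.T n)

lemma perm_mp {s : ℕ → ℕ} (C : ChaconMap μ s) (n : ℤ) : MeasurePreserving (⇑(C.perm ^ n)) μ μ := by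
  have := perm_coe_iterZ C.T n
  unfold ChaconMap.perm
  rw [← this]
  cases n with
  | ofNat n => exact C.measurePreserving.iterate n
  | negSucc n => exact (C.measurePreserving.symm C.T).iterate (n + 1)

lemma perm_image {s : ℕ → ℕ} (C : ChaconMap μ s) (n : ℤ) (B : Set X) :
    ⇑(C.perm ^ n) '' B = {x | (C.perm ^ (-n)) x ∈ B} := by
  ext x
  simp only [Set.mem_image]
  constructor
  · rintro ⟨y, hy, rfl⟩
    simpa using hy
  · intro h
    exact ⟨_, h, by simp⟩

lemma level_image {s : ℕ → ℕ} (C : ChaconMap μ s) (n : ℕ) (B : Set X) :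
    (⇑C.T)^[n] '' B = {x | (C.perm ^ (-(n : ℤ))) x ∈ B} := by
  rw [perm_nat, perm_image]

lemma perm_add {s : ℕ → ℕ} (C : ChaconMap μ s) (m n : ℤ) (x : X) :
    (C.perm ^ m) ((C.perm ^ n) x) = (C.perm ^ (m + n)) x := by
  rw [zpow_add]; rfl

lemma ht_one {s : ℕ → ℕ} (C : ChaconMap μ s) : C.ht 1 = 2 := by simp [ChaconMap.ht, C.h_one]

lemma ht_succ (C : ChaconMap μ (fun j => j)) : ∀ j : ℕ, 1 ≤ j → C.ht (j + 1) = 3 * C.ht j + j := by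
  intro j hj
  simp only [ChaconMap.ht, C.h_succ j hj]; push_cast; ring

lemma mem_vs_iff {s : ℕ → ℕ} (C : ChaconMap μ s) (x : X) (j : ℕ) (n : ℤ) :
    n ∈ C.vs x j ↔ (C.perm ^ n) x ∈ C.E j := Iff.rfl

lemma mem_vs_shift {s : ℕ → ℕ} (C : ChaconMap μ s) (x : X) (j : ℕ) (m n : ℤ) :
    m ∈ C.vs ((C.perm ^ n) x) j ↔ m + n ∈ C.vs x j := by
  simp only [mem_vs_iff, perm_add]

lemma ae_shift {s : ℕ → ℕ} (C : ChaconMap μ s) {p : X → Prop} (hp : ∀ᵐ x ∂μ, p x) :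
    ∀ᵐ x ∂μ, ∀ n : ℤ, p ((C.perm ^ n) x) := by
  rw [ae_all_iff]
  intro n
  exact (perm_mp C n).quasiMeasurePreserving.ae hp

lemma ae_iff_of_symmDiff {A B : Set X} (h : μ (A ∆ B) = 0) : ∀ᵐ x ∂μ, x ∈ A ↔ x ∈ B := by
  have := measure_symmDiff_eq_zero_iff.1 h
  filter_upwards [this] with x hx
  exact iff_of_eq hx

lemma ae_vis (C : ChaconMap μ (fun j => j)) : ∀ᵐ x ∂μ, Vis C.ht (C.vs x) := by
  have a1 : ∀ᵐ x ∂μ, ∀ j, 1 ≤ j → ∀ n : ℤ, ((C.perm ^ (-C.ht j)) ((C.perm ^ n) x) ∈ C.E1 j ↔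
      (C.perm ^ n) x ∈ C.E2 j) := by
    rw [ae_all_iff]; intro j
    by_cases hj : 1 ≤ j
    · have := C.stack1 j hj
      rw [level_image] at this
      filter_upwards [ae_shift C (ae_iff_of_symmDiff this)] with x hx _ n
      have := hx n
      simpa [ChaconMap.ht] using this
    · exact Eventually.of_forall fun x h => absurd h hj
  have a2 : ∀ᵐ x ∂μ, ∀ j, 1 ≤ j → ∀ n : ℤ, ((C.perm ^ (-(C.ht j + j))) ((C.perm ^ n) x) ∈ C.E2 j ↔
      (C.perm ^ n) x ∈ C.E3 j) := by
    rw [ae_all_iff]; intro j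
    by_cases hj : 1 ≤ j
    · have := C.stack2 j hj
      rw [level_image] at this
      filter_upwards [ae_shift C (ae_iff_of_symmDiff this)] with x hx _ n
      have := hx n
      simpa [ChaconMap.ht] using this
    · exact Eventually.of_forall fun x h => absurd h hj
  filter_upwards [a1, a2] with x h1 h2
  simp only [perm_add] at h1 h2
  have key1 : ∀ j, 1 ≤ j → ∀ n : ℤ, n ∈ C.vs x (j + 1) ↔ (C.perm ^ n) x ∈ C.E1 j := by
    intro j hj n; rw [mem_vs_iff, C.E_next j hj]
  have hU : ∀ j, 1 ≤ j → ∀ n : ℤ, n ∈ C.vs x j ↔ ((C.perm ^ n) x ∈ C.E1 j ∨ (C.perm ^ n) x ∈ C.E2 j) ∨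
      (C.perm ^ n) x ∈ C.E3 j := by
    intro j hj n; rw [mem_vs_iff, C.E_union j hj]; rfl
  refine ⟨?_, ?_, ?_, ?_, ?_⟩
  · intro j hj n hn
    rw [key1 j hj] at hn
    rw [hU j hj]; tauto
  · intro j hj n hn
    rw [key1 j hj] at hn
    rw [hU j hj]
    have := h1 j hj (n + C.ht j)
    rw [show -C.ht j + (n + C.ht j) = n by ring] at this
    tauto
  · intro j hj n hn
    rw [key1 j hj] at hn
    rw [hU j hj]
    have := h1 j hj (n + C.ht j)
    rw [show -C.ht j + (n + C.ht j) = n by ring] at this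
    have h' := h2 j hj (n + (2 * C.ht j + j))
    rw [show -(C.ht j + j) + (n + (2 * C.ht j + j)) = n + C.ht j by ring] at h'
    tauto
  · intro j hj n hn
    rw [hU j hj] at hn
    rw [key1 j hj, key1 j hj, key1 j hj]
    have e1 := h1 j hj n
    have e2 := h2 j hj n
    have e3 := h1 j hj (-(C.ht j + j) + n)
    rw [show -C.ht j + n = n - C.ht j by ring] at e1
    rw [show -C.ht j + (-(C.ht j + j) + n) = n - (2 * C.ht j + j) by ring] at e3
    tauto
  · intro j hj n n' hn hn' hlt
    by_contra hcon
    push Not at hcon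
    obtain ⟨i, hi⟩ : ∃ i : ℕ, n' = i + n := ⟨(n' - n).toNat, by omega⟩
    simp only [ChaconMap.ht] at hcon
    have hd := C.tower_disjoint j hj i (by omega) 0 (by omega) (by omega)
    rw [level_image, level_image] at hd
    refine (Set.disjoint_left.1 hd) (?_ : (C.perm ^ n') x ∈ _) ?_
    · change (C.perm ^ (-(i : ℤ))) ((C.perm ^ n') x) ∈ C.E j
      rw [perm_add, hi, show -(i : ℤ) + (i + n) = n by ring]; exact hn
    · simpa using (mem_vs_iff C x j n').1 hn'

lemma E_meas_succ {s : ℕ → ℕ} (C : ChaconMap μ s) (j : ℕ) (hj : 1 ≤ j) :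
    3 * μ.real (C.E (j + 1)) = μ.real (C.E j) ∨ μ (C.E j) = ⊤ := by
  by_cases htop : μ (C.E j) = ⊤
  · right; exact htop
  left
  have e := C.E_union j hj
  have f1 : μ (C.E1 j) ≠ ⊤ := fun h => htop (top_le_iff.1 (h ▸ measure_mono (by rw [e]; intro x hx; exact Or.inl (Or.inl hx))))
  have f2 : μ (C.E2 j) ≠ ⊤ := C.E_meas12 j hj ▸ f1
  have f3 : μ (C.E3 j) ≠ ⊤ := C.E_meas23 j hj ▸ f2
  rw [e, measureReal_union _ (C.measE3 j) _ f3, measureReal_union (C.E_disj12 j hj) (C.measE2 j) f1 f2, C.E_next j hj]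
  · have := C.E_meas12 j hj
    have h2 := C.E_meas23 j hj
    simp only [Measure.real]
    rw [← h2, ← this]; ring
  · rw [Set.disjoint_union_left]; exact ⟨C.E_disj13 j hj, C.E_disj23 j hj⟩
  · exact (measure_union_lt_top f1.lt_top f2.lt_top).ne

lemma E_meas_pow {s : ℕ → ℕ} [IsFiniteMeasure μ] (C : ChaconMap μ s) (j : ℕ) (hj : 1 ≤ j) (k : ℕ) :
    3 ^ k * μ.real (C.E (j + k)) = μ.real (C.E j) := by
  induction k with
  | zero => simp
  | succ k ih =>
    have := (E_meas_succ C (j + k) (by omega)).resolve_right (measure_ne_top _ _)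
    rw [← ih, ← this, ← add_assoc]; ring

lemma E_meas_ht {s : ℕ → ℕ} [IsProbabilityMeasure μ] (C : ChaconMap μ s) (j : ℕ) (hj : 1 ≤ j) :
    (C.ht j : ℝ) * μ.real (C.E j) ≤ 1 := by
  have h1 : ∀ i : ℕ, μ.real ((⇑C.T)^[i] '' C.E j) = μ.real (C.E j) := by
    intro i
    rw [level_image]
    exact (perm_mp C (-(i : ℤ))).measureReal_preimage (C.measE j).nullMeasurableSet
  have h2 : ∀ i : ℕ, MeasurableSet ((⇑C.T)^[i] '' C.E j) := by
    intro i
    rw [level_image]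
    exact (perm_mp C (-(i : ℤ))).measurable (C.measE j)
  have h3 := measureReal_biUnion_finset (μ := μ) (s := Finset.range (C.h j + 1))
    (f := fun i => (⇑C.T)^[i] '' C.E j) (fun a ha b hb hab => by
      simp only [Finset.coe_range, Set.mem_Iio] at ha hb
      exact C.tower_disjoint j hj a (by omega) b (by omega) hab) (fun i _ => h2 i)
  simp only [h1, Finset.sum_const, Finset.card_range, nsmul_eq_mul] at h3
  have := measureReal_le_one (μ := μ) (s := ⋃ i ∈ Finset.range (C.h j + 1), (⇑C.T)^[i] '' C.E j)
  rw [h3] at this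
  simpa [ChaconMap.ht] using this

lemma vs_meas {s : ℕ → ℕ} (C : ChaconMap μ s) (j : ℕ) (n : ℤ) :
    μ.real {x | n ∈ C.vs x j} = μ.real (C.E j) :=
  (perm_mp C n).measureReal_preimage (C.measE j).nullMeasurableSet

lemma vs_measurable {s : ℕ → ℕ} (C : ChaconMap μ s) (j : ℕ) (n : ℤ) :
    MeasurableSet {x | n ∈ C.vs x j} :=
  (perm_mp C n).measurable (C.measE j)

lemma ae_g3 [IsProbabilityMeasure μ] (C : ChaconMap μ (fun j => j)) :
    ∀ᵐ x ∂μ, ∀ a : ℤ, ∀ j1 : ℕ, ∃ j ≥ j1, -a ∉ C.vs x j := by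
  rw [ae_all_iff]; intro a
  rw [ae_all_iff]; intro j1
  have hlim : Tendsto (fun k : ℕ => ((1 : ℝ) / 3) ^ k) atTop (𝓝 0) :=
    tendsto_pow_atTop_nhds_zero_of_lt_one (by norm_num) (by norm_num)
  rw [ae_iff]
  have h0 : μ.real {x | ¬ ∃ j ≥ j1, -a ∉ C.vs x j} ≤ 0 := by
    refine ge_of_tendsto hlim ?_
    filter_upwards [eventually_ge_atTop j1] with k hk
    have h1 : μ.real {x | ¬ ∃ j ≥ j1, -a ∉ C.vs x j} ≤ μ.real {x | -a ∈ C.vs x (1 + k)} := by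
      refine measureReal_mono ?_
      intro x hx
      simp only [Set.mem_ofPred_eq, not_exists, not_and, not_not] at hx ⊢
      exact hx (1 + k) (by omega)
    rw [vs_meas] at h1
    have h2 := E_meas_pow C 1 le_rfl k
    have h3 := measureReal_le_one (μ := μ) (s := C.E 1)
    refine h1.trans ?_
    rw [one_div, inv_pow, ← one_div, le_div_iff₀ (by positivity)]
    linarith
  have h1 : μ.real {x | ¬ ∃ j ≥ j1, -a ∉ C.vs x j} = 0 := le_antisymm h0 measureReal_nonneg
  exact (measureReal_eq_zero_iff (measure_ne_top _ _)).1 h1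

lemma ae_g1 [IsProbabilityMeasure μ] (C : ChaconMap μ (fun j => j)) :
    ∀ᵐ x ∂μ, ∃ j0 : ℕ, ∀ j ≥ j0, ∃ a : ℤ, 0 ≤ a ∧ a < C.ht j ∧ -a ∈ C.vs x j := by
  have hex : ∀ᵐ x ∂μ, ∃ j0 : ℕ, 1 ≤ j0 ∧ ∃ a : ℤ, 0 ≤ a ∧ a < C.ht j0 ∧ -a ∈ C.vs x j0 := by
    have hm : MeasurableSet {x | ∃ j0 : ℕ, 1 ≤ j0 ∧ ∃ a : ℤ, 0 ≤ a ∧ a < C.ht j0 ∧ -a ∈ C.vs x j0} := by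
      have : {x | ∃ j0 : ℕ, 1 ≤ j0 ∧ ∃ a : ℤ, 0 ≤ a ∧ a < C.ht j0 ∧ -a ∈ C.vs x j0} =
          ⋃ j0 : ℕ, ⋃ _ : 1 ≤ j0, ⋃ a : ℤ, ⋃ _ : 0 ≤ a, ⋃ _ : a < C.ht j0, {x | -a ∈ C.vs x j0} := by
        ext x; simp only [Set.mem_iUnion, exists_prop]; rfl
      rw [this]
      refine MeasurableSet.iUnion fun j => MeasurableSet.iUnion fun _ => MeasurableSet.iUnion fun a =>
        MeasurableSet.iUnion fun _ => MeasurableSet.iUnion fun _ => vs_measurable C j _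
    have h1 : μ {x | ∃ j0 : ℕ, 1 ≤ j0 ∧ ∃ a : ℤ, 0 ≤ a ∧ a < C.ht j0 ∧ -a ∈ C.vs x j0} = 1 := by
      refine le_antisymm prob_le_one (le_of_tendsto C.tower_full ?_)
      filter_upwards [eventually_ge_atTop 1] with j hj
      refine measure_mono ?_
      intro x hx
      simp only [Set.mem_iUnion, Finset.mem_range] at hx
      obtain ⟨i, hi, hx⟩ := hx
      rw [level_image] at hx
      exact ⟨j, hj, i, by positivity, by simp only [ChaconMap.ht]; omega, hx⟩
    exact (mem_ae_iff_prob_eq_one hm).2 h1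
  filter_upwards [hex, ae_vis C] with x ⟨j0, hj0, h0⟩ hv
  refine ⟨j0, fun j hj => ?_⟩
  induction j, hj using Nat.le_induction with
  | base => exact h0
  | succ j hj ih =>
    obtain ⟨a, ha0, ha, hm⟩ := ih
    have hj1 : 1 ≤ j := hj0.trans hj
    have hs := ht_succ C j hj1
    have hp : 0 < C.ht j := H_pos (ht_one C) (ht_succ C) j hj1
    rcases hv.s1 j hj1 _ hm with h | h | h
    · exact ⟨a, ha0, by omega, h⟩
    · exact ⟨a + C.ht j, by omega, by omega, by rwa [show -(a + C.ht j) = -a - C.ht j by ring]⟩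
    · exact ⟨a + (2 * C.ht j + j), by omega, by omega, by
        rwa [show -(a + (2 * C.ht j + j)) = -a - (2 * C.ht j + j) by ring]⟩

lemma ae_g2 [IsProbabilityMeasure μ] (C : ChaconMap μ (fun j => j)) :
    ∀ᵐ x ∂μ, ∃ j0 : ℕ, ∀ j ≥ j0, ∀ A : ℤ, 0 ≤ A → A < C.ht (j + j) → -A ∈ C.vs x (j + j) →
    A + 50 * C.ht j < C.ht (j + j) := by
  set S : ℕ → Set X := fun j => ⋃ A ∈ Finset.Ico (C.ht (j + j) - 50 * C.ht j) (C.ht (j + j)),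
    {x | -A ∈ C.vs x (j + j)} with hS
  have hb : ∀ j : ℕ, 1 ≤ j → μ.real (S j) ≤ 50 * (1 / 3) ^ j := by
    intro j hj
    have hp : 0 < C.ht j := H_pos (ht_one C) (ht_succ C) j hj
    refine (measureReal_biUnion_finset_le _ _).trans ?_
    simp only [vs_meas, Finset.sum_const, Int.card_Ico, nsmul_eq_mul]
    have h1 := E_meas_pow C j hj j
    have h2 := E_meas_ht C j hj
    have h3 : (((C.ht (j + j) - (C.ht (j + j) - 50 * C.ht j)).toNat : ℕ) : ℝ) = 50 * C.ht j := by
      rw [show C.ht (j + j) - (C.ht (j + j) - 50 * C.ht j) = 50 * C.ht j by ring]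
      have : (((50 * C.ht j).toNat : ℕ) : ℤ) = 50 * C.ht j := Int.toNat_of_nonneg (by positivity)
      exact_mod_cast this
    rw [h3, one_div, inv_pow]
    rw [← h1] at h2
    rw [← div_eq_mul_inv, le_div_iff₀ (by positivity)]
    nlinarith
  have hsum : ∑' j, μ (S j) ≠ ⊤ := by
    have hs : Summable fun j : ℕ => μ.real (S j) := by
      have hg : Summable fun j : ℕ => (50 : ℝ) * (1 / 3) ^ j :=
        (summable_geometric_of_lt_one (by norm_num) (by norm_num)).mul_left _
      have hg1 := (summable_nat_add_iff 1).2 hg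
      refine (summable_nat_add_iff 1).1 (Summable.of_nonneg_of_le (fun _ => measureReal_nonneg) (fun j => ?_) hg1)
      exact hb (j + 1) (by omega)
    have := hs.tsum_ofReal_ne_top
    simpa [ofReal_measureReal] using this
  filter_upwards [ae_eventually_notMem hsum] with x hx
  obtain ⟨j0, hj0⟩ := eventually_atTop.1 hx
  refine ⟨j0, fun j hj A _ hA hm => ?_⟩
  by_contra hcon
  refine hj0 j hj ?_
  simp only [hS, Set.mem_iUnion, Finset.mem_Ico]
  exact ⟨A, ⟨by omega, hA⟩, hm⟩

lemma ae_gen [IsProbabilityMeasure μ] (C : ChaconMap μ (fun j => j)) :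
    ∀ᵐ x ∂μ, Gen C.ht (C.vs x) := by
  filter_upwards [ae_vis C, ae_g1 C, ae_g2 C, ae_g3 C] with x a b c d
  exact ⟨a, b, c, d⟩

end part3a


section part3b
variable {X : Type*} [MeasurableSpace X] {μ : Measure X}

/-- The level `α` of the `m`-th tower. -/
def ChaconMap.lev {s : ℕ → ℕ} (C : ChaconMap μ s) (m : ℕ) (α : ℤ) : Set X := {x | -α ∈ C.vs x m}

lemma lev_measurable {s : ℕ → ℕ} (C : ChaconMap μ s) (m : ℕ) (α : ℤ) : MeasurableSet (C.lev m α) :=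
  vs_measurable C m _

lemma lev_inter (C : ChaconMap μ (fun j => j)) {m m' : ℕ} {α α' : ℤ} (hm : 1 ≤ m) (hmm : m ≤ m')
    (ha0 : 0 ≤ α) (ha : α < C.ht m) (hb0 : 0 ≤ α') (hb : α' < C.ht m') :
    (C.lev m α ∩ C.lev m' α' : Set X) =ᵐ[μ] C.lev m' α' ∨ (C.lev m α ∩ C.lev m' α' : Set X) =ᵐ[μ] (∅ : Set X) := by
  by_cases hp : ∃ p, p < 3 ^ (m' - m) ∧ α' = α + pos C.ht m (m' - m) p
  · left
    filter_upwards [ae_vis C] with x hx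
    refine propext ⟨fun h => h.2, fun h => ⟨?_, h⟩⟩
    have := (level_iff (ht_one C) (ht_succ C) hx hm hmm ha0 ha hb0 hb h).2 hp
    rw [show -α' + α' - α = -α by ring] at this
    exact this
  · right
    filter_upwards [ae_vis C] with x hx
    refine propext ⟨fun h => hp ?_, fun h => h.elim⟩
    refine (level_iff (ht_one C) (ht_succ C) hx hm hmm ha0 ha hb0 hb h.2).1 ?_
    rw [show -α' + α' - α = -α by ring]
    exact h.1

lemma ext_levels (C : ChaconMap μ (fun j => j)) {ρ₁ ρ₂ : Measure X} [IsFiniteMeasure ρ₁]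
    (h1 : ρ₁ ≪ μ) (h2 : ρ₂ ≪ μ) (hu : ρ₁ Set.univ = ρ₂ Set.univ)
    (hl : ∀ m α, 1 ≤ m → 0 ≤ α → α < C.ht m → ρ₁ (C.lev m α) = ρ₂ (C.lev m α))
    {A : Set X} (hA : MeasurableSet A) : ρ₁ A = ρ₂ A := by
  set P : Set (Set X) := {S | MeasurableSet S ∧ (S =ᵐ[μ] (∅ : Set X) ∨
    ∃ m α, 1 ≤ m ∧ 0 ≤ α ∧ α < C.ht m ∧ S =ᵐ[μ] C.lev m α)} with hP
  have hpi : IsPiSystem P := by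
    rintro S ⟨hS, hS'⟩ S' ⟨hT, hT'⟩ _
    refine ⟨hS.inter hT, ?_⟩
    rcases hS' with h | ⟨m, α, hm, ha0, ha, h⟩
    · left; simpa using h.inter (EventuallyEq.refl (ae μ) S')
    rcases hT' with h' | ⟨m', α', hm', hb0, hb, h'⟩
    · left; simpa using (EventuallyEq.refl (ae μ) S).inter h'
    have hi := h.inter h'
    rcases le_total m m' with hmm | hmm
    · rcases lev_inter C hm hmm ha0 ha hb0 hb with k | k
      · right; exact ⟨m', α', hm', hb0, hb, hi.trans k⟩
      · left; exact hi.trans k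
    · rw [Set.inter_comm (C.lev m α)] at hi
      rcases lev_inter C hm' hmm hb0 hb ha0 ha with k | k
      · right; exact ⟨m, α, hm, ha0, ha, hi.trans k⟩
      · left; exact hi.trans k
  have hag : ∀ S ∈ P, ρ₁ S = ρ₂ S := by
    rintro S ⟨hS, h | ⟨m, α, hm, ha0, ha, h⟩⟩
    · rw [measure_congr (h1.ae_eq h), measure_congr (h2.ae_eq h)]; simp
    · rw [measure_congr (h1.ae_eq h), measure_congr (h2.ae_eq h)]; exact hl m α hm ha0 ha
  obtain ⟨B, hB, hAB⟩ := C.generates A hA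
  have hB' : MeasurableSet[MeasurableSpace.generateFrom P] B := by
    refine MeasurableSpace.generateFrom_mono ?_ B hB
    rintro S ⟨j, hj, i, hi, rfl⟩
    rw [level_image]
    refine ⟨lev_measurable C j i, Or.inr ⟨j, i, hj, by positivity, by simp only [ChaconMap.ht]; omega, ?_⟩⟩
    exact EventuallyEq.rfl
  have hle : MeasurableSpace.generateFrom P ≤ ‹MeasurableSpace X› :=
    MeasurableSpace.generateFrom_le fun S hS => hS.1
  have := ext_on_measurableSpace_of_generate_finite _ P hag hle rfl hpi hu hB'
  have hae := measure_symmDiff_eq_zero_iff.1 hAB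
  rw [measure_congr (h1.ae_eq hae), measure_congr (h2.ae_eq hae)]; exact this

lemma ext_prod (C : ChaconMap μ (fun j => j)) {ν₁ ν₂ : Measure (X × X)} [IsFiniteMeasure ν₁]
    (a1 : ∀ A : Set X, MeasurableSet A → ν₁ (A ×ˢ (Set.univ : Set X)) = μ A)
    (b1 : ∀ A : Set X, MeasurableSet A → ν₁ ((Set.univ : Set X) ×ˢ A) = μ A)
    (a2 : ∀ A : Set X, MeasurableSet A → ν₂ (A ×ˢ (Set.univ : Set X)) = μ A)
    (b2 : ∀ A : Set X, MeasurableSet A → ν₂ ((Set.univ : Set X) ×ˢ A) = μ A)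
    (hl : ∀ m α m' β, 1 ≤ m → 0 ≤ α → α < C.ht m → 1 ≤ m' → 0 ≤ β → β < C.ht m' →
      ν₁ (C.lev m α ×ˢ C.lev m' β) = ν₂ (C.lev m α ×ˢ C.lev m' β))
    {A B : Set X} (hA : MeasurableSet A) (hB : MeasurableSet B) : ν₁ (A ×ˢ B) = ν₂ (A ×ˢ B) := by
  have s1 : ∀ (ν : Measure (X × X)) {A B : Set X} (_ : MeasurableSet A) (_ : MeasurableSet B),
      ((ν.restrict (A ×ˢ Set.univ)).map Prod.snd) B = ν (A ×ˢ B) := by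
    intro ν A B hA hB
    rw [Measure.map_apply measurable_snd hB, Measure.restrict_apply (measurable_snd hB)]
    congr 1; ext z; simp [and_comm]
  have s2 : ∀ (ν : Measure (X × X)) {A B : Set X} (_ : MeasurableSet A) (_ : MeasurableSet B),
      ((ν.restrict (Set.univ ×ˢ B)).map Prod.fst) A = ν (A ×ˢ B) := by
    intro ν A B hA hB
    rw [Measure.map_apply measurable_fst hA, Measure.restrict_apply (measurable_fst hA)]
    congr 1; ext z; simp
  have ac1 : ∀ (ν : Measure (X × X)) (_ : ∀ A : Set X, MeasurableSet A → ν ((Set.univ : Set X) ×ˢ A) = μ A)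
      (A : Set X) (_ : MeasurableSet A), ((ν.restrict (A ×ˢ Set.univ)).map Prod.snd) ≪ μ := by
    intro ν h A hA
    refine Measure.AbsolutelyContinuous.mk fun S hS h0 => ?_
    rw [s1 ν hA hS]
    refine measure_mono_null (Set.prod_mono_left (Set.subset_univ A)) ?_
    rw [h S hS, h0]
  have ac2 : ∀ (ν : Measure (X × X)) (_ : ∀ A : Set X, MeasurableSet A → ν (A ×ˢ (Set.univ : Set X)) = μ A)
      (B : Set X) (_ : MeasurableSet B), ((ν.restrict (Set.univ ×ˢ B)).map Prod.fst) ≪ μ := by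
    intro ν h B hB
    refine Measure.AbsolutelyContinuous.mk fun S hS h0 => ?_
    rw [s2 ν hS hB]
    refine measure_mono_null (Set.prod_mono_right (Set.subset_univ B)) ?_
    rw [h S hS, h0]
  have step : ∀ m α, 1 ≤ m → 0 ≤ α → α < C.ht m → ∀ B, MeasurableSet B →
      ν₁ (C.lev m α ×ˢ B) = ν₂ (C.lev m α ×ˢ B) := by
    intro m α hm ha0 ha B hB
    have hm' := lev_measurable C m α
    rw [← s1 ν₁ hm' hB, ← s1 ν₂ hm' hB]
    refine ext_levels C (ac1 ν₁ b1 _ hm') (ac1 ν₂ b2 _ hm') ?_ ?_ hB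
    · rw [s1 ν₁ hm' MeasurableSet.univ, s1 ν₂ hm' MeasurableSet.univ, a1 _ hm', a2 _ hm']
    · intro m' β h1 h2 h3
      rw [s1 ν₁ hm' (lev_measurable C _ _), s1 ν₂ hm' (lev_measurable C _ _)]
      exact hl _ _ _ _ hm ha0 ha h1 h2 h3
  rw [← s2 ν₁ hA hB, ← s2 ν₂ hA hB]
  refine ext_levels C (ac2 ν₁ a1 _ hB) (ac2 ν₂ a2 _ hB) ?_ ?_ hA
  · rw [s2 ν₁ MeasurableSet.univ hB, s2 ν₂ MeasurableSet.univ hB, b1 _ hB, b2 _ hB]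
  · intro m α h1 h2 h3
    rw [s2 ν₁ (lev_measurable C _ _) hB, s2 ν₂ (lev_measurable C _ _) hB]
    exact step m α h1 h2 h3 B hB

end part3b


/-- Two sequences with averages agreeing on long shifted windows have equal averages. -/
lemma window_eq {a b : ℕ → ℝ} {c c' : ℝ}
    (ha : ∀ ε : ℝ, 0 < ε → ∃ K : ℝ, ∀ n : ℕ, |∑ k ∈ Finset.range n, a k - n * c| ≤ ε * n + K)
    (hb : ∀ ε : ℝ, 0 < ε → ∃ K : ℝ, ∀ n : ℕ, |∑ k ∈ Finset.range n, b k - n * c'| ≤ ε * n + K)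
    (hw : ∀ N : ℕ, ∃ u v l : ℕ, N ≤ l ∧ u ≤ 400 * l ∧ v ≤ 400 * l ∧
      ∀ t < l, a (u + t) = b (v + t)) : c = c' := by
  by_contra hne
  set δ := |c - c'| with hδ
  have hδ0 : 0 < δ := abs_pos.2 (sub_ne_zero.2 hne)
  obtain ⟨Ka, hKa⟩ := ha (δ / 4000) (by positivity)
  obtain ⟨Kb, hKb⟩ := hb (δ / 4000) (by positivity)
  obtain ⟨N, hN⟩ := exists_nat_gt ((4 * (Ka + Kb)) / δ)
  obtain ⟨u, v, l, hl, hu, hv, heq⟩ := hw (max N 1)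
  rw [div_lt_iff₀ hδ0] at hN
  have hlN : (N : ℝ) ≤ l := by exact_mod_cast (le_max_left _ _).trans hl
  have hl1 : (1 : ℝ) ≤ l := by exact_mod_cast (le_max_right _ _).trans hl
  have hu' : (u : ℝ) ≤ 400 * l := by exact_mod_cast hu
  have hv' : (v : ℝ) ≤ 400 * l := by exact_mod_cast hv
  have e1 := abs_le.1 (hKa u)
  have e2 := abs_le.1 (hKa (u + l))
  have e3 := abs_le.1 (hKb v)
  have e4 := abs_le.1 (hKb (v + l))
  rw [Finset.sum_range_add] at e2 e4
  have hs : ∑ x ∈ Finset.range l, a (u + x) = ∑ x ∈ Finset.range l, b (v + x) :=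
    Finset.sum_congr rfl fun t ht => heq t (Finset.mem_range.1 ht)
  push_cast at e2 e4
  rw [hs] at e2
  have m1 : δ * u ≤ δ * (400 * l) := mul_le_mul_of_nonneg_left hu' hδ0.le
  have m2 : δ * v ≤ δ * (400 * l) := mul_le_mul_of_nonneg_left hv' hδ0.le
  have m3 : N * δ ≤ l * δ := mul_le_mul_of_nonneg_right hlN hδ0.le
  have m4 : 0 < δ * l := by positivity
  have key : |(l : ℝ) * (c - c')| ≤ 1602 * (δ / 4000) * l + 2 * (Ka + Kb) := by
    rw [abs_le]
    constructor <;> linarith [e1.1, e1.2, e2.1, e2.2, e3.1, e3.2, e4.1, e4.2]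
  rw [abs_mul, abs_of_nonneg (by positivity : (0 : ℝ) ≤ l), ← hδ] at key
  linarith

section part3c
variable {X : Type*} [MeasurableSpace X] {μ : Measure X}

lemma prod_iter {s : ℕ → ℕ} (C : ChaconMap μ s) (k : ℕ) (z : X × X) :
    (fun x : X × X => (C.T x.1, C.T x.2))^[k] z = ((C.perm ^ (k : ℤ)) z.1, (C.perm ^ (k : ℤ)) z.2) := by
  have := Prod.map_iterate (⇑C.T) (⇑C.T) k
  rw [perm_nat] at this
  exact congrFun this z

/-- Case of constant offset. -/
lemma case_const (C : ChaconMap μ (fun j => j)) {x y : X} (hx : Gen C.ht (C.vs x))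
    (hy : Gen C.ht (C.vs y)) {d : ℤ}
    (hd : ∃ j1 : ℕ, ∀ j ≥ j1, ∃ a : ℤ, 0 ≤ a ∧ a < C.ht j ∧ 0 ≤ a + d ∧ a + d < C.ht j ∧
      -a ∈ C.vs x j ∧ -(a + d) ∈ C.vs y j) {m : ℕ} {β : ℤ} (hm : 1 ≤ m) (h0 : 0 ≤ β) (hβ : β < C.ht m)
    (k : ℕ) : (k : ℤ) - β ∈ C.vs y m ↔ k + d - β ∈ C.vs x m := by
  obtain ⟨j1, hj1⟩ := hd
  obtain ⟨j2, hj2⟩ := hy.g2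
  set j := j1 + j2 + m + k + 1
  obtain ⟨a, a0, a1, b0, b1, hax, hay⟩ := hj1 (j + j) (by omega)
  have hr := hj2 j (by omega) _ b0 b1 hay
  have hsq := H_sq (ht_one C) (ht_succ C) j (by omega)
  have hjk : (k : ℤ) + 1 ≤ j := by omega
  have hk : (k : ℤ) < 50 * C.ht j := by nlinarith
  have e1 := level_iff (ht_one C) (ht_succ C) hy.vis hm (show m ≤ j + j by omega) h0 hβ
    (show 0 ≤ a + d + k by omega) (by omega) hay
  have e2 := level_iff (ht_one C) (ht_succ C) hx.vis hm (show m ≤ j + j by omega) h0 hβ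
    (show 0 ≤ a + d + k by omega) (by omega) hax
  rw [show -(a + d) + (a + d + k) - β = k - β by ring] at e1
  rw [show -a + (a + d + k) - β = k + d - β by ring] at e2
  rw [e1, e2]

/-- Case of shift windows. -/
lemma case_win (C : ChaconMap μ (fun j => j)) {x y : X} (hx : Vis C.ht (C.vs x))
    (hy : Vis C.ht (C.vs y)) {gx gy e : ℤ} {j m m' : ℕ} (hw : Win C.ht (C.vs x) (C.vs y) j gx gy)
    (hgx : 0 ≤ gx) (hgy : 0 ≤ gy)
    (he : e = gy - gx) {α β : ℤ} (hm : 1 ≤ m) (h0 : 0 ≤ α) (hα : α < C.ht m) (hmj : m ≤ j)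
    (hm' : 1 ≤ m') (h0' : 0 ≤ β) (hβ : β < C.ht m') (hmj' : m' ≤ j) :
    ∃ u v l : ℕ, j ≤ 8 * l ∧ u ≤ 400 * l ∧ v ≤ 400 * l ∧ ∀ t < l,
      (((u + t : ℕ) : ℤ) - α ∈ C.vs x m ∧ ((u + t : ℕ) : ℤ) - β ∈ C.vs y m' ↔
       ((v + t : ℕ) : ℤ) - α ∈ C.vs x m ∧ ((v + t : ℕ) : ℤ) - (β + e) ∈ C.vs y m') := by
  obtain ⟨tx, ty, u, l, b1, b2, b3, b4, b5, b6, b7, b8, b9, b10, b11, b12⟩ := hw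
  have hj : 1 ≤ j := hm.trans hmj
  have hp : 0 < C.ht j := H_pos (ht_one C) (ht_succ C) j hj
  have hsq := H_sq (ht_one C) (ht_succ C) j hj
  have hj' : (1 : ℤ) ≤ j := by exact_mod_cast hj
  have hjH : (j : ℤ) ≤ C.ht j := by nlinarith
  refine ⟨(u + C.ht j).toNat, (u - gx).toNat, l.toNat, by omega, by omega, by omega, ?_⟩
  intro t ht
  have c1 : (((u + C.ht j).toNat + t : ℕ) : ℤ) = u + C.ht j + t := by omega
  have c2 : (((u - gx).toNat + t : ℕ) : ℤ) = u - gx + t := by omega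
  rw [c1, c2]
  have r1 : 0 ≤ u + t - tx - gx := by omega
  have r2 : u + t - tx - gx < C.ht j := by omega
  have r3 : 0 ≤ u + t - ty - gy := by omega
  have r4 : u + t - ty - gy < C.ht j := by omega
  have e1 := level_iff (ht_one C) (ht_succ C) hx hm hmj h0 hα r1 r2 b2
  have e2 := level_iff (ht_one C) (ht_succ C) hx hm hmj h0 hα r1 r2 b1
  have e3 := level_iff (ht_one C) (ht_succ C) hy hm' hmj' h0' hβ r3 r4 b4
  have e4 := level_iff (ht_one C) (ht_succ C) hy hm' hmj' h0' hβ r3 r4 b3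
  rw [show tx + C.ht j + gx + (u + t - tx - gx) - α = u + C.ht j + t - α by ring] at e1
  rw [show tx + (u + t - tx - gx) - α = u - gx + t - α by ring] at e2
  rw [show ty + C.ht j + gy + (u + t - ty - gy) - β = u + C.ht j + t - β by ring] at e3
  rw [show ty + (u + t - ty - gy) - β = u - gx + t - (β + e) by rw [he]; ring] at e4
  rw [e1, e2, e3, e4]

lemma prod_case [IsProbabilityMeasure μ] (C : ChaconMap μ (fun j => j)) (ν : Measure (X × X))
    [IsProbabilityMeasure ν]
    (a1 : ∀ A : Set X, MeasurableSet A → ν (A ×ˢ (Set.univ : Set X)) = μ A)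
    (b1 : ∀ A : Set X, MeasurableSet A → ν ((Set.univ : Set X) ×ˢ A) = μ A)
    (herg : Ergodic (fun x : X × X => (C.T x.1, C.T x.2)) ν) {e : ℤ} (he : e = 1 ∨ e = -1)
    (hl : ∀ m α m' β, 1 ≤ m → 0 ≤ α → α < C.ht m → 1 ≤ m' → 0 ≤ β → β < C.ht m' →
      ν (C.lev m α ×ˢ C.lev m' β) = ν (C.lev m α ×ˢ C.lev m' (β + e))) : ν = μ.prod μ := by
  have hmeas : Measurable (fun z : X × X => (z.1, (C.perm ^ (-e)) z.2)) :=
    measurable_fst.prodMk ((perm_mp C _).measurable.comp measurable_snd)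
  have hmap : ∀ A B : Set X, MeasurableSet A → MeasurableSet B →
      (ν.map (fun z : X × X => (z.1, (C.perm ^ (-e)) z.2))) (A ×ˢ B) = ν (A ×ˢ (⇑(C.perm ^ (-e)) ⁻¹' B)) := by
    intro A B hA hB
    rw [Measure.map_apply hmeas (hA.prod hB)]; rfl
  have hinv : ∀ A B : Set X, MeasurableSet A → MeasurableSet B →
      ν (A ×ˢ B) = ν (A ×ˢ (⇑(C.perm ^ (-e)) ⁻¹' B)) := by
    intro A B hA hB
    rw [← hmap A B hA hB]
    refine ext_prod C a1 b1 ?_ ?_ ?_ hA hB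
    · intro A hA
      rw [hmap _ _ hA MeasurableSet.univ]; simpa using a1 A hA
    · intro A hA
      rw [hmap _ _ MeasurableSet.univ hA, b1 _ ((perm_mp C _).measurable hA)]
      exact (perm_mp C _).measure_preimage hA.nullMeasurableSet
    · intro m α m' β h1 h2 h3 h4 h5 h6
      rw [hmap _ _ (lev_measurable _ _ _) (lev_measurable _ _ _), hl _ _ _ _ h1 h2 h3 h4 h5 h6]
      congr 2
      ext y
      change -(β + e) ∈ C.vs y m' ↔ -β ∈ C.vs ((C.perm ^ (-e)) y) m'
      rw [mem_vs_shift, show -β + -e = -(β + e) by ring]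
  have hfst : MeasurePreserving (Prod.fst : X × X → X) ν μ := by
    refine ⟨measurable_fst, Measure.ext fun A hA => ?_⟩
    rw [Measure.map_apply measurable_fst hA, ← a1 A hA]
    congr 1; ext z; simp
  have hT : Ergodic C.T μ := by
    exact MeasurePreserving.ergodic_of_ergodic_semiconj hfst herg C.T.measurable (fun z => rfl)
  symm
  refine Measure.prod_eq fun A B hA hB => ?_
  have s1 : ∀ {B : Set X} (_ : MeasurableSet B),
      ((ν.restrict (A ×ˢ Set.univ)).map Prod.snd) B = ν (A ×ˢ B) := by
    intro B hB
    rw [Measure.map_apply measurable_snd hB, Measure.restrict_apply (measurable_snd hB)]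
    congr 1; ext z; simp [and_comm]
  set ρ := (ν.restrict (A ×ˢ Set.univ)).map Prod.snd with hρ
  have hac : ρ ≪ μ := by
    refine Measure.AbsolutelyContinuous.mk fun S hS h0 => ?_
    rw [s1 hS]
    refine measure_mono_null (Set.prod_mono_left (Set.subset_univ A)) ?_
    rw [b1 S hS, h0]
  have hmp : MeasurePreserving (⇑(C.perm ^ (-e))) ρ ρ := by
    refine ⟨(perm_mp C _).measurable, Measure.ext fun S hS => ?_⟩
    rw [Measure.map_apply (perm_mp C _).measurable hS, s1 hS, s1 ((perm_mp C _).measurable hS)]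
    exact (hinv A S hA hS).symm
  have hmpT : MeasurePreserving C.T ρ ρ := by
    rcases he with rfl | rfl
    · have h : MeasurePreserving C.T.symm ρ ρ := by
        convert hmp using 1
        rw [zpow_neg_one]; rfl
      exact h.symm C.T.symm
    · convert hmp using 1
      rw [neg_neg, zpow_one]; rfl
  obtain ⟨c, hc⟩ := hT.eq_smul_of_absolutelyContinuous hmpT hac
  have h1 := s1 MeasurableSet.univ
  rw [a1 A hA, hc] at h1
  have h2 := s1 hB
  rw [hc] at h2
  simp only [Measure.smul_apply, measure_univ, smul_eq_mul, mul_one] at h1 h2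
  rw [← h2, h1]

end part3c

theorem linearChacon_MSJ
    {X : Type*} [MeasurableSpace X] (μ : Measure X) [IsProbabilityMeasure μ]
    (C : ChaconMap μ (fun j => j)) :
    ∀ ν : Measure (X × X), IsProbabilityMeasure ν →
      MeasurePreserving (fun x : X × X => (C.T x.1, C.T x.2)) ν ν →
      (∀ A : Set X, MeasurableSet A → ν (A ×ˢ (Set.univ : Set X)) = μ A) →
      (∀ A : Set X, MeasurableSet A → ν ((Set.univ : Set X) ×ˢ A) = μ A) →
      Ergodic (fun x : X × X => (C.T x.1, C.T x.2)) ν →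
      (ν = μ.prod μ ∨
        ∃ i : ℤ, ∀ A B : Set X, MeasurableSet A → MeasurableSet B →
          ν (A ×ˢ B) = μ (A ∩ C.T.iterZ i '' B)) := by
  intro ν hν _ a1 b1 herg
  set S : X × X → X × X := fun x : X × X => (C.T x.1, C.T x.2) with hS
  have hfst : MeasurePreserving (Prod.fst : X × X → X) ν μ := by
    refine ⟨measurable_fst, Measure.ext fun A hA => ?_⟩
    rw [Measure.map_apply measurable_fst hA, ← a1 A hA]
    congr 1; ext z; simp
  have hsnd : MeasurePreserving (Prod.snd : X × X → X) ν μ := by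
    refine ⟨measurable_snd, Measure.ext fun A hA => ?_⟩
    rw [Measure.map_apply measurable_snd hA, ← b1 A hA]
    congr 1; ext z; simp
  have g1 : ∀ᵐ z ∂ν, Gen C.ht (C.vs z.1) := hfst.quasiMeasurePreserving.ae (ae_gen C)
  have g2 : ∀ᵐ z ∂ν, Gen C.ht (C.vs z.2) := hsnd.quasiMeasurePreserving.ae (ae_gen C)
  have hDm : ∀ m α m' β, MeasurableSet (C.lev m α ×ˢ C.lev m' β : Set (X × X)) := fun m α m' β =>
    (lev_measurable C m α).prod (lev_measurable C m' β)
  have hDm' : ∀ m α m' β, MeasurableSet ((C.lev m α ∩ C.lev m' β) ×ˢ (Set.univ : Set X) : Set (X × X)) :=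
    fun m α m' β => ((lev_measurable C m α).inter (lev_measurable C m' β)).prod MeasurableSet.univ
  have g3 : ∀ᵐ z ∂ν, ∀ m : ℕ, ∀ α : ℤ, ∀ m' : ℕ, ∀ β : ℤ, ∀ ε : ℝ, 0 < ε → ∃ K : ℝ, ∀ n : ℕ,
      |∑ k ∈ Finset.range n, (C.lev m α ×ˢ C.lev m' β : Set (X × X)).indicator (fun _ => (1 : ℝ)) (S^[k] z) -
        n * ν.real (C.lev m α ×ˢ C.lev m' β)| ≤ ε * n + K := by
    rw [ae_all_iff]; intro m
    rw [ae_all_iff]; intro α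
    rw [ae_all_iff]; intro m'
    rw [ae_all_iff]; intro β
    exact birkhoff_set herg (hDm m α m' β)
  have g4 : ∀ᵐ z ∂ν, ∀ m : ℕ, ∀ α : ℤ, ∀ m' : ℕ, ∀ β : ℤ, ∀ ε : ℝ, 0 < ε → ∃ K : ℝ, ∀ n : ℕ,
      |∑ k ∈ Finset.range n, ((C.lev m α ∩ C.lev m' β) ×ˢ (Set.univ : Set X) : Set (X × X)).indicator
        (fun _ => (1 : ℝ)) (S^[k] z) -
        n * ν.real ((C.lev m α ∩ C.lev m' β) ×ˢ (Set.univ : Set X))| ≤ ε * n + K := by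
    rw [ae_all_iff]; intro m
    rw [ae_all_iff]; intro α
    rw [ae_all_iff]; intro m'
    rw [ae_all_iff]; intro β
    exact birkhoff_set herg (hDm' m α m' β)
  obtain ⟨z, hz1, hz2, hz3, hz4⟩ := (g1.and (g2.and (g3.and g4))).exists
  have hmem : ∀ m α m' β (k : ℕ), S^[k] z ∈ (C.lev m α ×ˢ C.lev m' β : Set (X × X)) ↔
      (k : ℤ) - α ∈ C.vs z.1 m ∧ (k : ℤ) - β ∈ C.vs z.2 m' := by
    intro m α m' β k
    rw [hS, prod_iter, Set.mem_prod]
    change (-α ∈ C.vs ((C.perm ^ (k : ℤ)) z.1) m ∧ -β ∈ C.vs ((C.perm ^ (k : ℤ)) z.2) m') ↔ _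
    rw [mem_vs_shift, mem_vs_shift, neg_add_eq_sub, neg_add_eq_sub]
  have hmem' : ∀ m α m' β (k : ℕ), S^[k] z ∈ ((C.lev m α ∩ C.lev m' β) ×ˢ (Set.univ : Set X) : Set (X × X)) ↔
      (k : ℤ) - α ∈ C.vs z.1 m ∧ (k : ℤ) - β ∈ C.vs z.1 m' := by
    intro m α m' β k
    rw [hS, prod_iter, Set.mem_prod]
    change ((-α ∈ C.vs ((C.perm ^ (k : ℤ)) z.1) m ∧ -β ∈ C.vs ((C.perm ^ (k : ℤ)) z.1) m') ∧ True) ↔ _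
    rw [mem_vs_shift, mem_vs_shift, neg_add_eq_sub, neg_add_eq_sub, and_true]
  have hind : ∀ {D D' : Set (X × X)} {w w' : X × X}, (w ∈ D ↔ w' ∈ D') →
      D.indicator (fun _ => (1 : ℝ)) w = D'.indicator (fun _ => (1 : ℝ)) w' := by
    intro D D' w w' h
    by_cases hw : w ∈ D
    · rw [Set.indicator_of_mem hw, Set.indicator_of_mem (h.1 hw)]
    · rw [Set.indicator_of_notMem hw, Set.indicator_of_notMem (fun h' => hw (h.2 h'))]
  have hreal : ∀ {D D' : Set (X × X)}, ν.real D = ν.real D' → ν D = ν D' := by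
    intro D D' h
    exact (measureReal_eq_measureReal_iff).1 h
  have hwin : ∀ e : ℤ, (e = 1 ∨ e = -1) → (∀ N : ℕ, ∃ j ≥ N, ∃ gx gy : ℤ, 0 ≤ gx ∧ 0 ≤ gy ∧ e = gy - gx ∧
      Win C.ht (C.vs z.1) (C.vs z.2) j gx gy) → ν = μ.prod μ := by
    intro e he hw
    refine prod_case C ν a1 b1 herg he ?_
    intro m α m' β h1 h2 h3 h4 h5 h6
    refine hreal (window_eq (hz3 m α m' β) (hz3 m α m' (β + e)) ?_)
    intro N
    obtain ⟨j, hj, gx, gy, hgx, hgy, hee, hW⟩ := hw (m + m' + 8 * N)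
    obtain ⟨u, v, l, c1, c2, c3, c4⟩ := case_win C hz1.vis hz2.vis hW hgx hgy hee h1 h2 h3 (by omega)
      h4 h5 h6 (by omega)
    refine ⟨u, v, l, by omega, c2, c3, fun t ht => hind ?_⟩
    rw [hmem, hmem]
    exact c4 t ht
  rcases trichotomy (ht_one C) (ht_succ C) hz1 hz2 with ⟨d, hd⟩ | hw | hw
  · right
    refine ⟨-d, fun A B hA hB => ?_⟩
    have hrhs : A ∩ C.T.iterZ (-d) '' B = A ∩ ⇑(C.perm ^ d) ⁻¹' B := by
      rw [perm_coe_iterZ, show (C.T.toEquiv : Equiv.Perm X) = C.perm from rfl, perm_image, neg_neg]; rfl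
    rw [hrhs]
    have hmeas : Measurable (fun x : X => (x, (C.perm ^ d) x)) :=
      measurable_id.prodMk (perm_mp C d).measurable
    have hmap : ∀ A B : Set X, MeasurableSet A → MeasurableSet B →
        (μ.map (fun x : X => (x, (C.perm ^ d) x))) (A ×ˢ B) = μ (A ∩ ⇑(C.perm ^ d) ⁻¹' B) := by
      intro A B hA hB
      rw [Measure.map_apply hmeas (hA.prod hB)]; rfl
    rw [← hmap A B hA hB]
    refine ext_prod C a1 b1 ?_ ?_ ?_ hA hB
    · intro A hA
      rw [hmap _ _ hA MeasurableSet.univ]; simp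
    · intro A hA
      rw [hmap _ _ MeasurableSet.univ hA, Set.univ_inter]
      exact (perm_mp C d).measure_preimage hA.nullMeasurableSet
    · intro m α m' β h1 h2 h3 h4 h5 h6
      rw [hmap _ _ (lev_measurable _ _ _) (lev_measurable _ _ _)]
      have hpre : ⇑(C.perm ^ d) ⁻¹' C.lev m' β = C.lev m' (β - d) := by
        ext y
        change -β ∈ C.vs ((C.perm ^ d) y) m' ↔ -(β - d) ∈ C.vs y m'
        rw [mem_vs_shift, show -β + d = -(β - d) by ring]
      rw [hpre, ← a1 _ ((lev_measurable C m α).inter (lev_measurable C m' (β - d)))]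
      refine hreal (window_eq (hz3 m α m' β) (hz4 m α m' (β - d)) ?_)
      intro N
      refine ⟨0, 0, N, le_rfl, by omega, by omega, fun t _ => hind ?_⟩
      rw [hmem, hmem', case_const C hz1 hz2 hd h4 h5 h6,
        show ((0 + t : ℕ) : ℤ) + d - β = ((0 + t : ℕ) : ℤ) - (β - d) by ring]
  · left
    refine hwin 1 (Or.inl rfl) fun N => ?_
    obtain ⟨j, hj, h⟩ := frequently_atTop.1 hw N
    exact ⟨j, hj, j, j + 1, by positivity, by positivity, by ring, h⟩
  · left
    refine hwin (-1) (Or.inr rfl) fun N => ?_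
    obtain ⟨j, hj, h⟩ := frequently_atTop.1 hw N
    exact ⟨j, hj, j + 1, j, by positivity, by positivity, by ring, h⟩
end

section
/- The prime Chacon map T is weakly mixing: the product transformation T × T is ergodic on (X × X, μ ⊗ μ). -/
open MeasureTheory Filter Topology
open scoped symmDiff

lemma cwm_jordan (β : ℝ) (hβ : |β| ≤ 1/2) :
    4 * |β| ≤ ‖Complex.exp (2 * Real.pi * β * Complex.I) - 1‖ := by
  have h1 : (2 * Real.pi * β * Complex.I : ℂ) = Complex.I * ((2 * Real.pi * β : ℝ) : ℂ) := by
    push_cast; ring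
  rw [h1, Complex.norm_exp_I_mul_ofReal_sub_one, norm_mul]
  have h2 : 2 * Real.pi * β / 2 = Real.pi * β := by ring
  rw [h2]
  have h3 := Real.mul_abs_le_abs_sin (x := Real.pi * β) (by
    rw [abs_mul, abs_of_pos Real.pi_pos]; nlinarith [Real.pi_pos])
  rw [abs_mul, abs_of_pos Real.pi_pos] at h3
  have h4 : 2 / Real.pi * (Real.pi * |β|) = 2 * |β| := by
    field_simp
  rw [h4] at h3
  simp only [Real.norm_eq_abs, abs_two]
  linarith

lemma cwm_rational (z : ℂ) (hz : ‖z‖ = 1)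
    (h : ∀ᶠ M : ℕ in atTop, ∃ d : ℕ, 1 ≤ d ∧ d ≤ 2 * M ∧ ‖z ^ d - 1‖ ≤ 1 / (2 * M)) :
    ∃ q : ℕ, 1 ≤ q ∧ z ^ q = 1 := by
  obtain ⟨t, ht⟩ : ∃ t : ℝ, Complex.exp (t * Complex.I) = z := by
    exact ⟨Complex.arg z, by have := Complex.norm_mul_exp_arg_mul_I z; rw [hz] at this; simpa using this⟩
  obtain ⟨α, hα⟩ : ∃ α : ℝ, Complex.exp (2 * Real.pi * α * Complex.I) = z := by
    refine ⟨t / (2 * Real.pi), ?_⟩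
    rw [← ht]; congr 1; push_cast; field_simp
  have key : ∀ d : ℕ, ∀ m : ℤ, z ^ d = Complex.exp (2 * Real.pi * ((d * α - m : ℝ) : ℂ) * Complex.I) := by
    intro d m
    rw [← hα, ← Complex.exp_nat_mul, Complex.exp_eq_exp_iff_exists_int]
    refine ⟨m, ?_⟩
    push_cast; ring
  have h' : ∀ᶠ M : ℕ in atTop, 1 ≤ M ∧ ∃ d : ℕ, ∃ m : ℤ, 1 ≤ d ∧ d ≤ 2 * M ∧ |d * α - m| ≤ 1 / (8 * M) := by
    filter_upwards [h, eventually_ge_atTop 1] with M hM hM1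
    obtain ⟨d, hd1, hd2, hd3⟩ := hM
    refine ⟨hM1, d, round (d * α), hd1, hd2, ?_⟩
    have := cwm_jordan (d * α - round (d * α)) (abs_sub_round _)
    rw [← key] at this
    have h8 : (1:ℝ) / (8 * M) = (1 / (2 * M)) / 4 := by field_simp; norm_num
    rw [h8]; linarith
  obtain ⟨M0, hM0⟩ := eventually_atTop.1 h'
  have hM0' : ∀ k : ℕ, ∃ d : ℕ, ∃ m : ℤ, 1 ≤ d ∧ d ≤ 2 * (M0 + k) ∧ |d * α - m| ≤ 1 / (8 * (M0 + k : ℕ)) := by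
    intro k
    exact (hM0 (M0 + k) (by omega)).2
  have hM01 := (hM0 M0 le_rfl).1
  choose d m hd1 hd2 hdm using hM0'
  have hpos : ∀ k, (0:ℝ) < d k := fun k => by exact_mod_cast hd1 k
  have step : ∀ k, m k * d (k+1) = m (k+1) * d k := by
    intro k
    have hz0 : |m k * d (k+1) - m (k+1) * d k| < 1 := by
      have e : ((m k * d (k+1) - m (k+1) * d k : ℤ) : ℝ)
          = (d (k+1) * α - m (k+1)) * d k - (d k * α - m k) * d (k+1) := by push_cast; ring
      have hr : |((m k * d (k+1) - m (k+1) * d k : ℤ) : ℝ)| < 1 := by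
        rw [e]
        refine (abs_sub _ _).trans_lt ?_
        rw [abs_mul, abs_mul, abs_of_pos (hpos k), abs_of_pos (hpos (k+1))]
        have a1 := hdm k
        have a2 := hdm (k+1)
        have b1 : (d k : ℝ) ≤ 2 * (M0 + k : ℕ) := by exact_mod_cast hd2 k
        have b2 : (d (k+1) : ℝ) ≤ 2 * ((M0 + k : ℕ) + 1) := by exact_mod_cast hd2 (k+1)
        have c1 : (1:ℝ) ≤ (M0 + k : ℕ) := by exact_mod_cast (by omega : 1 ≤ M0 + k)
        have e2 : ((M0 + (k+1) : ℕ) : ℝ) = (M0 + k : ℕ) + 1 := by push_cast; ring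
        rw [e2] at a2
        set N : ℝ := ((M0 + k : ℕ) : ℝ)
        calc _ ≤ 1 / (8 * (N+1)) * (2 * N) + 1 / (8 * N) * (2 * (N+1)) := by
              gcongr
          _ < 1 := by
              rw [div_mul_eq_mul_div, div_mul_eq_mul_div, div_add_div _ _ (by positivity) (by positivity),
                div_lt_one (by positivity)]
              nlinarith
      exact_mod_cast hr
    rw [Int.abs_lt_one_iff] at hz0
    linarith
  have all : ∀ k, m k * d 0 = m 0 * d k := by
    intro k
    induction k with
    | zero => rfl
    | succ k ih =>
      have hne : (d k : ℤ) ≠ 0 := by have := hd1 k; omega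
      apply mul_right_cancel₀ hne
      linear_combination (-(d 0:ℤ)) * step k + (d (k+1):ℤ) * ih
  have zero : d 0 * α - m 0 = 0 := by
    have lim : Tendsto (fun k : ℕ => (d 0 : ℝ) / 8 * (1 / ((k:ℝ) + 1))) atTop (𝓝 (d 0 / 8 * 0)) :=
      tendsto_one_div_add_atTop_nhds_zero_nat.const_mul _
    rw [mul_zero] at lim
    have : |d 0 * α - m 0| ≤ 0 := by
      refine ge_of_tendsto' lim fun k => ?_
      have e : (d 0 * α - m 0) * d k = d 0 * (d k * α - m k) := by
        have : ((m k * d 0 : ℤ) : ℝ) = ((m 0 * d k : ℤ):ℝ) := by rw [all k]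
        push_cast at this
        linear_combination this
      have e2 : |d 0 * α - m 0| * d k = d 0 * |d k * α - m k| := by
        rw [← abs_of_pos (hpos k), ← abs_mul, e, abs_mul, abs_of_pos (hpos 0)]
        rw [abs_of_pos (hpos k)]
      have d1 : (1:ℝ) ≤ d k := by exact_mod_cast hd1 k
      have : 1 / (8 * ((M0 + k : ℕ) : ℝ)) ≤ 1 / (8 * ((k:ℝ)+1)) := by
        gcongr
        have : (1:ℝ) ≤ M0 := by exact_mod_cast hM01
        push_cast; linarith
      calc |d 0 * α - m 0| ≤ |d 0 * α - m 0| * d k := le_mul_of_one_le_right (abs_nonneg _) d1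
        _ = d 0 * |d k * α - m k| := e2
        _ ≤ d 0 * (1 / (8 * ((k:ℝ)+1))) := by gcongr; exact (hdm k).trans this
        _ = _ := by field_simp
    exact abs_eq_zero.1 (le_antisymm this (abs_nonneg _))
  refine ⟨d 0, hd1 0, ?_⟩
  rw [key (d 0) (m 0), zero]; simp

lemma cwm_cheb : ∀ᶠ M : ℕ in atTop, Nat.nth Nat.Prime (M ^ 3) ≤ M ^ 4 := by
  have hlog : ∀ᶠ M : ℕ in atTop, Real.log M ≤ (1/100) * M := by
    have := (Real.isLittleO_log_id_atTop.bound (c := 1/100) (by norm_num))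
    have := tendsto_natCast_atTop_atTop.eventually this
    filter_upwards [this, eventually_ge_atTop 1] with M hM h1
    have h0 : 0 ≤ Real.log M := Real.log_natCast_nonneg _
    simpa [abs_of_nonneg h0] using hM
  filter_upwards [hlog, eventually_ge_atTop 100] with M hM hM1
  have h := Chebyshev.pi_ge (M ^ 4)
  have hM1' : (100:ℝ) ≤ M := by exact_mod_cast hM1
  have l0 : 0 < Real.log M := Real.log_pos (by linarith)
  have l2 : 0.6 < Real.log 2 := by have := Real.log_two_gt_d9; linarith
  have hl : Real.log ((M ^ 4 : ℕ) : ℝ) = 4 * Real.log M := by push_cast; rw [Real.log_pow]; norm_num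
  have hl' : Real.log (((M ^ 4 : ℕ) : ℝ) + 1) ≤ M := by
    calc Real.log (((M ^ 4 : ℕ) : ℝ) + 1) ≤ Real.log ((M:ℝ) ^ 5) := by
          apply Real.log_le_log (by positivity)
          push_cast
          have : (1:ℝ) ≤ (M:ℝ)^4 := one_le_pow₀ (by linarith)
          nlinarith
      _ = 5 * Real.log M := by rw [Real.log_pow]; norm_num
      _ ≤ M := by linarith
  rw [hl, div_le_iff₀ (by positivity)] at h
  have : (M ^ 3 : ℕ) < Nat.primeCounting (M ^ 4) := by
    by_contra hcon
    push Not at hcon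
    have hc : (Nat.primeCounting (M ^ 4) : ℝ) ≤ (M:ℝ) ^ 3 := by exact_mod_cast hcon
    have : (Nat.primeCounting (M ^ 4) : ℝ) * (4 * Real.log M) ≤ (M:ℝ)^3 * (4 * ((1/100) * M)) := by
      gcongr
    push_cast at h hl'
    have h4 : (M:ℝ) ≤ (M:ℝ)^4 / 100 := by
      have : (100:ℝ) ≤ (M:ℝ)^3 := hM1'.trans (le_self_pow₀ (by linarith) (by norm_num))
      nlinarith
    have h5 : (0:ℝ) < (M:ℝ)^4 := by positivity
    nlinarith
  rw [Nat.primeCounting, Nat.primeCounting'] at this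
  have := Nat.nth_lt_of_lt_count this
  omega

lemma cwm_gaps (z : ℂ) (hz : ‖z‖ = 1)
    (hs : Summable (fun j : ℕ => ‖z ^ (Nat.nth Nat.Prime j) - 1‖ ^ 2)) :
    ∀ᶠ M : ℕ in atTop, ∃ d : ℕ, 1 ≤ d ∧ d ≤ 2 * M ∧ ‖z ^ d - 1‖ ≤ 1 / (2 * M) := by
  set p : ℕ → ℕ := Nat.nth Nat.Prime with hp
  have pmono : StrictMono p := Nat.nth_strictMono Nat.infinite_setOfPred_prime
  set B := ∑' j, ‖z ^ (p j) - 1‖ ^ 2 with hB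
  obtain ⟨K, hK⟩ := exists_nat_gt (32 * B)
  filter_upwards [cwm_cheb, eventually_ge_atTop (K+1)] with M hM hMK
  by_contra hcon
  push Not at hcon
  have hM0 : (0:ℝ) < M := by exact_mod_cast (by omega : 0 < M)
  set J := M ^ 3 with hJ
  have gap : ∀ j, ‖z ^ (p (j+1) - p j) - 1‖ ^ 2 ≤ 2 * (‖z ^ (p (j+1)) - 1‖^2 + ‖z ^ (p j) - 1‖^2) := by
    intro j
    have hle := (pmono (Nat.lt_succ_self j)).le
    have e : z ^ (p (j+1)) - z ^ p j = z ^ p j * (z ^ (p (j+1) - p j) - 1) := by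
      rw [mul_sub, ← pow_add, Nat.add_sub_cancel' hle, mul_one]
    have e2 : ‖z ^ (p (j+1) - p j) - 1‖ = ‖z ^ (p (j+1)) - z ^ p j‖ := by
      rw [e, norm_mul, norm_pow, hz]; simp
    have e3 : ‖z ^ (p (j+1)) - z ^ p j‖ ≤ ‖z ^ (p (j+1)) - 1‖ + ‖z ^ (p j) - 1‖ := by
      have : z ^ (p (j+1)) - z ^ p j = (z ^ (p (j+1)) - 1) - (z ^ (p j) - 1) := by ring
      rw [this]; exact norm_sub_le _ _
    rw [e2]
    have := norm_nonneg (z ^ (p (j+1)) - z ^ p j)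
    nlinarith [sq_nonneg (‖z ^ (p (j+1)) - 1‖ - ‖z ^ (p j) - 1‖)]
  have up : ∑ j ∈ Finset.range J, ‖z ^ (p (j+1) - p j) - 1‖ ^ 2 ≤ 4 * B := by
    have s1 : ∑ j ∈ Finset.range J, ‖z ^ (p j) - 1‖^2 ≤ B :=
      hs.sum_le_tsum _ (fun _ _ => by positivity)
    have s2 : ∑ j ∈ Finset.range J, ‖z ^ (p (j+1)) - 1‖^2 ≤ B := by
      have := hs.sum_le_tsum (Finset.range (J+1)) (fun _ _ => by positivity)
      rw [Finset.sum_range_succ'] at this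
      have h0 : 0 ≤ ‖z ^ (p 0) - 1‖^2 := by positivity
      linarith
    calc _ ≤ ∑ j ∈ Finset.range J, 2 * (‖z ^ (p (j+1)) - 1‖^2 + ‖z ^ (p j) - 1‖^2) :=
          Finset.sum_le_sum fun j _ => gap j
      _ = 2 * (∑ j ∈ Finset.range J, ‖z ^ (p (j+1)) - 1‖^2 + ∑ j ∈ Finset.range J, ‖z ^ (p j) - 1‖^2) := by
          rw [← Finset.mul_sum, Finset.sum_add_distrib]
      _ ≤ _ := by linarith
  -- pointwise lower bound: inverse square minus gap
  have low : ∀ j, 1 / (4 * (M:ℝ)^2) - ((p (j+1) : ℝ) - p j) / (8 * (M:ℝ)^3) ≤ ‖z ^ (p (j+1) - p j) - 1‖ ^ 2 := by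
    intro j
    have hlt : p j < p (j+1) := pmono (Nat.lt_succ_self j)
    have ec : ((p (j+1) - p j : ℕ) : ℝ) = (p (j+1) : ℝ) - p j := by
      push_cast [Nat.cast_sub hlt.le]; ring
    rw [← ec]
    by_cases hd : p (j+1) - p j ≤ 2 * M
    · have := hcon _ (by omega : 1 ≤ p (j+1) - p j) hd
      have h2 : (1 / (2 * (M:ℝ)))^2 ≤ ‖z ^ (p (j+1) - p j) - 1‖ ^ 2 := by
        gcongr
      have h3 : (1 / (2 * (M:ℝ)))^2 = 1 / (4 * (M:ℝ)^2) := by field_simp; norm_num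
      have h4 : 0 ≤ ((p (j+1) - p j : ℕ) : ℝ) / (8 * (M:ℝ)^3) := by positivity
      linarith
    · have h2 : (2:ℝ) * M ≤ ((p (j+1) - p j : ℕ) : ℝ) := by exact_mod_cast (by omega : 2 * M ≤ p (j+1) - p j)
      have h3 : 1 / (4 * (M:ℝ)^2) = (2 * M) / (8 * (M:ℝ)^3) := by field_simp; norm_num
      have h4 : (2 * (M:ℝ)) / (8 * (M:ℝ)^3) ≤ ((p (j+1) - p j : ℕ) : ℝ) / (8 * (M:ℝ)^3) := by gcongr
      have : 0 ≤ ‖z ^ (p (j+1) - p j) - 1‖ ^ 2 := by positivity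
      linarith
  have lows := Finset.sum_le_sum fun j (_ : j ∈ Finset.range J) => low j
  have tele : ∑ j ∈ Finset.range J, ((p (j+1) : ℝ) - p j) / (8 * (M:ℝ)^3)
      = ((p J : ℝ) - p 0) / (8 * (M:ℝ)^3) := by
    rw [← Finset.sum_div, Finset.sum_range_sub (fun j => (p j : ℝ))]
  rw [Finset.sum_sub_distrib, tele] at lows
  simp only [Finset.sum_const, Finset.card_range, nsmul_eq_mul] at lows
  have hpJ : (p J : ℝ) ≤ (M:ℝ)^4 := by exact_mod_cast hM
  have h1 : ((p J : ℝ) - p 0) / (8 * (M:ℝ)^3) ≤ M / 8 := by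
    rw [div_le_div_iff₀ (by positivity) (by positivity)]
    have : (0:ℝ) ≤ p 0 := by positivity
    nlinarith
  have h2 : (J:ℝ) * (1 / (4 * (M:ℝ)^2)) = M / 4 := by
    rw [hJ]; push_cast; field_simp
  have hKM : (K:ℝ) ≤ M := by exact_mod_cast (by omega : K ≤ M)
  rw [h2] at lows
  linarith

lemma cwm_nt (z : ℂ) (hz : ‖z‖ = 1) (h1 : z ≠ 1) :
    ¬ Summable (fun j : ℕ => ‖z ^ (Nat.nth Nat.Prime j) - 1‖ ^ 2) := by
  intro hs
  obtain ⟨q, hq, hzq⟩ := cwm_rational z hz (cwm_gaps z hz hs)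
  have lim := hs.tendsto_atTop_zero
  -- values in a finite set
  have pmono : StrictMono (Nat.nth Nat.Prime) := Nat.nth_strictMono Nat.infinite_setOfPred_prime
  have fin : ∀ n, z ^ n = z ^ (n % q) := fun n => by
    conv_lhs => rw [← Nat.mod_add_div n q, pow_add, pow_mul, hzq, one_pow, mul_one]
  have ne : ∀ᶠ j in atTop, z ^ (Nat.nth Nat.Prime j) ≠ 1 := by
    filter_upwards [eventually_gt_atTop q] with j hj hcon
    have hpr := Nat.prime_nth_prime j
    have hgt : q < Nat.nth Nat.Prime j := hj.trans_le (pmono.id_le j)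
    have cop : Nat.Coprime (Nat.nth Nat.Prime j) q := by
      rw [hpr.coprime_iff_not_dvd]
      intro hd
      exact absurd (Nat.le_of_dvd (by omega) hd) (by omega)
    have a := orderOf_dvd_of_pow_eq_one hcon
    have b := orderOf_dvd_of_pow_eq_one hzq
    have := Nat.dvd_gcd a b
    rw [cop] at this
    exact h1 (orderOf_eq_one_iff.1 (Nat.dvd_one.1 this))
  obtain ⟨ε, hε, hεle⟩ : ∃ ε > 0, ∀ r ∈ Finset.range q, z ^ r ≠ 1 → ε ≤ ‖z ^ r - 1‖ ^ 2 := by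
    classical
    by_cases hne : ((Finset.range q).filter (fun r => z ^ r ≠ 1)).Nonempty
    · obtain ⟨r, hr, hmin⟩ := Finset.exists_min_image _ (fun r => ‖z ^ r - 1‖ ^ 2) hne
      refine ⟨‖z ^ r - 1‖ ^ 2, ?_, fun r' hr' hr2 => hmin r' (by simp [hr2]; simpa using hr')⟩
      have := (Finset.mem_filter.1 hr).2
      have := norm_pos_iff.2 (sub_ne_zero.2 this)
      positivity
    · refine ⟨1, one_pos, fun r hr hr2 => (hne ⟨r, by simp [hr2]; simpa using hr⟩).elim⟩
  have := lim.eventually (gt_mem_nhds hε)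
  obtain ⟨j, hj1, hj2⟩ := (this.and ne).exists
  rw [fin] at hj1 hj2
  exact absurd (hεle _ (Finset.mem_range.2 (Nat.mod_lt _ (by omega))) hj2) (not_le.2 hj1)


open Polynomial in
/-- The one-step polynomial `(1 + X^H + X^(2 * H + s))/3`. -/
noncomputable def cwmP (H s : ℕ) : ℂ[X] := C (1/3) * (1 + X ^ H + X ^ (2 * H + s))

open Polynomial in
/-- The product of one-step polynomials. -/
noncomputable def cwmQ (H s : ℕ → ℕ) (j n : ℕ) : ℂ[X] :=
  ∏ i ∈ Finset.range n, cwmP (H (j + i)) (s (j + i))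

lemma cwm_three (z w : ℂ) (hz : ‖z‖ = 1) (hw : ‖w‖ = 1) :
    ‖1 + z + w‖ ^ 2 = 9 - (‖1 - z‖^2 + ‖w - z‖^2 + ‖1 - w‖^2) := by
  have h1 : Complex.normSq z = 1 := by rw [Complex.normSq_eq_norm_sq, hz]; norm_num
  have h2 : Complex.normSq w = 1 := by rw [Complex.normSq_eq_norm_sq, hw]; norm_num
  simp only [← Complex.normSq_eq_norm_sq, Complex.normSq_apply] at *
  simp only [Complex.add_re, Complex.add_im, Complex.sub_re, Complex.sub_im, Complex.one_re, Complex.one_im] at *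
  linear_combination 3 * h1 + 3 * h2

lemma cwmP_bound (H s : ℕ) (z : ℂ) (hz : ‖z‖ = 1) :
    ‖(cwmP H s).eval z‖ ^ 2 ≤ 1 - ‖z ^ s - 1‖ ^ 2 / 18 := by
  have e : (cwmP H s).eval z = (1/3) * (1 + z ^ H + z ^ (2 * H + s)) := by
    simp [cwmP]
  have ha : ‖z ^ H‖ = 1 := by rw [norm_pow, hz, one_pow]
  have hb : ‖z ^ (2 * H + s)‖ = 1 := by rw [norm_pow, hz, one_pow]
  rw [e, norm_mul, mul_pow, cwm_three _ _ ha hb]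
  have e1 : ‖z ^ s - 1‖ = ‖z ^ (2 * H + s) - z ^ (2 * H)‖ := by
    have : z ^ (2 * H + s) - z ^ (2 * H) = z ^ (2 * H) * (z ^ s - 1) := by rw [pow_add]; ring
    rw [this, norm_mul, norm_pow, hz, one_pow, one_mul]
  have e2 : ‖z ^ (2 * H + s) - z ^ (2 * H)‖ ≤ ‖z ^ (2 * H + s) - z ^ H‖ + ‖1 - z ^ H‖ := by
    have : z ^ (2 * H + s) - z ^ (2 * H) = (z ^ (2 * H + s) - z ^ H) + z ^ H * (1 - z ^ H) := by ring
    rw [this]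
    refine (norm_add_le _ _).trans ?_
    rw [norm_mul, ha, one_mul]
  rw [e1]
  have := norm_nonneg (z ^ (2 * H + s) - z ^ (2 * H))
  have h3 : ‖(1/3 : ℂ)‖ ^ 2 = 1/9 := by norm_num
  rw [h3]
  have h5 : 0 ≤ ‖1 - z ^ (2 * H + s)‖^2 := by positivity
  nlinarith [sq_nonneg (‖z ^ (2 * H + s) - z ^ H‖ - ‖1 - z ^ H‖)]

lemma cwmQ_prod (H s : ℕ → ℕ) (j n : ℕ) (z : ℂ) :
    ‖(cwmQ H s j n).eval z‖ = ∏ i ∈ Finset.range n, ‖(cwmP (H (j + i)) (s (j + i))).eval z‖ := by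
  rw [cwmQ, Polynomial.eval_prod, norm_prod]

lemma cwmQ_anti (H s : ℕ → ℕ) (j : ℕ) (z : ℂ) (hz : ‖z‖ = 1) :
    Antitone (fun n => ‖(cwmQ H s j n).eval z‖) := by
  refine antitone_nat_of_succ_le fun n => ?_
  rw [cwmQ_prod, cwmQ_prod, Finset.prod_range_succ]
  refine mul_le_of_le_one_right (Finset.prod_nonneg fun _ _ => norm_nonneg _) ?_
  have := cwmP_bound (H (j+n)) (s (j+n)) z hz
  have h2 : 0 ≤ ‖z ^ (s (j+n)) - 1‖ ^ 2 / 18 := by positivity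
  have h3 := norm_nonneg ((cwmP (H (j+n)) (s (j+n))).eval z)
  nlinarith

lemma cwmQ_tendsto (H s : ℕ → ℕ) (hs : ∀ i, s i = Nat.nth Nat.Prime i) (j : ℕ) (z : ℂ) (hz : ‖z‖ = 1)
    (h1 : z ≠ 1) : Tendsto (fun n => ‖(cwmQ H s j n).eval z‖) atTop (𝓝 0) := by
  set f : ℕ → ℝ := fun i => ‖z ^ (Nat.nth Nat.Prime i) - 1‖ ^ 2 with hf
  have ns : ¬ Summable (fun i => f (i + j)) := by
    rw [summable_nat_add_iff j]; exact cwm_nt z hz h1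
  have div := (not_summable_iff_tendsto_nat_atTop_of_nonneg (fun i => by positivity)).1 ns
  have b : ∀ n, ‖(cwmQ H s j n).eval z‖ ^ 2 ≤ Real.exp (- ((1/18) * ∑ i ∈ Finset.range n, f (i + j))) := by
    intro n
    rw [cwmQ_prod, ← Finset.prod_pow, Finset.mul_sum, ← Finset.sum_neg_distrib, Real.exp_sum]
    refine Finset.prod_le_prod (fun _ _ => by positivity) fun i _ => ?_
    refine (cwmP_bound _ _ z hz).trans ?_
    have := Real.add_one_le_exp (-((1/18) * f (i + j)))
    refine le_trans (le_of_eq ?_) this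
    rw [hs, hf]; simp only [add_comm i j]; ring
  have l2 : Tendsto (fun n => ‖(cwmQ H s j n).eval z‖ ^ 2) atTop (𝓝 0) := by
    refine squeeze_zero (fun _ => by positivity) b ?_
    exact Real.tendsto_exp_neg_atTop_nhds_zero.comp (div.const_mul_atTop (by norm_num))
  have := l2.sqrt
  simpa using this

lemma cwmQ_unif (H s : ℕ → ℕ) (hs : ∀ i, s i = Nat.nth Nat.Prime i) (j : ℕ) (ε : ℝ) (hε : 0 < ε) :
    ∀ᶠ n in atTop, ∀ z : ℂ, ‖z‖ = 1 → ‖(cwmQ H s j n * (Polynomial.X - 1)).eval z‖ ≤ ε := by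
  have hT : TendstoUniformlyOn (fun n (z : ℂ) => ‖(cwmQ H s j n * (Polynomial.X - 1)).eval z‖)
      (fun _ => 0) atTop (Metric.sphere (0:ℂ) 1) := by
    refine Antitone.tendstoUniformlyOn_of_forall_tendsto (isCompact_sphere _ _) ?_ ?_ ?_ ?_
    · intro n
      exact (Polynomial.continuous _).norm.continuousOn
    · intro z hz
      have hz' : ‖z‖ = 1 := by simpa using hz
      intro n m hnm
      simp only [Polynomial.eval_mul, norm_mul]
      gcongr
      exact cwmQ_anti H s j z hz' hnm
    · exact continuousOn_const
    · intro z hz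
      have hz' : ‖z‖ = 1 := by simpa using hz
      by_cases h1 : z = 1
      · subst h1; simp
      · have := (cwmQ_tendsto H s hs j z hz' h1).mul_const ‖(Polynomial.X - 1 : Polynomial ℂ).eval z‖
        simpa only [Polynomial.eval_mul, norm_mul, zero_mul] using this
  rw [Metric.tendstoUniformlyOn_iff] at hT
  filter_upwards [hT ε hε] with n hn z hz
  have := hn z (by simpa using hz)
  rw [dist_comm, Real.dist_eq, sub_zero, abs_of_nonneg (norm_nonneg _)] at this
  exact this.le

section op
set_option linter.unusedSectionVars false
variable {E : Type*} [NormedAddCommGroup E] [InnerProductSpace ℂ E] [CompleteSpace E]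

/-- A unitary as a continuous linear map. -/
noncomputable def cwmL (S : E ≃ₗᵢ[ℂ] E) : E →L[ℂ] E := (S.toContinuousLinearEquiv : E →L[ℂ] E)

@[simp] lemma cwmL_apply (S : E ≃ₗᵢ[ℂ] E) (x : E) : cwmL S x = S x := rfl

lemma cwmL_unitary (S : E ≃ₗᵢ[ℂ] E) : cwmL S ∈ unitary (E →L[ℂ] E) := by
  rw [Unitary.mem_iff]
  constructor
  · ext x
    refine ext_inner_left ℂ fun y => ?_
    rw [ContinuousLinearMap.star_eq_adjoint, mul_apply_eq_comp,
      ContinuousLinearMap.adjoint_inner_right]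
    simp
  · ext x
    obtain ⟨x, rfl⟩ := S.surjective x
    have : (ContinuousLinearMap.adjoint (cwmL S)) (S x) = x := by
      refine ext_inner_left ℂ fun y => ?_
      rw [ContinuousLinearMap.adjoint_inner_right]
      simp
    rw [ContinuousLinearMap.star_eq_adjoint, mul_apply_eq_comp, this]
    simp

lemma cwm_vN (S : E ≃ₗᵢ[ℂ] E) (P : Polynomial ℂ) (c : ℝ) (hc : 0 ≤ c)
    (h : ∀ z : ℂ, ‖z‖ = 1 → ‖P.eval z‖ ≤ c) : ‖Polynomial.aeval (cwmL S) P‖ ≤ c := by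
  have hu := cwmL_unitary S
  have hn : IsStarNormal (cwmL S) := ⟨by
    rw [Commute, SemiconjBy, (Unitary.mem_iff.1 hu).1, (Unitary.mem_iff.1 hu).2]⟩
  rw [← cfc_polynomial P (cwmL S) hn]
  refine norm_cfc_le hc fun x hx => h x ?_
  have := spectrum.subset_circle_of_unitary hu hx
  simpa using this

lemma cwmQ_norm_le (H s : ℕ → ℕ) (j n : ℕ) (S : E ≃ₗᵢ[ℂ] E) :
    ‖Polynomial.aeval (cwmL S) (cwmQ H s j n)‖ ≤ 1 := by
  refine cwm_vN S _ 1 zero_le_one fun z hz => ?_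
  have := cwmQ_anti H s j z hz (Nat.zero_le n)
  simpa [cwmQ] using this

lemma cwmQ_op (H s : ℕ → ℕ) (hs : ∀ i, s i = Nat.nth Nat.Prime i) (j : ℕ) (S : E ≃ₗᵢ[ℂ] E) (φ : E) :
    Tendsto (fun n => ‖Polynomial.aeval (cwmL S) (cwmQ H s j n) (S φ - φ)‖) atTop (𝓝 0) := by
  have e : ∀ n, Polynomial.aeval (cwmL S) (cwmQ H s j n) (S φ - φ)
      = Polynomial.aeval (cwmL S) (cwmQ H s j n * (Polynomial.X - 1)) φ := by
    intro n
    simp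
  rw [Metric.tendsto_atTop]
  intro ε hε
  have hφ : 0 < ‖φ‖ + 1 := by positivity
  obtain ⟨N, hN⟩ := eventually_atTop.1 (cwmQ_unif H s hs j (ε / (‖φ‖ + 1)) (by positivity))
  refine ⟨N, fun n hn => ?_⟩
  have b := cwm_vN S _ _ (by positivity) (hN n hn)
  rw [dist_zero_right, norm_norm, e]
  calc _ ≤ ε / (‖φ‖ + 1) * ‖φ‖ := (ContinuousLinearMap.le_opNorm _ _).trans (by gcongr)
    _ < ε / (‖φ‖ + 1) * (‖φ‖ + 1) := by gcongr; linarith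
    _ = ε := by field_simp
end op


section hs
set_option linter.unusedSectionVars false
variable {E : Type*} [NormedAddCommGroup E] [InnerProductSpace ℂ E] [CompleteSpace E]

/-- The abstract Hilbert space data of the squared Chacon map. -/
structure CwmData (E : Type*) [NormedAddCommGroup E] [InnerProductSpace ℂ E] [CompleteSpace E] where
  S : E ≃ₗᵢ[ℂ] E
  R : E ≃ₗᵢ[ℂ] E
  comm : S * R = R * S
  H : ℕ → ℕ
  s : ℕ → ℕ
  hH : ∀ j, 3 * H j ≤ H (j + 1)
  hH0 : 1 ≤ H 0
  e : ℕ → E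
  m : ℕ → ℝ
  m_pos : ∀ j, 0 < m j
  m_rec : ∀ j, m j = 3 * m (j + 1)
  e_rec : ∀ j x, inner ℂ (e j) x = 9 * inner ℂ (e (j + 1))
    (Polynomial.aeval (cwmL S) (cwmP (H j) (s j)) (Polynomial.aeval (cwmL R) (cwmP (H j) (s j)) x))
  orth : ∀ j, ∀ a < H j, ∀ b < H j, ∀ a' < H j, ∀ b' < H j,
    inner ℂ ((S ^ a)⁻¹ ((R ^ b)⁻¹ (e j))) ((S ^ a')⁻¹ ((R ^ b')⁻¹ (e j))) =
      if a = a' ∧ b = b' then ((m j ^ 2 : ℝ) : ℂ) else 0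
  tens : ∀ j, ∀ a < H j, ∀ b < H j, ∀ a' < H j, ∀ b' < H j, ∀ k l : ℤ,
    ((m j ^ 2 : ℝ) : ℂ) * inner ℂ ((S ^ k) ((S ^ a)⁻¹ ((R ^ b)⁻¹ (e j)))) ((R ^ l) ((S ^ a')⁻¹ ((R ^ b')⁻¹ (e j))))
    = ∑ i : Fin (H j) × Fin (H j),
      inner ℂ ((S ^ k) ((S ^ a)⁻¹ ((R ^ b)⁻¹ (e j)))) ((S ^ (i.1:ℕ))⁻¹ ((R ^ (i.2:ℕ))⁻¹ (e j))) *
      inner ℂ ((S ^ (i.1:ℕ))⁻¹ ((R ^ (i.2:ℕ))⁻¹ (e j))) ((R ^ l) ((S ^ a')⁻¹ ((R ^ b')⁻¹ (e j))))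
  dense : ∀ ψ : E, ∀ ε > 0, ∃ j, ∃ ξ ∈ Submodule.span ℂ
    (Set.range (fun i : Fin (H j) × Fin (H j) => (S ^ (i.1:ℕ))⁻¹ ((R ^ (i.2:ℕ))⁻¹ (e j)))), ‖ψ - ξ‖ ≤ ε

namespace CwmData
variable (D : CwmData E)

/-- The level vectors. -/
noncomputable def v (j : ℕ) (i : Fin (D.H j) × Fin (D.H j)) : E :=
  (D.S ^ (i.1:ℕ))⁻¹ ((D.R ^ (i.2:ℕ))⁻¹ (D.e j))

lemma mul_app (U V : E ≃ₗᵢ[ℂ] E) (x : E) : (U * V) x = U (V x) := rfl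

lemma zpow_fix (U : E ≃ₗᵢ[ℂ] E) (x : E) (h : U x = x) (k : ℤ) : (U ^ k) x = x := by
  let G : Subgroup (E ≃ₗᵢ[ℂ] E) :=
    { carrier := {U | U x = x}
      mul_mem' := by intro a b ha hb; simp only [Set.mem_setOf_eq] at *; rw [mul_app, hb, ha]
      one_mem' := rfl
      inv_mem' := by
        intro a ha
        simp only [Set.mem_setOf_eq] at *
        conv_lhs => rw [← ha]
        exact a.symm_apply_apply x }
  exact G.zpow_mem (show U ∈ G from h) k

lemma inner_inv (U : E ≃ₗᵢ[ℂ] E) (x y : E) : inner ℂ (U⁻¹ x) y = inner ℂ x (U y) := by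
  rw [← LinearIsometryEquiv.inner_map_map U (U⁻¹ x) y]
  congr 1
  exact U.apply_symm_apply x

lemma inner_v (j : ℕ) (i) (x : E) :
    inner ℂ (D.v j i) x = inner ℂ (D.e j) ((D.R ^ (i.2:ℕ)) ((D.S ^ (i.1:ℕ)) x)) := by
  rw [v, inner_inv, inner_inv]

/-- Coordinates with respect to the levels of tower `j`. -/
noncomputable def Λ (j : ℕ) (f : E) : EuclideanSpace ℂ (Fin (D.H j) × Fin (D.H j)) :=
  WithLp.toLp 2 (fun i => inner ℂ (D.v j i) f)

lemma Λ_sub (j : ℕ) (f g : E) : D.Λ j (f - g) = D.Λ j f - D.Λ j g := by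
  ext i; simp [Λ, inner_sub_right]

lemma Λ_norm_sq (j : ℕ) (f : E) : ‖D.Λ j f‖ ^ 2 = ∑ i, ‖inner ℂ (D.v j i) f‖ ^ 2 := by
  rw [EuclideanSpace.norm_sq_eq]; rfl

lemma orthonormal (j : ℕ) : Orthonormal ℂ (fun i => ((D.m j)⁻¹ : ℂ) • D.v j i) := by
  classical
  rw [orthonormal_iff_ite]
  intro i i'
  have h := D.orth j i.1 i.1.2 i.2 i.2.2 i'.1 i'.1.2 i'.2 i'.2.2
  have hm := (D.m_pos j).ne'
  have hm' : (D.m j : ℂ) ≠ 0 := by exact_mod_cast hm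
  have heq : ((i.1:ℕ) = i'.1 ∧ (i.2:ℕ) = i'.2) ↔ i = i' := by
    rw [Prod.ext_iff, Fin.ext_iff, Fin.ext_iff]
  rw [inner_smul_left, inner_smul_right, v, v, h]
  simp only [heq]
  split_ifs
  · simp; field_simp
  · simp

lemma Λ_le (j : ℕ) (f : E) : ‖D.Λ j f‖ ≤ D.m j * ‖f‖ := by
  have hb := (D.orthonormal j).sum_inner_products_le f (s := Finset.univ)
  have hm := D.m_pos j
  have h2 : ‖D.Λ j f‖ ^ 2 ≤ (D.m j * ‖f‖) ^ 2 := by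
    rw [Λ_norm_sq]
    have : ∀ i, ‖inner ℂ (D.v j i) f‖ ^ 2 = (D.m j) ^ 2 * ‖inner ℂ (((D.m j)⁻¹ : ℂ) • D.v j i) f‖ ^ 2 := by
      intro i
      rw [inner_smul_left, norm_mul]
      simp [abs_of_pos hm]
      field_simp
    simp_rw [this, ← Finset.mul_sum]
    rw [mul_pow]
    gcongr
  exact (abs_le_of_sq_le_sq' h2 (by positivity)).2

lemma tens_span (j : ℕ) (k l : ℤ) (ξ ξ' : E) (h : ξ ∈ Submodule.span ℂ (Set.range (D.v j)))
    (h' : ξ' ∈ Submodule.span ℂ (Set.range (D.v j))) :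
    ((D.m j ^ 2 : ℝ) : ℂ) * inner ℂ ((D.S ^ k) ξ) ((D.R ^ l) ξ')
      = inner ℂ (D.Λ j ((D.S ^ k) ξ)) (D.Λ j ((D.R ^ l) ξ')) := by
  have key : ∀ x y, inner ℂ (D.Λ j x) (D.Λ j y) = ∑ i, inner ℂ x (D.v j i) * inner ℂ (D.v j i) y := by
    intro x y
    rw [PiLp.inner_apply]
    refine Finset.sum_congr rfl fun i _ => ?_
    simp [Λ, mul_comm]
  rw [key]
  induction h using Submodule.span_induction with
  | mem x hx =>
    obtain ⟨i, rfl⟩ := hx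
    induction h' using Submodule.span_induction with
    | mem y hy =>
      obtain ⟨i', rfl⟩ := hy
      exact D.tens j i.1 i.1.2 i.2 i.2.2 i'.1 i'.1.2 i'.2 i'.2.2 k l
    | zero => simp
    | add x y _ _ hx hy =>
      simp only [map_add, inner_add_right, mul_add, Finset.sum_add_distrib, hx, hy]
    | smul c x _ hx =>
      simp only [map_smul, inner_smul_right]
      rw [mul_left_comm, hx, Finset.mul_sum]
      exact Finset.sum_congr rfl fun i _ => by ring
  | zero => simp
  | add x y _ _ hx hy =>
    simp only [map_add, inner_add_left, mul_add, add_mul, Finset.sum_add_distrib, hx, hy]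
  | smul c x _ hx =>
    simp only [map_smul, inner_smul_left]
    rw [mul_left_comm, hx, Finset.mul_sum]
    exact Finset.sum_congr rfl fun i _ => by ring

lemma inv_zpow (ψ : E) (h : D.S (D.R ψ) = ψ) (k : ℤ) : (D.S ^ k) ψ = (D.R ^ (-k)) ψ := by
  have h1 : D.S ψ = D.R⁻¹ ψ := by
    have : D.S (D.R ψ) = D.R (D.S ψ) := by
      have := congrArg (fun f : E ≃ₗᵢ[ℂ] E => f ψ) D.comm
      exact this
    rw [this] at h
    conv_rhs => rw [← h]
    exact (D.R.symm_apply_apply _).symm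
  have c : Commute D.S D.R := D.comm
  have hk : ((D.R * D.S) ^ k) ψ = ψ := by
    have hf : (D.R * D.S) ψ = ψ := by
      rw [← D.comm]; exact h
    exact zpow_fix _ _ hf k
  rw [c.symm.mul_zpow] at hk
  calc (D.S ^ k) ψ = (D.R ^ (-k)) ((D.R ^ k * D.S ^ k) ψ) := by
        rw [← mul_app, ← mul_assoc, ← zpow_add]; simp
    _ = _ := by rw [hk]

lemma lower (ψ : E) (hψ : ψ ≠ 0) (h : D.S (D.R ψ) = ψ) :
    ∃ j, ∃ c > 0, ∀ k : ℤ, D.m j ^ 2 * c ≤ ‖D.Λ j ((D.S ^ k) ψ)‖ ^ 2 := by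
  have hN : 0 < ‖ψ‖ := norm_pos_iff.2 hψ
  set N := ‖ψ‖ with hNdef
  obtain ⟨j, ξ, hξ, hd⟩ := D.dense ψ (N / 8) (by positivity)
  refine ⟨j, (3 * N / 8) ^ 2, by positivity, fun k => ?_⟩
  have hm := D.m_pos j
  set w := (D.S ^ k) ψ with hw
  set u := (D.S ^ k) ξ with hu
  set r := (D.R ^ (-k)) ξ with hr
  have nw : ‖w‖ = N := LinearIsometryEquiv.norm_map _ _
  have d1 : ‖w - u‖ ≤ N / 8 := by
    rw [hw, hu, ← map_sub, LinearIsometryEquiv.norm_map]; exact hd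
  have d2 : ‖w - r‖ ≤ N / 8 := by
    rw [hw, D.inv_zpow ψ h, hr, ← map_sub, LinearIsometryEquiv.norm_map]; exact hd
  have nr : ‖r‖ ≤ N + N / 8 := by
    have : r = w - (w - r) := by abel
    rw [this]; exact (norm_sub_le _ _).trans (by linarith)
  have hur : N ^ 2 - (N / 8 * (N + N / 8) + N * (N / 8)) ≤ ‖inner ℂ u r‖ := by
    have e : inner ℂ w w = inner ℂ u r + (inner ℂ (w - u) r + inner ℂ w (w - r)) := by
      simp only [inner_sub_left, inner_sub_right]; ring
    have e1 : ‖(inner ℂ w w : ℂ)‖ = N ^ 2 := by rw [inner_self_eq_norm_sq_to_K]; simp [nw]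
    have b1 : ‖(inner ℂ (w - u) r : ℂ)‖ ≤ N / 8 * (N + N / 8) :=
      (norm_inner_le_norm _ _).trans (by gcongr)
    have b2 : ‖(inner ℂ w (w - r) : ℂ)‖ ≤ N * (N / 8) :=
      (norm_inner_le_norm _ _).trans (by rw [nw]; gcongr)
    have := norm_add_le (inner ℂ u r : ℂ) (inner ℂ (w - u) r + inner ℂ w (w - r))
    have := norm_add_le (inner ℂ (w - u) r : ℂ) (inner ℂ w (w - r))
    rw [← e, e1] at *
    linarith
  have ht := D.tens_span j k (-k) ξ ξ hξ hξ
  have ht2 : D.m j ^ 2 * ‖inner ℂ u r‖ ≤ ‖D.Λ j u‖ * (D.m j * (N + N / 8)) := by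
    calc D.m j ^ 2 * ‖inner ℂ u r‖ = ‖((D.m j ^ 2 : ℝ) : ℂ) * inner ℂ u r‖ := by
          rw [norm_mul, Complex.norm_real, Real.norm_of_nonneg (by positivity)]
      _ = ‖inner ℂ (D.Λ j u) (D.Λ j r)‖ := by rw [ht]
      _ ≤ ‖D.Λ j u‖ * ‖D.Λ j r‖ := norm_inner_le_norm _ _
      _ ≤ _ := by gcongr; exact (D.Λ_le j r).trans (by gcongr)
  have hΛu : D.m j * (N / 2) ≤ ‖D.Λ j u‖ := by
    have a : D.m j * ‖inner ℂ u r‖ ≤ ‖D.Λ j u‖ * (N + N / 8) := by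
      have : D.m j * (D.m j * ‖inner ℂ u r‖) ≤ D.m j * (‖D.Λ j u‖ * (N + N / 8)) := by nlinarith
      exact le_of_mul_le_mul_left this hm
    have b : D.m j * (47/64 * N ^ 2) ≤ D.m j * ‖inner ℂ u r‖ := by gcongr; nlinarith
    have c : N * (D.m j * (N / 2)) ≤ N * ‖D.Λ j u‖ := by nlinarith [mul_pos hm (mul_pos hN hN)]
    exact le_of_mul_le_mul_left c hN
  have hΛw : D.m j * (3 * N / 8) ≤ ‖D.Λ j w‖ := by
    have : D.Λ j u = D.Λ j w - D.Λ j (w - u) := by rw [Λ_sub]; abel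
    have h2 := norm_sub_le (D.Λ j w) (D.Λ j (w - u))
    rw [← this] at h2
    have h3 := (D.Λ_le j (w - u)).trans (mul_le_mul_of_nonneg_left d1 hm.le)
    linarith
  calc D.m j ^ 2 * (3 * N / 8) ^ 2 = (D.m j * (3 * N / 8)) ^ 2 := by ring
    _ ≤ _ := by gcongr

lemma commute_aeval (A B : E →L[ℂ] E) (h : Commute A B) (P : Polynomial ℂ) :
    Commute A (Polynomial.aeval B P) := by
  induction P using Polynomial.induction_on' with
  | add p q hp hq => rw [map_add]; exact hp.add_right hq
  | monomial n c =>
    rw [Polynomial.aeval_monomial]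
    have hc : Commute A (algebraMap ℂ (E →L[ℂ] E) c) := (Algebra.commutes c A).symm
    exact hc.mul_right (h.pow_right n)

lemma comm' : Commute (cwmL D.S) (cwmL D.R) := by
  ext x
  exact congrArg (fun f : E ≃ₗᵢ[ℂ] E => f x) D.comm

lemma comm_aeval (P Q : Polynomial ℂ) :
    Commute (Polynomial.aeval (cwmL D.S) P) (Polynomial.aeval (cwmL D.R) Q) := by
  refine commute_aeval _ _ ?_ _
  exact (commute_aeval _ _ D.comm'.symm _).symm

lemma e_rec_n (j n : ℕ) (x : E) : inner ℂ (D.e j) x = 9 ^ n * inner ℂ (D.e (j + n))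
    (Polynomial.aeval (cwmL D.S) (cwmQ D.H D.s j n) (Polynomial.aeval (cwmL D.R) (cwmQ D.H D.s j n) x)) := by
  induction n with
  | zero => simp [cwmQ]
  | succ n ih =>
    rw [ih, D.e_rec, ← mul_assoc, ← pow_succ, ← add_assoc]
    congr 2
    have hQ : cwmQ D.H D.s j (n + 1) = cwmP (D.H (j+n)) (D.s (j+n)) * cwmQ D.H D.s j n := by
      rw [cwmQ, Finset.prod_range_succ, mul_comm]; rfl
    rw [hQ, map_mul, map_mul]
    have := D.comm_aeval (cwmQ D.H D.s j n) (cwmP (D.H (j+n)) (D.s (j+n)))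
    have h2 := congrArg (fun f : E →L[ℂ] E => f (Polynomial.aeval (cwmL D.R) (cwmQ D.H D.s j n) x)) this.eq
    change _ = _ at h2
    simp only [mul_apply_eq_comp, ContinuousLinearMap.comp_apply] at h2 ⊢
    rw [h2]

lemma m_rec_n (j n : ℕ) : D.m j = 3 ^ n * D.m (j + n) := by
  induction n with
  | zero => simp
  | succ n ih => rw [ih, D.m_rec (j + n), pow_succ, ← add_assoc]; ring

lemma H_n (j n : ℕ) : 3 ^ n * D.H j ≤ D.H (j + n) := by
  induction n with
  | zero => simp
  | succ n ih =>
    have := D.hH (j + n)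
    rw [← add_assoc, pow_succ]
    nlinarith

lemma H_pos (j : ℕ) : 1 ≤ D.H j := by
  have := D.H_n 0 j
  have h0 := D.hH0
  rw [zero_add] at this
  have h3 : 0 < 3 ^ j := by positivity
  nlinarith

lemma sum_blocks (f : ℕ → ℝ) (K H : ℕ) :
    ∑ i ∈ Finset.range (K * H), f i = ∑ p ∈ Finset.range K, ∑ a ∈ Finset.range H, f (p * H + a) := by
  induction K with
  | zero => simp
  | succ K ih => rw [Nat.succ_mul, Finset.sum_range_add, ih, Finset.sum_range_succ]

lemma Λ_sum (j : ℕ) (x : E) : ‖D.Λ j x‖ ^ 2 = ∑ a ∈ Finset.range (D.H j), ∑ b ∈ Finset.range (D.H j),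
    ‖inner ℂ (D.e j) ((D.R ^ b) ((D.S ^ a) x))‖ ^ 2 := by
  rw [Λ_norm_sq, Fintype.sum_prod_type, Finset.sum_range]
  refine Finset.sum_congr rfl fun a _ => ?_
  rw [Finset.sum_range]
  refine Finset.sum_congr rfl fun b _ => ?_
  rw [inner_v]

lemma bound_Q (ψ : E) (h : D.S (D.R ψ) = ψ) (j : ℕ) (c : ℝ)
    (hc : ∀ k : ℤ, D.m j ^ 2 * c ≤ ‖D.Λ j ((D.S ^ k) ψ)‖ ^ 2) (n : ℕ) :
    c ≤ ‖Polynomial.aeval (cwmL D.S) (cwmQ D.H D.s j n) ψ‖ ^ 2 := by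
  set QS := Polynomial.aeval (cwmL D.S) (cwmQ D.H D.s j n) with hQS
  set QR := Polynomial.aeval (cwmL D.R) (cwmQ D.H D.s j n) with hQR
  set g : ℕ → ℕ → ℝ := fun a b => ‖inner ℂ (D.e j) ((D.R ^ b) ((D.S ^ a) ψ))‖ ^ 2 with hg
  have cSR : Commute D.S D.R := D.comm
  have hQQ : QS (QR ψ) = QR (QS ψ) := by
    exact congrArg (fun f : E →L[ℂ] E => f ψ) (D.comm_aeval (cwmQ D.H D.s j n) (cwmQ D.H D.s j n)).eq
  have n1 : ‖QS (QR ψ)‖ ≤ ‖QS ψ‖ := by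
    rw [hQQ]
    refine (ContinuousLinearMap.le_opNorm _ _).trans ?_
    exact mul_le_of_le_one_left (norm_nonneg _) (cwmQ_norm_le _ _ _ _ _)
  -- commutation of powers with the polynomials
  have powL : ∀ (U : E ≃ₗᵢ[ℂ] E) (a : ℕ) (x : E), (U ^ a) x = ((cwmL U) ^ a) x := by
    intro U a x
    induction a generalizing x with
    | zero => rfl
    | succ a ih => rw [pow_succ, pow_succ, mul_app, ih]; rfl
  have cm : ∀ a b (x : E), QS (QR ((D.R ^ b) ((D.S ^ a) x))) = (D.R ^ b) ((D.S ^ a) (QS (QR x))) := by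
    intro a b x
    rw [powL, powL, powL, powL]
    have c1 : Commute (QS * QR) ((cwmL D.R) ^ b * (cwmL D.S) ^ a) := by
      have q1 : Commute QS (cwmL D.R) := (commute_aeval _ _ D.comm'.symm _).symm
      have q2 : Commute QS (cwmL D.S) := (commute_aeval _ _ (Commute.refl _) _).symm
      have q3 : Commute QR (cwmL D.R) := (commute_aeval _ _ (Commute.refl _) _).symm
      have q4 : Commute QR (cwmL D.S) := (commute_aeval _ _ D.comm' _).symm
      exact ((q1.pow_right b).mul_right (q2.pow_right a)).mul_left
        ((q3.pow_right b).mul_right (q4.pow_right a))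
    exact congrArg (fun f : E →L[ℂ] E => f x) c1.eq
  have gle : ∀ a b, g a b = 81 ^ n * ‖inner ℂ (D.e (j + n)) ((D.R ^ b) ((D.S ^ a) (QS (QR ψ))))‖ ^ 2 := by
    intro a b
    rw [hg]
    simp only
    rw [D.e_rec_n j n, ← hQS, ← hQR, cm, norm_mul, mul_pow]
    congr 1
    rw [norm_pow, ← pow_mul, mul_comm n 2, pow_mul]; norm_num
  have up : ∑ a ∈ Finset.range (D.H (j + n)), ∑ b ∈ Finset.range (D.H (j + n)), g a b
      ≤ 81 ^ n * (D.m (j + n) * ‖QS ψ‖) ^ 2 := by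
    simp_rw [gle, ← Finset.mul_sum]
    rw [← Λ_sum]
    gcongr
    refine (D.Λ_le _ _).trans ?_
    have := (D.m_pos (j + n)).le
    gcongr
  have low : 9 ^ n * (D.m j ^ 2 * c) ≤
      ∑ a ∈ Finset.range (D.H (j + n)), ∑ b ∈ Finset.range (D.H (j + n)), g a b := by
    have hsub : Finset.range (3 ^ n * D.H j) ⊆ Finset.range (D.H (j + n)) :=
      Finset.range_subset_range.2 (D.H_n j n)
    have gnn : ∀ a b, 0 ≤ g a b := fun a b => by positivity
    calc 9 ^ n * (D.m j ^ 2 * c)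
        = ∑ p ∈ Finset.range (3 ^ n), ∑ q ∈ Finset.range (3 ^ n), D.m j ^ 2 * c := by
          simp only [Finset.sum_const, Finset.card_range, nsmul_eq_mul]
          push_cast
          have h9 : (9:ℝ) ^ n = 3 ^ n * 3 ^ n := by rw [← mul_pow]; norm_num
          rw [h9]; ring
      _ ≤ ∑ p ∈ Finset.range (3 ^ n), ∑ q ∈ Finset.range (3 ^ n),
            ∑ a ∈ Finset.range (D.H j), ∑ b ∈ Finset.range (D.H j), g (p * D.H j + a) (q * D.H j + b) := by
          refine Finset.sum_le_sum fun p _ => Finset.sum_le_sum fun q _ => ?_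
          have := hc ((p * D.H j : ℕ) - (q * D.H j : ℕ) : ℤ)
          rw [Λ_sum] at this
          refine this.trans (le_of_eq ?_)
          refine Finset.sum_congr rfl fun a _ => Finset.sum_congr rfl fun b _ => ?_
          rw [hg]
          simp only
          congr 3
          have e1 : (D.S ^ ((p * D.H j : ℕ) - (q * D.H j : ℕ) : ℤ)) ψ
              = (D.R ^ (q * D.H j)) ((D.S ^ (p * D.H j)) ψ) := by
            rw [← mul_app, ← (cSR.pow_pow _ _).eq, mul_app]
            have := D.inv_zpow ψ h (-((q * D.H j : ℕ) : ℤ))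
            rw [neg_neg, zpow_natCast] at this
            rw [← this, ← zpow_natCast, ← mul_app, ← zpow_add, sub_eq_add_neg]
          rw [e1]
          simp only [← mul_app]
          congr 1
          rw [add_comm (q * D.H j), add_comm (p * D.H j), pow_add, pow_add]
          rw [mul_assoc, ← mul_assoc (D.S ^ a), (cSR.pow_pow a (q * D.H j)).eq]
          simp only [mul_assoc]
      _ = ∑ a ∈ Finset.range (3 ^ n * D.H j), ∑ b ∈ Finset.range (3 ^ n * D.H j), g a b := by
          rw [sum_blocks]
          refine Finset.sum_congr rfl fun p _ => ?_
          rw [Finset.sum_comm]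
          refine Finset.sum_congr rfl fun a _ => ?_
          rw [sum_blocks]
      _ ≤ ∑ a ∈ Finset.range (3 ^ n * D.H j), ∑ b ∈ Finset.range (D.H (j + n)), g a b :=
          Finset.sum_le_sum fun a _ => Finset.sum_le_sum_of_subset_of_nonneg hsub fun _ _ _ => gnn _ _
      _ ≤ _ := Finset.sum_le_sum_of_subset_of_nonneg hsub fun _ _ _ => Finset.sum_nonneg fun _ _ => gnn _ _
  have hh := low.trans up
  rw [D.m_rec_n j n] at hh
  have hm := D.m_pos (j + n)
  have e3 : (9:ℝ) ^ n * ((3 ^ n * D.m (j + n)) ^ 2 * c) = (81 ^ n * D.m (j + n) ^ 2) * c := by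
    have : (81:ℝ) ^ n = 9 ^ n * (3 ^ n) ^ 2 := by
      rw [← pow_mul, mul_comm n 2, pow_mul, ← mul_pow]; norm_num
    rw [this]; ring
  rw [e3, mul_pow, ← mul_assoc] at hh
  exact le_of_mul_le_mul_left hh (by positivity)

lemma eq_zero_of_Q (ψ : E) (h : D.S (D.R ψ) = ψ)
    (hl : ∀ j, Tendsto (fun n => ‖Polynomial.aeval (cwmL D.S) (cwmQ D.H D.s j n) ψ‖) atTop (𝓝 0)) :
    ψ = 0 := by
  by_contra hψ
  obtain ⟨j, c, hc, hb⟩ := D.lower ψ hψ h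
  have := (hl j).pow 2
  have h2 := ge_of_tendsto' this (D.bound_Q ψ h j c hb)
  norm_num at h2
  linarith

theorem S_fix (hs : ∀ i, D.s i = Nat.nth Nat.Prime i) (φ : E) (h : D.S (D.R φ) = φ) : D.S φ = φ := by
  rw [← sub_eq_zero]
  refine D.eq_zero_of_Q _ ?_ fun j => cwmQ_op D.H D.s hs j D.S φ
  have c : D.R (D.S φ) = D.S (D.R φ) := (congrArg (fun f : E ≃ₗᵢ[ℂ] E => f φ) D.comm).symm
  rw [map_sub, map_sub, c, h]

theorem eq_zero_of_fix (θ : E) (hS : D.S θ = θ) (hR : D.R θ = θ) (one : E)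
    (hone : Tendsto (fun j => ∑ i, D.v j i) atTop (𝓝 one)) (h0 : inner ℂ one θ = 0) : θ = 0 := by
  have vinner : ∀ j i, inner ℂ (D.v j i) θ = inner ℂ (D.e j) θ := by
    intro j i
    rw [inner_v]
    have a := zpow_fix D.S θ hS (i.1 : ℕ)
    have b := zpow_fix D.R θ hR (i.2 : ℕ)
    rw [zpow_natCast] at a b
    rw [a, b]
  have rec1 : ∀ j, inner ℂ (D.e j) θ = 9 * inner ℂ (D.e (j+1)) θ := by
    intro j
    rw [D.e_rec]
    have pS : ∀ (U : E ≃ₗᵢ[ℂ] E) (hU : U θ = θ), Polynomial.aeval (cwmL U) (cwmP (D.H j) (D.s j)) θ = θ := by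
      intro U hU
      have pw : ∀ n, ((cwmL U) ^ n) θ = θ := by
        intro n
        induction n with
        | zero => rfl
        | succ n ih => 
          rw [pow_succ]
          change ((cwmL U) ^ n) (U θ) = θ
          rw [hU, ih]
      have e : Polynomial.aeval (cwmL U) (cwmP (D.H j) (D.s j))
          = (1/3 : ℂ) • (1 + (cwmL U) ^ (D.H j) + (cwmL U) ^ (2 * D.H j + D.s j)) := by
        simp only [cwmP, map_mul, map_add, map_one, map_pow, Polynomial.aeval_X, Polynomial.aeval_C]
        rw [Algebra.smul_def]
      rw [e]
      simp only [ContinuousLinearMap.smul_apply, ContinuousLinearMap.add_apply, pw]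
      change (1/3 : ℂ) • (θ + θ + θ) = θ
      have : θ + θ + θ = (3:ℂ) • θ := by
        rw [show (3:ℂ) = 1 + 1 + 1 by norm_num, add_smul, add_smul, one_smul]
      rw [this, smul_smul]; norm_num
    rw [pS _ hR, pS _ hS]
  have rec_n : ∀ j n, inner ℂ (D.e j) θ = 9 ^ n * inner ℂ (D.e (j+n)) θ := by
    intro j n
    induction n with
    | zero => simp
    | succ n ih => rw [ih, rec1 (j + n), pow_succ, mul_assoc, ← add_assoc]
  have lim : Tendsto (fun j => ‖(inner ℂ (∑ i, D.v j i) θ : ℂ)‖) atTop (𝓝 0) := by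
    have := ((hone.inner (𝕜 := ℂ) (tendsto_const_nhds (x := θ)))).norm
    rwa [h0, norm_zero] at this
  have hsum : ∀ j, ‖(inner ℂ (∑ i, D.v j i) θ : ℂ)‖ = (D.H j : ℝ) ^ 2 * ‖(inner ℂ (D.e j) θ : ℂ)‖ := by
    intro j
    rw [sum_inner]
    simp only [vinner, Finset.sum_const, Finset.card_univ, Fintype.card_prod, Fintype.card_fin, nsmul_eq_mul]
    rw [norm_mul]
    push_cast
    rw [norm_mul, Complex.norm_natCast]
    ring
  have zero : ∀ j, (inner ℂ (D.e j) θ : ℂ) = 0 := by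
    intro j
    have l2 : Tendsto (fun n => ‖(inner ℂ (∑ i, D.v (j + n) i) θ : ℂ)‖) atTop (𝓝 0) := by
      exact lim.comp (tendsto_atTop_mono (fun n => Nat.le_add_left n j) tendsto_id)
    have : ‖(inner ℂ (D.e j) θ : ℂ)‖ ≤ 0 := by
      refine ge_of_tendsto' l2 fun n => ?_
      rw [hsum, rec_n j n, norm_mul, norm_pow]
      have h3 : (3:ℝ) ^ n ≤ D.H (j + n) := by
        have := D.H_n j n
        have h1 := D.H_pos j
        have : 3 ^ n ≤ D.H (j + n) := le_trans (Nat.le_mul_of_pos_right _ h1) this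
        exact_mod_cast this
      have h9 : ‖(9:ℂ)‖ ^ n = ((3:ℝ) ^ n) ^ 2 := by
        rw [← pow_mul, mul_comm, pow_mul]; norm_num
      rw [h9]
      gcongr
    exact norm_eq_zero.1 (le_antisymm this (norm_nonneg _))
  by_contra hθ
  have hN : 0 < ‖θ‖ := norm_pos_iff.2 hθ
  obtain ⟨j, ξ, hξ, hd⟩ := D.dense θ (‖θ‖ / 2) (by positivity)
  have hperp : (inner ℂ ξ θ : ℂ) = 0 := by
    clear hd
    induction hξ using Submodule.span_induction with
    | mem x hx => obtain ⟨i, rfl⟩ := hx; exact (vinner j i).trans (zero j)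
    | zero => simp
    | add x y _ _ hx hy => rw [inner_add_left, hx, hy, add_zero]
    | smul c x _ hx => rw [inner_smul_left, hx, mul_zero]
  have e : (inner ℂ θ θ : ℂ) = inner ℂ (θ - ξ) θ := by rw [inner_sub_left, hperp, sub_zero]
  have e1 : ‖(inner ℂ θ θ : ℂ)‖ = ‖θ‖ ^ 2 := by rw [inner_self_eq_norm_sq_to_K]; simp
  have := norm_inner_le_norm (𝕜 := ℂ) (θ - ξ) θ
  rw [← e, e1] at this
  nlinarith

end CwmData
end hs


section cwmMeas
set_option linter.unusedSectionVars false

/-- Indicator function of a set as an element of `L²`. -/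
noncomputable def cwmInd {Y : Type*} [MeasurableSpace Y] (ν : Measure Y) [IsFiniteMeasure ν] (A : Set Y) :
    Lp ℂ 2 ν := by
  classical
  exact if h : MeasurableSet A then indicatorConstLp 2 h (measure_ne_top ν A) (1 : ℂ) else 0

section gen
variable {Y : Type*} [MeasurableSpace Y] {ν : Measure Y} [IsFiniteMeasure ν]

lemma cwmInd_of {A : Set Y} (h : MeasurableSet A) :
    cwmInd ν A = indicatorConstLp 2 h (measure_ne_top ν A) (1 : ℂ) := by
  unfold cwmInd; rw [dif_pos h]

lemma cwmInd_ae {A B : Set Y} (hA : MeasurableSet A) (hB : MeasurableSet B) (h : A =ᵐ[ν] B) :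
    cwmInd ν A = cwmInd ν B := by
  rw [cwmInd_of hA, cwmInd_of hB, indicatorConstLp_inj _ _ _ _ one_ne_zero]; exact h

lemma cwmInd_union {A B : Set Y} (hA : MeasurableSet A) (hB : MeasurableSet B) (h : Disjoint A B) :
    cwmInd ν (A ∪ B) = cwmInd ν A + cwmInd ν B := by
  rw [cwmInd_of hA, cwmInd_of hB, cwmInd_of (hA.union hB)]
  exact indicatorConstLp_disjoint_union hA hB _ _ h _

lemma cwmInd_empty : cwmInd ν (∅ : Set Y) = 0 := by
  rw [cwmInd_of MeasurableSet.empty]; exact indicatorConstLp_empty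

lemma cwmInd_biUnion {ι : Type*} (F : Finset ι) (A : ι → Set Y) (hA : ∀ i ∈ F, MeasurableSet (A i))
    (hd : ∀ i ∈ F, ∀ i' ∈ F, i ≠ i' → Disjoint (A i) (A i')) :
    cwmInd ν (⋃ i ∈ F, A i) = ∑ i ∈ F, cwmInd ν (A i) := by
  classical
  induction F using Finset.induction_on with
  | empty => simp [cwmInd_empty]
  | insert a F ha ih =>
    rw [Finset.set_biUnion_insert, Finset.sum_insert ha, cwmInd_union, ih]
    · exact fun i hi => hA i (Finset.mem_insert_of_mem hi)
    · exact fun i hi i' hi' => hd i (Finset.mem_insert_of_mem hi) i' (Finset.mem_insert_of_mem hi')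
    · exact hA a (Finset.mem_insert_self _ _)
    · exact F.measurableSet_biUnion fun i hi => hA i (Finset.mem_insert_of_mem hi)
    · rw [Set.disjoint_iUnion₂_right]
      intro i hi
      exact hd a (Finset.mem_insert_self _ _) i (Finset.mem_insert_of_mem hi)
        (fun h => ha (h ▸ hi))

lemma cwmInd_inner {A B : Set Y} (hA : MeasurableSet A) (hB : MeasurableSet B) :
    inner ℂ (cwmInd ν A) (cwmInd ν B) = ((ν.real (A ∩ B) : ℝ) : ℂ) := by
  rw [cwmInd_of hA, cwmInd_of hB]
  exact L2.inner_indicatorConstLp_one_indicatorConstLp_one hA hB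

lemma cwmInd_dist {A B : Set Y} (hA : MeasurableSet A) (hB : MeasurableSet B) :
    ‖cwmInd ν A - cwmInd ν B‖ ^ 2 = ν.real (A ∆ B) := by
  rw [cwmInd_of hA, cwmInd_of hB, ← dist_eq_norm, dist_indicatorConstLp_eq_norm,
    norm_indicatorConstLp (by norm_num) (by norm_num)]
  simp
  rw [← Real.rpow_natCast, ← Real.rpow_mul measureReal_nonneg]
  norm_num

lemma cwmInd_inner_left {A : Set Y} (hA : MeasurableSet A) (f : Lp ℂ 2 ν) :
    inner ℂ (cwmInd ν A) f = ∫ x in A, f x ∂ν := by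
  rw [cwmInd_of hA]; exact L2.inner_indicatorConstLp_one hA _ f

/-- The Koopman operator. -/
noncomputable def cwmK (e : Y ≃ᵐ Y) (he : MeasurePreserving e ν ν) : Lp ℂ 2 ν ≃ₗᵢ[ℂ] Lp ℂ 2 ν :=
  LinearIsometryEquiv.ofSurjective (Lp.compMeasurePreservingₗᵢ ℂ e he) (by
    intro f
    refine ⟨Lp.compMeasurePreserving e.symm (he.symm e) f, ?_⟩
    change Lp.compMeasurePreserving e he (Lp.compMeasurePreserving e.symm (he.symm e) f) = f
    rw [← Lp.compMeasurePreserving_comp_apply]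
    have : ∀ (g : Y → Y) (hg : MeasurePreserving g ν ν), g = id → Lp.compMeasurePreserving g hg f = f := by
      rintro g hg rfl; exact Lp.compMeasurePreserving_id_apply f
    exact this _ _ (by ext x; simp))

lemma cwmK_apply (e : Y ≃ᵐ Y) (he : MeasurePreserving e ν ν) (f : Lp ℂ 2 ν) :
    cwmK e he f = Lp.compMeasurePreserving e he f := rfl

lemma cwmK_ind (e : Y ≃ᵐ Y) (he : MeasurePreserving e ν ν) {A : Set Y} (hA : MeasurableSet A) :
    cwmK e he (cwmInd ν A) = cwmInd ν (e ⁻¹' A) := by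
  rw [cwmInd_of hA, cwmInd_of (he.measurable hA), cwmK_apply]
  exact Lp.indicatorConstLp_compMeasurePreserving hA _ _ he

lemma cwmK_inv_ind (e : Y ≃ᵐ Y) (he : MeasurePreserving e ν ν) {A : Set Y} (hA : MeasurableSet A) :
    (cwmK e he)⁻¹ (cwmInd ν A) = cwmInd ν (e.symm ⁻¹' A) := by
  have h : cwmInd ν A = cwmK e he (cwmInd ν (e.symm ⁻¹' A)) := by
    rw [cwmK_ind _ _ (e.symm.measurable hA), ← Set.preimage_comp]; simp
  rw [h]
  exact (cwmK e he).symm_apply_apply _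

lemma cwmK_comm (e f : Y ≃ᵐ Y) (he : MeasurePreserving e ν ν) (hf : MeasurePreserving f ν ν)
    (h : ∀ x, e (f x) = f (e x)) : cwmK e he * cwmK f hf = cwmK f hf * cwmK e he := by
  apply LinearIsometryEquiv.ext
  intro x
  change Lp.compMeasurePreserving e he (Lp.compMeasurePreserving f hf x) =
    Lp.compMeasurePreserving f hf (Lp.compMeasurePreserving e he x)
  rw [← Lp.compMeasurePreserving_comp_apply, ← Lp.compMeasurePreserving_comp_apply]
  congr 2
  ext x
  exact (h x).symm

end gen

section prodpart
variable {X : Type*} [MeasurableSpace X] {μ : Measure X} [IsProbabilityMeasure μ]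
  (T : X ≃ᵐ X) (hT : MeasurePreserving T μ μ)

lemma cwmS_mp (hT : MeasurePreserving T μ μ) : MeasurePreserving (MeasurableEquiv.prodCongr T (MeasurableEquiv.refl X)) (μ.prod μ) (μ.prod μ) :=
  hT.prod (MeasurePreserving.id μ)

lemma cwmR_mp (hT : MeasurePreserving T μ μ) : MeasurePreserving (MeasurableEquiv.prodCongr (MeasurableEquiv.refl X) T) (μ.prod μ) (μ.prod μ) :=
  (MeasurePreserving.id μ).prod hT

/-- Koopman operator on the first coordinate. -/
noncomputable def cwmS : Lp ℂ 2 (μ.prod μ) ≃ₗᵢ[ℂ] Lp ℂ 2 (μ.prod μ) :=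
  cwmK (MeasurableEquiv.prodCongr T (MeasurableEquiv.refl X)) (cwmS_mp T hT)

/-- Koopman operator on the second coordinate. -/
noncomputable def cwmR : Lp ℂ 2 (μ.prod μ) ≃ₗᵢ[ℂ] Lp ℂ 2 (μ.prod μ) :=
  cwmK (MeasurableEquiv.prodCongr (MeasurableEquiv.refl X) T) (cwmR_mp T hT)

lemma cwmSR_comm : cwmS T hT * cwmR T hT = cwmR T hT * cwmS T hT := by
  apply cwmK_comm
  intro x
  rfl

/-- Indicator of a rectangle. -/
noncomputable def cwmRect (μ : Measure X) [IsProbabilityMeasure μ] (A B : Set X) : Lp ℂ 2 (μ.prod μ) :=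
  cwmInd (μ.prod μ) (A ×ˢ B)

variable {A B A' B' : Set X}

lemma cwmS_rect (hA : MeasurableSet A) (hB : MeasurableSet B) :
    cwmS T hT (cwmRect μ A B) = cwmRect μ (T ⁻¹' A) B := by
  unfold cwmS cwmRect
  rw [cwmK_ind _ _ (hA.prod hB)]
  rfl

lemma cwmS_inv_rect (hA : MeasurableSet A) (hB : MeasurableSet B) :
    (cwmS T hT)⁻¹ (cwmRect μ A B) = cwmRect μ (T.symm ⁻¹' A) B := by
  unfold cwmS cwmRect
  rw [cwmK_inv_ind _ _ (hA.prod hB)]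
  rfl

lemma cwmR_rect (hA : MeasurableSet A) (hB : MeasurableSet B) :
    cwmR T hT (cwmRect μ A B) = cwmRect μ A (T ⁻¹' B) := by
  unfold cwmR cwmRect
  rw [cwmK_ind _ _ (hA.prod hB)]
  rfl

lemma cwmR_inv_rect (hA : MeasurableSet A) (hB : MeasurableSet B) :
    (cwmR T hT)⁻¹ (cwmRect μ A B) = cwmRect μ A (T.symm ⁻¹' B) := by
  unfold cwmR cwmRect
  rw [cwmK_inv_ind _ _ (hA.prod hB)]
  rfl

/-- The level of height `a` over `A`. -/
def cwmLev (a : ℕ) (A : Set X) : Set X := (⇑T.symm)^[a] ⁻¹' A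

lemma cwmLev_meas (a : ℕ) (hA : MeasurableSet A) : MeasurableSet (cwmLev T a A) :=
  (T.symm.measurable.iterate a) hA

lemma cwmLev_eq (a : ℕ) (A : Set X) : (⇑T)^[a] '' A = cwmLev T a A := by
  refine congrFun (Set.image_eq_preimage_of_inverse ?_ ?_) A
  · exact Function.LeftInverse.iterate T.symm_apply_apply a
  · exact Function.RightInverse.iterate T.apply_symm_apply a

lemma cwmLev_succ (a : ℕ) (A : Set X) : cwmLev T (a + 1) A = T.symm ⁻¹' (cwmLev T a A) := rfl

lemma cwmLev_add (a b : ℕ) (A : Set X) : cwmLev T (a + b) A = cwmLev T a (cwmLev T b A) := by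
  unfold cwmLev
  rw [add_comm, Function.iterate_add]; rfl

lemma cwmLev_union (a : ℕ) (A B : Set X) : cwmLev T a (A ∪ B) = cwmLev T a A ∪ cwmLev T a B := rfl

lemma cwmLev_measure (hT : MeasurePreserving T μ μ) (a : ℕ) (hA : MeasurableSet A) : μ (cwmLev T a A) = μ A :=
  ((hT.symm T).iterate a).measure_preimage hA.nullMeasurableSet

lemma cwmLev_ae (hT : MeasurePreserving T μ μ) (a : ℕ) (h : A =ᵐ[μ] B) : cwmLev T a A =ᵐ[μ] cwmLev T a B :=
  ((hT.symm T).iterate a).quasiMeasurePreserving.preimage_ae_eq h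

lemma cwmS_pow_inv_rect (a : ℕ) (hA : MeasurableSet A) (hB : MeasurableSet B) :
    ((cwmS T hT) ^ a)⁻¹ (cwmRect μ A B) = cwmRect μ (cwmLev T a A) B := by
  induction a with
  | zero => simp; rfl
  | succ a ih =>
    rw [pow_succ, mul_inv_rev, CwmData.mul_app, ih, cwmS_inv_rect T hT (cwmLev_meas T a hA) hB]
    rfl

lemma cwmR_pow_inv_rect (a : ℕ) (hA : MeasurableSet A) (hB : MeasurableSet B) :
    ((cwmR T hT) ^ a)⁻¹ (cwmRect μ A B) = cwmRect μ A (cwmLev T a B) := by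
  induction a with
  | zero => simp; rfl
  | succ a ih =>
    rw [pow_succ, mul_inv_rev, CwmData.mul_app, ih, cwmR_inv_rect T hT hA (cwmLev_meas T a hB)]
    rfl

lemma cwmSR_rect (a b : ℕ) (hA : MeasurableSet A) (hB : MeasurableSet B) :
    ((cwmS T hT) ^ a)⁻¹ (((cwmR T hT) ^ b)⁻¹ (cwmRect μ A B)) = cwmRect μ (cwmLev T a A) (cwmLev T b B) := by
  rw [cwmR_pow_inv_rect T hT b hA hB, cwmS_pow_inv_rect T hT a hA (cwmLev_meas T b hB)]

lemma cwmS_zpow_rect (k : ℤ) (hA : MeasurableSet A) (hB : MeasurableSet B) :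
    ∃ A', MeasurableSet A' ∧ ((cwmS T hT) ^ k) (cwmRect μ A B) = cwmRect μ A' B := by
  induction k with
  | zero => exact ⟨A, hA, by simp⟩
  | succ n ih =>
    obtain ⟨A', hA', h⟩ := ih
    refine ⟨T ⁻¹' A', T.measurable hA', ?_⟩
    rw [add_comm, zpow_add, zpow_one, CwmData.mul_app, h, cwmS_rect T hT hA' hB]
  | pred n ih =>
    obtain ⟨A', hA', h⟩ := ih
    refine ⟨T.symm ⁻¹' A', T.symm.measurable hA', ?_⟩
    rw [sub_eq_add_neg, add_comm, zpow_add, zpow_neg_one, CwmData.mul_app, h, cwmS_inv_rect T hT hA' hB]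

lemma cwmR_zpow_rect (k : ℤ) (hA : MeasurableSet A) (hB : MeasurableSet B) :
    ∃ B', MeasurableSet B' ∧ ((cwmR T hT) ^ k) (cwmRect μ A B) = cwmRect μ A B' := by
  induction k with
  | zero => exact ⟨B, hB, by simp⟩
  | succ n ih =>
    obtain ⟨A', hA', h⟩ := ih
    refine ⟨T ⁻¹' A', T.measurable hA', ?_⟩
    rw [add_comm, zpow_add, zpow_one, CwmData.mul_app, h, cwmR_rect T hT hA hA']
  | pred n ih =>
    obtain ⟨A', hA', h⟩ := ih
    refine ⟨T.symm ⁻¹' A', T.symm.measurable hA', ?_⟩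
    rw [sub_eq_add_neg, add_comm, zpow_add, zpow_neg_one, CwmData.mul_app, h, cwmR_inv_rect T hT hA hA']

lemma cwmRect_inner (hA : MeasurableSet A) (hB : MeasurableSet B) (hA' : MeasurableSet A')
    (hB' : MeasurableSet B') : inner ℂ (cwmRect μ A B) (cwmRect μ A' B') =
      ((μ.real (A ∩ A') * μ.real (B ∩ B') : ℝ) : ℂ) := by
  unfold cwmRect
  rw [cwmInd_inner (hA.prod hB) (hA'.prod hB'), Set.prod_inter_prod, measureReal_prod_prod]

lemma cwmRect_ae (hA : MeasurableSet A) (hB : MeasurableSet B) (hA' : MeasurableSet A')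
    (hB' : MeasurableSet B') (h : A =ᵐ[μ] A') (h' : B =ᵐ[μ] B') : cwmRect μ A B = cwmRect μ A' B' :=
  cwmInd_ae (hA.prod hB) (hA'.prod hB') (Measure.set_prod_ae_eq h h')

lemma cwmRect_union_left (hA : MeasurableSet A) (hA' : MeasurableSet A') (hB : MeasurableSet B)
    (h : Disjoint A A') : cwmRect μ (A ∪ A') B = cwmRect μ A B + cwmRect μ A' B := by
  unfold cwmRect
  rw [Set.union_prod, cwmInd_union (hA.prod hB) (hA'.prod hB) (Set.Disjoint.set_prod_left h B B)]

lemma cwmRect_union_right (hA : MeasurableSet A) (hB : MeasurableSet B) (hB' : MeasurableSet B')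
    (h : Disjoint B B') : cwmRect μ A (B ∪ B') = cwmRect μ A B + cwmRect μ A B' := by
  unfold cwmRect
  rw [Set.prod_union, cwmInd_union (hA.prod hB) (hA.prod hB') (Set.Disjoint.set_prod_right h A A)]

end prodpart
end cwmMeas


section cwmChacon
set_option linter.unusedSectionVars false
variable {X : Type*} [MeasurableSpace X] {μ : Measure X} [IsProbabilityMeasure μ] {s : ℕ → ℕ}
  (C : ChaconMap μ s)

/-- Level `a` of the (shifted) tower `j`. -/
def cwmlv (j a : ℕ) : Set X := cwmLev C.T a (C.E (j + 1))

/-- Number of levels of the shifted tower. -/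
def cwmH (j : ℕ) : ℕ := C.h (j + 1) + 1

lemma cwmH_succ (j : ℕ) : cwmH C (j + 1) = 3 * cwmH C j + s (j + 1) := by
  unfold cwmH
  rw [C.h_succ (j + 1) (by omega)]; ring

lemma cwmlv_meas (j a : ℕ) : MeasurableSet (cwmlv C j a) := cwmLev_meas _ _ (C.measE _)

lemma cwmlv_disj (j a b : ℕ) (ha : a < cwmH C j) (hb : b < cwmH C j) (hab : a ≠ b) :
    Disjoint (cwmlv C j a) (cwmlv C j b) := by
  have := C.tower_disjoint (j + 1) (by omega) a (Nat.lt_succ_iff.1 ha) b (Nat.lt_succ_iff.1 hb) hab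
  rwa [cwmLev_eq, cwmLev_eq] at this

/-- Measure of the levels. -/
noncomputable def cwmm (j : ℕ) : ℝ := μ.real (C.E (j + 1))

lemma cwmlv_real (j a : ℕ) : μ.real (cwmlv C j a) = cwmm C j := by
  unfold cwmm cwmlv Measure.real
  rw [cwmLev_measure C.T C.measurePreserving a (C.measE _)]

lemma cwm_E2_ae (j : ℕ) : C.E2 (j + 1) =ᵐ[μ] cwmLev C.T (cwmH C j) (C.E (j + 2)) := by
  have := C.stack1 (j + 1) (by omega)
  rw [measure_symmDiff_eq_zero_iff, cwmLev_eq, ← C.E_next (j + 1) (by omega)] at this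
  exact this.symm

lemma cwm_E3_ae (j : ℕ) : C.E3 (j + 1) =ᵐ[μ]
    cwmLev C.T (2 * cwmH C j + s (j + 1)) (C.E (j + 2)) := by
  have := C.stack2 (j + 1) (by omega)
  rw [measure_symmDiff_eq_zero_iff, cwmLev_eq] at this
  refine this.symm.trans ?_
  refine (cwmLev_ae C.T C.measurePreserving _ (cwm_E2_ae C j)).trans ?_
  rw [← cwmLev_add]
  have e : C.h (j + 1) + 1 + s (j + 1) + cwmH C j = 2 * cwmH C j + s (j + 1) := by unfold cwmH; ring
  rw [e]
  exact ae_eq_refl _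

lemma cwm_E_ae (j : ℕ) : C.E (j + 1) =ᵐ[μ] (C.E (j + 2) ∪ cwmLev C.T (cwmH C j) (C.E (j + 2)) ∪
    cwmLev C.T (2 * cwmH C j + s (j + 1)) (C.E (j + 2)) : Set X) := by
  conv_lhs => rw [C.E_union (j + 1) (by omega), ← C.E_next (j + 1) (by omega)]
  exact ((ae_eq_refl _).union (cwm_E2_ae C j)).union (cwm_E3_ae C j)

lemma cwmlv_ae (j a : ℕ) : cwmlv C j a =ᵐ[μ] (cwmlv C (j + 1) a ∪ cwmlv C (j + 1) (a + cwmH C j) ∪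
    cwmlv C (j + 1) (a + (2 * cwmH C j + s (j + 1))) : Set X) := by
  refine (cwmLev_ae C.T C.measurePreserving a (cwm_E_ae C j)).trans ?_
  rw [cwmLev_union, cwmLev_union, ← cwmLev_add, ← cwmLev_add]
  rfl

lemma cwmm_rec (j : ℕ) : cwmm C j = 3 * cwmm C (j + 1) := by
  have h1 : 1 ≤ j + 1 := by omega
  unfold cwmm
  rw [C.E_union _ h1, measureReal_union _ (C.measE3 _), measureReal_union (C.E_disj12 _ h1) (C.measE2 _),
    C.E_next _ h1]
  · have a : μ.real (C.E1 (j+1)) = μ.real (C.E2 (j+1)) := by simp only [Measure.real, C.E_meas12 _ h1]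
    have b : μ.real (C.E2 (j+1)) = μ.real (C.E3 (j+1)) := by simp only [Measure.real, C.E_meas23 _ h1]
    linarith
  · exact Disjoint.union_left (C.E_disj13 _ h1) (C.E_disj23 _ h1)

/-- The union of a family of levels. -/
def cwmU (j : ℕ) (F : Finset ℕ) : Set X := ⋃ a ∈ F, cwmlv C j a

lemma cwmU_meas (j : ℕ) (F : Finset ℕ) : MeasurableSet (cwmU C j F) :=
  F.measurableSet_biUnion fun a _ => cwmlv_meas C j a

lemma cwmU_full : Tendsto (fun j => μ (cwmU C j (Finset.range (cwmH C j)))) atTop (𝓝 1) := by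
  have := C.tower_full.comp (tendsto_add_atTop_nat 1)
  refine this.congr fun j => ?_
  simp only [Function.comp, cwmU, cwmlv, cwmH, cwmLev_eq]

lemma cwmm_pos (j : ℕ) : 0 < cwmm C j := by
  by_contra hneg
  have hz : cwmm C j = 0 := le_antisymm (not_lt.1 hneg) measureReal_nonneg
  have h0 : cwmm C 0 = 0 := by
    have : ∀ n, cwmm C 0 = 3 ^ n * cwmm C n := by
      intro n
      induction n with
      | zero => simp
      | succ n ih => rw [ih, cwmm_rec C n, pow_succ]; ring
    rw [this j, hz, mul_zero]
  have hall : ∀ n, cwmm C n = 0 := by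
    intro n
    induction n with
    | zero => exact h0
    | succ n ih => have := cwmm_rec C n; linarith
  have hU : ∀ n, μ (cwmU C n (Finset.range (cwmH C n))) = 0 := by
    intro n
    unfold cwmU
    refine (measure_biUnion_null_iff (Finset.countable_toSet (Finset.range (cwmH C n)))).2 ?_
    intro a _
    have := cwmlv_real C n a
    rw [hall n] at this
    exact (measureReal_eq_zero_iff).1 this
  have := cwmU_full C
  simp_rw [hU] at this
  exact zero_ne_one (tendsto_nhds_unique tendsto_const_nhds this)

lemma cwm_inter_real (j a b : ℕ) (ha : a < cwmH C j) (hb : b < cwmH C j) :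
    μ.real (cwmlv C j a ∩ cwmlv C j b) = if a = b then cwmm C j else 0 := by
  split_ifs with h
  · subst h; rw [Set.inter_self, cwmlv_real]
  · rw [(cwmlv_disj C j a b ha hb h).inter_eq]; simp

/-- The base vector. -/
noncomputable def cwme (j : ℕ) : Lp ℂ 2 (μ.prod μ) := cwmRect μ (C.E (j + 1)) (C.E (j + 1))

/-- First Koopman operator of the Chacon map. -/
noncomputable def cwmCS : Lp ℂ 2 (μ.prod μ) ≃ₗᵢ[ℂ] Lp ℂ 2 (μ.prod μ) := cwmS C.T C.measurePreserving

/-- Second Koopman operator of the Chacon map. -/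
noncomputable def cwmCR : Lp ℂ 2 (μ.prod μ) ≃ₗᵢ[ℂ] Lp ℂ 2 (μ.prod μ) := cwmR C.T C.measurePreserving

lemma cwm_v (j a b : ℕ) : ((cwmCS C) ^ a)⁻¹ (((cwmCR C) ^ b)⁻¹ (cwme C j)) =
    cwmRect μ (cwmlv C j a) (cwmlv C j b) :=
  cwmSR_rect C.T C.measurePreserving a b (C.measE _) (C.measE _)

lemma cwm_e_split (j : ℕ) : cwme C j =
    ∑ p : Fin 3, ∑ q : Fin 3, cwmRect μ
      (cwmLev C.T (![0, cwmH C j, 2 * cwmH C j + s (j + 1)] p) (C.E (j + 2)))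
      (cwmLev C.T (![0, cwmH C j, 2 * cwmH C j + s (j + 1)] q) (C.E (j + 2))) := by
  have h1 : 1 ≤ j + 1 := by omega
  set F : Fin 3 → Set X := ![C.E1 (j + 1), C.E2 (j + 1), C.E3 (j + 1)] with hF
  have hFm : ∀ p, MeasurableSet (F p) := by
    intro p
    fin_cases p
    · exact C.measE1 _
    · exact C.measE2 _
    · exact C.measE3 _
  have hFae : ∀ p, F p =ᵐ[μ] cwmLev C.T (![0, cwmH C j, 2 * cwmH C j + s (j + 1)] p) (C.E (j + 2)) := by
    intro p
    fin_cases p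
    · have : C.E (j + 2) = C.E1 (j + 1) := C.E_next (j + 1) h1
      change C.E1 (j + 1) =ᵐ[μ] cwmLev C.T 0 (C.E (j + 2))
      rw [this]
      exact ae_eq_refl _
    · exact cwm_E2_ae C j
    · exact cwm_E3_ae C j
  have e1 : cwme C j = ∑ p : Fin 3, ∑ q : Fin 3, cwmRect μ (F p) (F q) := by
    have d : Disjoint (C.E1 (j + 1) ∪ C.E2 (j + 1)) (C.E3 (j + 1)) :=
      Disjoint.union_left (C.E_disj13 _ h1) (C.E_disj23 _ h1)
    have m1 := C.measE1 (j + 1)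
    have m2 := C.measE2 (j + 1)
    have m3 := C.measE3 (j + 1)
    have key : ∀ A, MeasurableSet A → cwmRect μ A (C.E (j + 1)) = ∑ q : Fin 3, cwmRect μ A (F q) := by
      intro A hA
      rw [C.E_union _ h1, cwmRect_union_right hA (m1.union m2) m3 d,
        cwmRect_union_right hA m1 m2 (C.E_disj12 _ h1), Fin.sum_univ_three]
      rfl
    unfold cwme
    have : cwmRect μ (C.E (j + 1)) (C.E (j + 1)) = ∑ p : Fin 3, cwmRect μ (F p) (C.E (j + 1)) := by
      conv_lhs =>
        rw [C.E_union _ h1, ← C.E_union _ h1, cwmRect]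
        enter [2, 1]
        rw [C.E_union _ h1]
      change cwmRect μ _ _ = _
      rw [cwmRect_union_left (m1.union m2) m3 (C.measE _) d,
        cwmRect_union_left m1 m2 (C.measE _) (C.E_disj12 _ h1), Fin.sum_univ_three]
      rfl
    rw [this]
    exact Finset.sum_congr rfl fun p _ => key _ (hFm p)
  rw [e1]
  refine Finset.sum_congr rfl fun p _ => Finset.sum_congr rfl fun q _ => ?_
  exact cwmRect_ae (hFm p) (hFm q) (cwmLev_meas _ _ (C.measE _)) (cwmLev_meas _ _ (C.measE _))
    (hFae p) (hFae q)

lemma cwmL_pow {E : Type*} [NormedAddCommGroup E] [InnerProductSpace ℂ E] [CompleteSpace E]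
    (U : E ≃ₗᵢ[ℂ] E) (a : ℕ) (x : E) : ((cwmL U) ^ a) x = (U ^ a) x := by
  induction a generalizing x with
  | zero => rfl
  | succ a ih => rw [pow_succ, pow_succ, CwmData.mul_app, ← ih]; rfl

lemma cwmP_apply {E : Type*} [NormedAddCommGroup E] [InnerProductSpace ℂ E] [CompleteSpace E]
    (U : E ≃ₗᵢ[ℂ] E) (H t : ℕ) (x : E) : Polynomial.aeval (cwmL U) (cwmP H t) x =
      (1/3 : ℂ) • ∑ p : Fin 3, (U ^ (![0, H, 2 * H + t] p)) x := by
  have e : Polynomial.aeval (cwmL U) (cwmP H t)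
      = (1/3 : ℂ) • ((cwmL U) ^ 0 + (cwmL U) ^ H + (cwmL U) ^ (2 * H + t)) := by
    simp only [cwmP, map_mul, map_add, map_one, map_pow, Polynomial.aeval_X, Polynomial.aeval_C]
    rw [Algebra.smul_def, pow_zero]
  rw [e, Fin.sum_univ_three]
  simp only [smul_apply, add_apply, cwmL_pow]
  rfl

lemma cwm_e_rec (j : ℕ) (x : Lp ℂ 2 (μ.prod μ)) : inner ℂ (cwme C j) x = 9 * inner ℂ (cwme C (j + 1))
    (Polynomial.aeval (cwmL (cwmCS C)) (cwmP (cwmH C j) (s (j + 1)))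
      (Polynomial.aeval (cwmL (cwmCR C)) (cwmP (cwmH C j) (s (j + 1))) x)) := by
  rw [cwmP_apply, cwmP_apply, cwm_e_split, sum_inner, inner_smul_right, inner_sum, Finset.mul_sum,
    Finset.mul_sum]
  refine Finset.sum_congr rfl fun p _ => ?_
  rw [sum_inner, map_smul, inner_smul_right, map_sum, inner_sum, Finset.mul_sum, Finset.mul_sum,
    Finset.mul_sum]
  refine Finset.sum_congr rfl fun q _ => ?_
  have : cwmRect μ
      (cwmLev C.T (![0, cwmH C j, 2 * cwmH C j + s (j + 1)] p) (C.E (j + 2)))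
      (cwmLev C.T (![0, cwmH C j, 2 * cwmH C j + s (j + 1)] q) (C.E (j + 2))) =
      ((cwmCR C) ^ (![0, cwmH C j, 2 * cwmH C j + s (j + 1)] q))⁻¹
      (((cwmCS C) ^ (![0, cwmH C j, 2 * cwmH C j + s (j + 1)] p))⁻¹ (cwme C (j + 1))) := by
    unfold cwmCR cwmCS cwme
    rw [cwmS_pow_inv_rect _ _ _ (C.measE _) (C.measE _),
      cwmR_pow_inv_rect _ _ _ (cwmLev_meas _ _ (C.measE _)) (C.measE _)]
  rw [this, CwmData.inner_inv, CwmData.inner_inv]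
  ring

lemma cwm_orth (j a : ℕ) (ha : a < cwmH C j) (b : ℕ) (hb : b < cwmH C j) (a' : ℕ) (ha' : a' < cwmH C j)
    (b' : ℕ) (hb' : b' < cwmH C j) :
    inner ℂ (((cwmCS C) ^ a)⁻¹ (((cwmCR C) ^ b)⁻¹ (cwme C j)))
      (((cwmCS C) ^ a')⁻¹ (((cwmCR C) ^ b')⁻¹ (cwme C j))) =
      if a = a' ∧ b = b' then ((cwmm C j ^ 2 : ℝ) : ℂ) else 0 := by
  rw [cwm_v, cwm_v, cwmRect_inner (cwmlv_meas _ _ _) (cwmlv_meas _ _ _) (cwmlv_meas _ _ _)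
    (cwmlv_meas _ _ _), cwm_inter_real C j a a' ha ha', cwm_inter_real C j b b' hb hb']
  by_cases h1 : a = a' <;> by_cases h2 : b = b' <;> simp [h1, h2, sq]

lemma cwm_tens (j a : ℕ) (_ha : a < cwmH C j) (b : ℕ) (hb : b < cwmH C j) (a' : ℕ) (ha' : a' < cwmH C j)
    (b' : ℕ) (_hb' : b' < cwmH C j) (k l : ℤ) :
    ((cwmm C j ^ 2 : ℝ) : ℂ) * inner ℂ (((cwmCS C) ^ k) (((cwmCS C) ^ a)⁻¹ (((cwmCR C) ^ b)⁻¹ (cwme C j))))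
      (((cwmCR C) ^ l) (((cwmCS C) ^ a')⁻¹ (((cwmCR C) ^ b')⁻¹ (cwme C j))))
    = ∑ i : Fin (cwmH C j) × Fin (cwmH C j),
      inner ℂ (((cwmCS C) ^ k) (((cwmCS C) ^ a)⁻¹ (((cwmCR C) ^ b)⁻¹ (cwme C j))))
        (((cwmCS C) ^ (i.1:ℕ))⁻¹ (((cwmCR C) ^ (i.2:ℕ))⁻¹ (cwme C j))) *
      inner ℂ (((cwmCS C) ^ (i.1:ℕ))⁻¹ (((cwmCR C) ^ (i.2:ℕ))⁻¹ (cwme C j)))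
        (((cwmCR C) ^ l) (((cwmCS C) ^ a')⁻¹ (((cwmCR C) ^ b')⁻¹ (cwme C j)))) := by
  simp only [cwm_v]
  obtain ⟨A, hA, eA⟩ := cwmS_zpow_rect C.T C.measurePreserving k (cwmlv_meas C j a) (cwmlv_meas C j b)
  obtain ⟨B, hB, eB⟩ := cwmR_zpow_rect C.T C.measurePreserving l (cwmlv_meas C j a') (cwmlv_meas C j b')
  have eA' : ((cwmCS C) ^ k) (cwmRect μ (cwmlv C j a) (cwmlv C j b)) = cwmRect μ A (cwmlv C j b) := eA
  have eB' : ((cwmCR C) ^ l) (cwmRect μ (cwmlv C j a') (cwmlv C j b')) = cwmRect μ (cwmlv C j a') B := eB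
  rw [eA', eB', Finset.sum_eq_single ((⟨a', ha'⟩, ⟨b, hb⟩) : Fin (cwmH C j) × Fin (cwmH C j))]
  · rw [cwmRect_inner hA (cwmlv_meas _ _ _) (cwmlv_meas _ _ _) hB,
      cwmRect_inner hA (cwmlv_meas _ _ _) (cwmlv_meas _ _ _) (cwmlv_meas _ _ _),
      cwmRect_inner (cwmlv_meas _ _ _) (cwmlv_meas _ _ _) (cwmlv_meas _ _ _) hB,
      cwm_inter_real C j b b hb hb, cwm_inter_real C j a' a' ha' ha', if_pos rfl, if_pos rfl]
    push_cast
    ring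
  · intro i _ hi
    rw [cwmRect_inner hA (cwmlv_meas _ _ _) (cwmlv_meas _ _ _) (cwmlv_meas _ _ _),
      cwmRect_inner (cwmlv_meas _ _ _) (cwmlv_meas _ _ _) (cwmlv_meas _ _ _) hB,
      cwm_inter_real C j b i.2 hb i.2.2, cwm_inter_real C j i.1 a' i.1.2 ha']
    by_cases h1 : (i.1 : ℕ) = a'
    · by_cases h2 : b = (i.2 : ℕ)
      · exact absurd (Prod.ext (Fin.ext h1) (Fin.ext h2.symm)) hi
      · rw [if_neg h2]; simp
    · rw [if_neg h1]; simp
  · intro h; exact absurd (Finset.mem_univ _) h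

end cwmChacon


section cwmDense
set_option linter.unusedSectionVars false
variable {X : Type*} [MeasurableSpace X] {μ : Measure X} [IsProbabilityMeasure μ] {s : ℕ → ℕ}
  (C : ChaconMap μ s)

/-- Approximability of a set by unions of levels. -/
def cwmAp (A : Set X) : Prop :=
  ∀ ε > 0, ∀ᶠ j in atTop, ∃ F ⊆ Finset.range (cwmH C j), μ.real (A ∆ cwmU C j F) < ε

lemma cwm_sd_ae {A B D : Set X} (h : A =ᵐ[μ] B) : μ.real (A ∆ D) = μ.real (B ∆ D) := by
  refine measureReal_congr ?_
  exact (h.diff (ae_eq_refl D)).union ((ae_eq_refl D).diff h)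

lemma cwm_sd_tri (A B D : Set X) : μ.real (A ∆ D) ≤ μ.real (A ∆ B) + μ.real (B ∆ D) :=
  (measureReal_mono (symmDiff_triangle A B D)).trans (measureReal_union_le _ _)

lemma cwmAp_ae {A B : Set X} (h : A =ᵐ[μ] B) (hB : cwmAp C B) : cwmAp C A := by
  intro ε hε
  filter_upwards [hB ε hε] with j hj
  obtain ⟨F, hF, h1⟩ := hj
  exact ⟨F, hF, by rwa [cwm_sd_ae h]⟩

lemma cwmU_step (n : ℕ) (F : Finset ℕ) (hF : F ⊆ Finset.range (cwmH C n)) :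
    ∃ F' ⊆ Finset.range (cwmH C (n + 1)), cwmU C n F =ᵐ[μ] cwmU C (n + 1) F' := by
  classical
  induction F using Finset.induction_on with
  | empty => exact ⟨∅, by simp, by simp [cwmU]⟩
  | insert a F ha ih =>
    obtain ⟨F', hF', h⟩ := ih fun x hx => hF (Finset.mem_insert_of_mem hx)
    have ha' : a < cwmH C n := Finset.mem_range.1 (hF (Finset.mem_insert_self _ _))
    refine ⟨{a, a + cwmH C n, a + (2 * cwmH C n + s (n + 1))} ∪ F', ?_, ?_⟩
    · refine Finset.union_subset ?_ hF'
      intro x hx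
      simp only [Finset.mem_insert, Finset.mem_singleton] at hx
      rw [Finset.mem_range, cwmH_succ]
      omega
    · have e1 : cwmU C n (insert a F) = cwmlv C n a ∪ cwmU C n F := by
        unfold cwmU; exact Finset.set_biUnion_insert _ _ _
      have e2 : cwmU C (n + 1) ({a, a + cwmH C n, a + (2 * cwmH C n + s (n + 1))} ∪ F') =
          (cwmlv C (n + 1) a ∪ cwmlv C (n + 1) (a + cwmH C n) ∪
            cwmlv C (n + 1) (a + (2 * cwmH C n + s (n + 1)))) ∪ cwmU C (n + 1) F' := by
        unfold cwmU
        rw [Finset.set_biUnion_union, Finset.set_biUnion_insert, Finset.set_biUnion_insert,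
          Finset.set_biUnion_singleton, Set.union_assoc]
        simp only [Set.union_assoc]
      rw [e1, e2]
      exact (cwmlv_ae C n a).union h

lemma cwmAp_lv (n a : ℕ) (ha : a < cwmH C n) : cwmAp C (cwmlv C n a) := by
  have key : ∀ k, ∃ F ⊆ Finset.range (cwmH C (n + k)), cwmlv C n a =ᵐ[μ] cwmU C (n + k) F := by
    intro k
    induction k with
    | zero => exact ⟨{a}, by simpa using ha, by simp [cwmU]; exact ae_eq_refl _⟩
    | succ k ih =>
      obtain ⟨F, hF, h⟩ := ih
      obtain ⟨F', hF', h'⟩ := cwmU_step C (n + k) F hF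
      exact ⟨F', hF', h.trans h'⟩
  intro ε hε
  filter_upwards [eventually_ge_atTop n] with j hj
  obtain ⟨k, rfl⟩ := Nat.exists_eq_add_of_le hj
  obtain ⟨F, hF, h⟩ := key k
  refine ⟨F, hF, ?_⟩
  rw [cwm_sd_ae h]
  simpa using hε

lemma cwmAp_empty : cwmAp C ∅ := fun ε hε =>
  Eventually.of_forall fun j => ⟨∅, by simp, by simpa [cwmU] using hε⟩

lemma cwmU_full_compl : Tendsto (fun j => μ.real (cwmU C j (Finset.range (cwmH C j)))ᶜ) atTop (𝓝 0) := by
  have h := (ENNReal.tendsto_toReal ENNReal.one_ne_top).comp (cwmU_full C)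
  have h2 : Tendsto (fun j => 1 - μ.real (cwmU C j (Finset.range (cwmH C j)))) atTop (𝓝 (1 - 1)) :=
    tendsto_const_nhds.sub (by simpa [Function.comp_def, Measure.real] using h)
  rw [sub_self] at h2
  refine h2.congr fun j => ?_
  rw [probReal_compl_eq_one_sub (cwmU_meas _ _ _)]

lemma cwmAp_compl {A : Set X} (hA : cwmAp C A) : cwmAp C Aᶜ := by
  classical
  intro ε hε
  filter_upwards [hA (ε / 2) (by positivity),
    (cwmU_full_compl C).eventually (gt_mem_nhds (show (0:ℝ) < ε / 2 by positivity))] with j hj hj2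
  obtain ⟨F, hF, h⟩ := hj
  refine ⟨Finset.range (cwmH C j) \ F, Finset.sdiff_subset, ?_⟩
  have hsub : Aᶜ ∆ cwmU C j (Finset.range (cwmH C j) \ F) ⊆
      (A ∆ cwmU C j F) ∪ (cwmU C j (Finset.range (cwmH C j)))ᶜ := by
    intro x hx
    by_cases hxU : x ∈ cwmU C j (Finset.range (cwmH C j))
    · left
      have hiff : x ∈ cwmU C j (Finset.range (cwmH C j) \ F) ↔ x ∉ cwmU C j F := by
        simp only [cwmU, Set.mem_iUnion, exists_prop] at hxU ⊢
        obtain ⟨a, ha, hxa⟩ := hxU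
        have uniq : ∀ b ∈ Finset.range (cwmH C j), x ∈ cwmlv C j b → b = a := by
          intro b hb hxb
          by_contra hne
          exact Set.disjoint_left.1 (cwmlv_disj C j b a (Finset.mem_range.1 hb)
            (Finset.mem_range.1 ha) hne) hxb hxa
        constructor
        · rintro ⟨b, hb, hxb⟩ ⟨c, hc, hxc⟩
          rw [Finset.mem_sdiff] at hb
          have := uniq b hb.1 hxb
          have := uniq c (hF hc) hxc
          grind
        · intro hno
          exact ⟨a, Finset.mem_sdiff.2 ⟨ha, fun haF => hno ⟨a, haF, hxa⟩⟩, hxa⟩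
      rw [Set.mem_symmDiff, Set.mem_compl_iff, hiff] at hx
      rw [Set.mem_symmDiff]
      tauto
    · right; exact hxU
  calc _ ≤ _ := measureReal_mono hsub
    _ ≤ _ := measureReal_union_le _ _
    _ < ε := by linarith

lemma cwmAp_union {A B : Set X} (hA : cwmAp C A) (hB : cwmAp C B) : cwmAp C (A ∪ B) := by
  classical
  intro ε hε
  filter_upwards [hA (ε / 2) (by positivity), hB (ε / 2) (by positivity)] with j hj hj2
  obtain ⟨F, hF, h⟩ := hj
  obtain ⟨F', hF', h'⟩ := hj2
  refine ⟨F ∪ F', Finset.union_subset hF hF', ?_⟩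
  have e : cwmU C j (F ∪ F') = cwmU C j F ∪ cwmU C j F' := by
    unfold cwmU; exact Finset.set_biUnion_union _ _ _
  rw [e]
  have hsub : (A ∪ B) ∆ (cwmU C j F ∪ cwmU C j F') ⊆ (A ∆ cwmU C j F) ∪ (B ∆ cwmU C j F') := by
    intro x
    simp only [Set.mem_symmDiff, Set.mem_union]
    tauto
  calc _ ≤ _ := measureReal_mono hsub
    _ ≤ _ := measureReal_union_le _ _
    _ < ε := by linarith

lemma cwmAp_iUnion (f : ℕ → Set X) (hm : ∀ n, MeasurableSet (f n)) (hf : ∀ n, cwmAp C (f n)) :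
    cwmAp C (⋃ n, f n) := by
  have hacc : ∀ n, cwmAp C (Set.accumulate f n) := by
    intro n
    induction n with
    | zero => rw [Set.accumulate_zero_nat]; exact hf 0
    | succ n ih => rw [Set.accumulate_succ]; exact cwmAp_union C ih (hf _)
  have ht : Tendsto (fun n => μ.real (Set.accumulate f n)) atTop (𝓝 (μ.real (⋃ n, f n))) :=
    (ENNReal.tendsto_toReal (measure_ne_top μ _)).comp tendsto_measure_iUnion_accumulate
  intro ε hε
  obtain ⟨n, hn⟩ := (ht.eventually (lt_mem_nhds
    (show μ.real (⋃ n, f n) - ε / 2 < μ.real (⋃ n, f n) by linarith))).exists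
  filter_upwards [hacc n (ε / 2) (by positivity)] with j hj
  obtain ⟨F, hF, h⟩ := hj
  refine ⟨F, hF, lt_of_le_of_lt (cwm_sd_tri _ (Set.accumulate f n) _) ?_⟩
  have hsub : Set.accumulate f n ⊆ ⋃ n, f n := Set.accumulate_subset_iUnion n
  have hmeas : MeasurableSet (Set.accumulate f n) := by
    rw [Set.accumulate_def]
    exact MeasurableSet.biUnion (Set.to_countable _) fun i _ => hm i
  have : μ.real ((⋃ n, f n) ∆ Set.accumulate f n) = μ.real (⋃ n, f n) - μ.real (Set.accumulate f n) := by
    rw [symmDiff_of_ge hsub]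
    exact measureReal_sdiff hsub hmeas
  linarith

lemma cwmAp_all {A : Set X} (hA : MeasurableSet A) : cwmAp C A := by
  obtain ⟨B, hB, h⟩ := C.generates A hA
  rw [measure_symmDiff_eq_zero_iff] at h
  refine cwmAp_ae C h ?_
  have gen : ∀ t ∈ {S : Set X | ∃ j, 1 ≤ j ∧ ∃ i ≤ C.h j, S = (⇑C.T)^[i] '' C.E j},
      ∃ n a, a < cwmH C n ∧ t = cwmlv C n a := by
    rintro t ⟨j, hj, i, hi, rfl⟩
    obtain ⟨n, rfl⟩ := Nat.exists_eq_add_of_le' hj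
    exact ⟨n, i, Nat.lt_succ_of_le hi, cwmLev_eq _ _ _⟩
  have hle : MeasurableSpace.generateFrom
      {S : Set X | ∃ j, 1 ≤ j ∧ ∃ i ≤ C.h j, S = (⇑C.T)^[i] '' C.E j} ≤ ‹MeasurableSpace X› := by
    refine MeasurableSpace.generateFrom_le fun t ht => ?_
    obtain ⟨n, a, _, rfl⟩ := gen t ht
    exact cwmlv_meas _ _ _
  refine MeasurableSpace.generateFrom_induction _ (fun t _ => cwmAp C t) ?_ (cwmAp_empty C) ?_ ?_ B hB
  · intro t ht _
    obtain ⟨n, a, ha, rfl⟩ := gen t ht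
    exact cwmAp_lv C n a ha
  · exact fun t _ h => cwmAp_compl C h
  · exact fun f hf h => cwmAp_iUnion C f (fun n => hle _ (hf n)) h

/-- Span of the rectangles of stage `j`. -/
noncomputable def cwmSp (j : ℕ) : Submodule ℂ (Lp ℂ 2 (μ.prod μ)) :=
  Submodule.span ℂ (Set.range (fun i : Fin (cwmH C j) × Fin (cwmH C j) =>
    ((cwmCS C) ^ (i.1:ℕ))⁻¹ (((cwmCR C) ^ (i.2:ℕ))⁻¹ (cwme C j))))

lemma cwmU_prod (j : ℕ) (F G : Finset ℕ) (hF : F ⊆ Finset.range (cwmH C j))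
    (hG : G ⊆ Finset.range (cwmH C j)) : cwmRect μ (cwmU C j F) (cwmU C j G) =
      ∑ i ∈ F ×ˢ G, cwmRect μ (cwmlv C j i.1) (cwmlv C j i.2) := by
  have e : cwmU C j F ×ˢ cwmU C j G = ⋃ i ∈ F ×ˢ G, cwmlv C j i.1 ×ˢ cwmlv C j i.2 := by
    ext ⟨x, y⟩
    simp only [cwmU, Set.mem_prod, Set.mem_iUnion, exists_prop, Finset.mem_product, Prod.exists]
    constructor
    · rintro ⟨⟨a, ha, hxa⟩, ⟨b, hb, hyb⟩⟩
      exact ⟨a, b, ⟨ha, hb⟩, hxa, hyb⟩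
    · rintro ⟨a, b, ⟨ha, hb⟩, hxa, hyb⟩
      exact ⟨⟨a, ha, hxa⟩, ⟨b, hb, hyb⟩⟩
  unfold cwmRect
  rw [e, cwmInd_biUnion]
  · exact fun i _ => (cwmlv_meas _ _ _).prod (cwmlv_meas _ _ _)
  · intro i hi i' hi' hne
    rw [Finset.mem_product] at hi hi'
    rw [Set.disjoint_prod]
    by_cases h1 : i.1 = i'.1
    · right
      exact cwmlv_disj C j _ _ (Finset.mem_range.1 (hG hi.2)) (Finset.mem_range.1 (hG hi'.2))
        (fun h2 => hne (Prod.ext h1 h2))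
    · left
      exact cwmlv_disj C j _ _ (Finset.mem_range.1 (hF hi.1)) (Finset.mem_range.1 (hF hi'.1)) h1

lemma cwmSp_mem (j : ℕ) (F G : Finset ℕ) (hF : F ⊆ Finset.range (cwmH C j))
    (hG : G ⊆ Finset.range (cwmH C j)) : cwmRect μ (cwmU C j F) (cwmU C j G) ∈ cwmSp C j := by
  rw [cwmU_prod C j F G hF hG]
  refine Submodule.sum_mem _ fun i hi => Submodule.subset_span ?_
  rw [Finset.mem_product] at hi
  exact ⟨(⟨i.1, Finset.mem_range.1 (hF hi.1)⟩, ⟨i.2, Finset.mem_range.1 (hG hi.2)⟩), cwm_v C j _ _⟩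

/-- The closed space of vectors approximated by the spans. -/
noncomputable def cwmW : Submodule ℂ (Lp ℂ 2 (μ.prod μ)) where
  carrier := {ψ | ∀ ε > 0, ∀ᶠ j in atTop, ∃ ξ ∈ cwmSp C j, ‖ψ - ξ‖ < ε}
  add_mem' := by
    intro a b ha hb ε hε
    filter_upwards [ha (ε / 2) (by positivity), hb (ε / 2) (by positivity)] with j h1 h2
    obtain ⟨x, hx, h1⟩ := h1
    obtain ⟨y, hy, h2⟩ := h2
    refine ⟨x + y, Submodule.add_mem _ hx hy, ?_⟩
    rw [add_sub_add_comm]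
    exact lt_of_le_of_lt (norm_add_le _ _) (by linarith)
  zero_mem' := fun ε hε => Eventually.of_forall fun j => ⟨0, Submodule.zero_mem _, by simpa using hε⟩
  smul_mem' := by
    intro c a ha ε hε
    filter_upwards [ha (ε / (‖c‖ + 1)) (by positivity)] with j h1
    obtain ⟨x, hx, h1⟩ := h1
    refine ⟨c • x, Submodule.smul_mem _ _ hx, ?_⟩
    rw [← smul_sub, norm_smul]
    rw [lt_div_iff₀ (by positivity)] at h1
    have := norm_nonneg (a - x)
    linarith

lemma cwmW_closed : IsClosed (cwmW C : Set (Lp ℂ 2 (μ.prod μ))) := by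
  refine isClosed_of_closure_subset fun ψ hψ ε hε => ?_
  obtain ⟨a, ha, hd⟩ := Metric.mem_closure_iff.1 hψ (ε / 2) (by positivity)
  filter_upwards [ha (ε / 2) (by positivity)] with j h1
  obtain ⟨x, hx, h1⟩ := h1
  refine ⟨x, hx, ?_⟩
  rw [dist_eq_norm] at hd
  have := norm_sub_le_norm_sub_add_norm_sub ψ a x
  linarith

lemma cwm_rect_sd {A B A' B' : Set X} (hA : MeasurableSet A) (hB : MeasurableSet B)
    (hA' : MeasurableSet A') (hB' : MeasurableSet B') :
    ‖cwmRect μ A B - cwmRect μ A' B'‖ ^ 2 ≤ μ.real (A ∆ A') + μ.real (B ∆ B') := by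
  unfold cwmRect
  rw [cwmInd_dist (hA.prod hB) (hA'.prod hB')]
  have hsub : (A ×ˢ B) ∆ (A' ×ˢ B') ⊆ ((A ∆ A') ×ˢ Set.univ) ∪ (Set.univ ×ˢ (B ∆ B')) := by
    rintro ⟨x, y⟩
    simp only [Set.mem_symmDiff, Set.mem_union, Set.mem_prod, Set.mem_univ]
    tauto
  calc _ ≤ _ := measureReal_mono hsub
    _ ≤ _ := measureReal_union_le _ _
    _ = _ := by rw [measureReal_prod_prod, measureReal_prod_prod]; simp

lemma cwmW_rect {A B : Set X} (hA : MeasurableSet A) (hB : MeasurableSet B) : cwmRect μ A B ∈ cwmW C := by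
  intro ε hε
  filter_upwards [cwmAp_all C hA (ε ^ 2 / 2) (by positivity),
    cwmAp_all C hB (ε ^ 2 / 2) (by positivity)] with j h1 h2
  obtain ⟨F, hF, h1⟩ := h1
  obtain ⟨G, hG, h2⟩ := h2
  refine ⟨_, cwmSp_mem C j F G hF hG, ?_⟩
  have := cwm_rect_sd (μ := μ) hA hB (cwmU_meas C j F) (cwmU_meas C j G)
  exact lt_of_pow_lt_pow_left₀ 2 hε.le (by linarith)

lemma cwmW_top : cwmW C = ⊤ := by
  have : CompleteSpace (cwmW C) := (cwmW_closed C).completeSpace_coe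
  rw [← Submodule.orthogonal_eq_bot_iff, Submodule.eq_bot_iff]
  intro ψ hψ
  have hpsi : Integrable ψ (μ.prod μ) := (Lp.memLp ψ).integrable (by norm_num)
  have hrect : ∀ A B : Set X, MeasurableSet A → MeasurableSet B →
      ∫ x in A ×ˢ B, ψ x ∂(μ.prod μ) = 0 := by
    intro A B hA hB
    rw [← cwmInd_inner_left (hA.prod hB)]
    exact (Submodule.mem_orthogonal _ _).1 hψ _ (cwmW_rect C hA hB)
  have hall : ∀ D : Set (X × X), MeasurableSet D → ∫ x in D, ψ x ∂(μ.prod μ) = 0 := by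
    refine MeasurableSpace.induction_on_inter (C := fun D _ => ∫ x in D, ψ x ∂(μ.prod μ) = 0)
      generateFrom_prod.symm isPiSystem_prod ?_ ?_ ?_ ?_
    · simp
    · rintro t ⟨A, hA, B, hB, rfl⟩
      exact hrect A B hA hB
    · intro t ht h
      have h1 := setIntegral_compl ht hpsi
      have h2 := hrect Set.univ Set.univ MeasurableSet.univ MeasurableSet.univ
      rw [Set.univ_prod_univ, setIntegral_univ] at h2
      rw [h1, h2, h, sub_zero]
    · intro f hd hm h
      rw [integral_iUnion hm hd hpsi.integrableOn]
      simp [h]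
  rw [Lp.eq_zero_iff_ae_eq_zero]
  exact Lp.ae_eq_zero_of_forall_setIntegral_eq_zero ψ (by norm_num) (by norm_num)
    (fun _ _ _ => hpsi.integrableOn) (fun D hD _ => hall D hD)

lemma cwmCS_univ : cwmCS C (cwmInd (μ.prod μ) Set.univ) = cwmInd (μ.prod μ) Set.univ := by
  unfold cwmCS cwmS
  rw [cwmK_ind _ _ MeasurableSet.univ, Set.preimage_univ]

lemma cwmCR_univ : cwmCR C (cwmInd (μ.prod μ) Set.univ) = cwmInd (μ.prod μ) Set.univ := by
  unfold cwmCR cwmR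
  rw [cwmK_ind _ _ MeasurableSet.univ, Set.preimage_univ]

/-- The Hilbert space data of a Chacon map. -/
noncomputable def cwmD : CwmData (Lp ℂ 2 (μ.prod μ)) where
  S := cwmCS C
  R := cwmCR C
  comm := cwmSR_comm _ _
  H := cwmH C
  s := fun j => s (j + 1)
  hH := fun j => by rw [cwmH_succ]; omega
  hH0 := by unfold cwmH; omega
  e := cwme C
  m := cwmm C
  m_pos := cwmm_pos C
  m_rec := cwmm_rec C
  e_rec := cwm_e_rec C
  orth := cwm_orth C
  tens := cwm_tens C
  dense := by
    intro ψ ε hε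
    have h : ψ ∈ cwmW C := by rw [cwmW_top]; trivial
    obtain ⟨j, ξ, hξ, h1⟩ := (h ε hε).exists
    exact ⟨j, ξ, hξ, h1.le⟩

lemma cwm_hone : Tendsto (fun j => ∑ i, (cwmD C).v j i) atTop (𝓝 (cwmInd (μ.prod μ) Set.univ)) := by
  have e : ∀ j, ∑ i, (cwmD C).v j i = cwmRect μ (cwmU C j (Finset.range (cwmH C j)))
      (cwmU C j (Finset.range (cwmH C j))) := by
    intro j
    rw [cwmU_prod C j _ _ (Finset.Subset.refl _) (Finset.Subset.refl _)]
    change ∑ i : Fin (cwmH C j) × Fin (cwmH C j),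
      ((cwmCS C) ^ (i.1:ℕ))⁻¹ (((cwmCR C) ^ (i.2:ℕ))⁻¹ (cwme C j)) = _
    simp only [cwm_v]
    rw [Fintype.sum_prod_type, Finset.sum_product, Finset.sum_range]
    refine Finset.sum_congr rfl fun i _ => ?_
    rw [Finset.sum_range]
  simp only [e]
  rw [tendsto_iff_norm_sub_tendsto_zero]
  have hb : ∀ j, ‖cwmRect μ (cwmU C j (Finset.range (cwmH C j))) (cwmU C j (Finset.range (cwmH C j)))
      - cwmInd (μ.prod μ) Set.univ‖ ≤
      Real.sqrt (2 * μ.real (cwmU C j (Finset.range (cwmH C j)))ᶜ) := by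
    intro j
    have h := cwm_rect_sd (μ := μ) (cwmU_meas C j (Finset.range (cwmH C j)))
      (cwmU_meas C j (Finset.range (cwmH C j))) MeasurableSet.univ MeasurableSet.univ
    have e2 : cwmRect μ Set.univ Set.univ = cwmInd (μ.prod μ) Set.univ := by
      unfold cwmRect; rw [Set.univ_prod_univ]
    have e3 : (cwmU C j (Finset.range (cwmH C j))) ∆ Set.univ = (cwmU C j (Finset.range (cwmH C j)))ᶜ :=
      symmDiff_top _
    rw [e2, e3] at h
    exact Real.le_sqrt_of_sq_le (by linarith)
  refine squeeze_zero (fun _ => norm_nonneg _) hb ?_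
  have := (Real.continuous_sqrt.tendsto _).comp ((cwmU_full_compl C).const_mul 2)
  simpa [Function.comp_def] using this

lemma cwm_main (hs : ∀ i, s (i + 1) = Nat.nth Nat.Prime i) :
    Ergodic (fun x : X × X => (C.T x.1, C.T x.2)) (μ.prod μ) := by
  refine ⟨C.measurePreserving.prod C.measurePreserving, ⟨fun A hA hinv => ?_⟩⟩
  set φ := cwmInd (μ.prod μ) A with hφ
  set one := cwmInd (μ.prod μ) (Set.univ : Set (X × X)) with h1
  have hSR : cwmCS C (cwmCR C φ) = φ := by
    rw [hφ]
    unfold cwmCS cwmCR cwmS cwmR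
    rw [cwmK_ind _ _ hA, cwmK_ind _ _ ((MeasurableEquiv.measurable _) hA)]
    congr 1
  have hS : cwmCS C φ = φ := (cwmD C).S_fix (fun i => hs i) φ hSR
  have hR : cwmCR C φ = φ := (cwmCS C).injective (hSR.trans hS.symm)
  set c : ℂ := (((μ.prod μ).real A : ℝ) : ℂ) with hc
  have i1 : inner ℂ one φ = c := by
    rw [h1, hφ, cwmInd_inner MeasurableSet.univ hA, Set.univ_inter]
  have i2 : inner ℂ one one = (1 : ℂ) := by
    rw [h1, cwmInd_inner MeasurableSet.univ MeasurableSet.univ, Set.univ_inter]; simp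
  have i3 : inner ℂ φ φ = c := by
    rw [hφ, cwmInd_inner hA hA, Set.inter_self]
  have i4 : inner ℂ φ one = c := by
    rw [h1, hφ, cwmInd_inner hA MeasurableSet.univ, Set.inter_univ]
  have hθ : φ - c • one = 0 := by
    refine (cwmD C).eq_zero_of_fix (φ - c • one) ?_ ?_ one (cwm_hone C) ?_
    · change cwmCS C (φ - c • one) = _
      rw [map_sub, map_smul, hS, cwmCS_univ]
    · change cwmCR C (φ - c • one) = _
      rw [map_sub, map_smul, hR, cwmCR_univ]
    · rw [inner_sub_right, inner_smul_right, i1, i2]; ring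
  have hz : c - c * c = 0 := by
    have : inner ℂ φ (φ - c • one) = (0 : ℂ) := by rw [hθ, inner_zero_right]
    rwa [inner_sub_right, inner_smul_right, i3, i4] at this
  rw [eventuallyConst_set']
  have hcc : c = 0 ∨ c = 1 := by
    have : c * (1 - c) = 0 := by linear_combination hz
    rcases mul_eq_zero.1 this with h | h
    · exact Or.inl h
    · exact Or.inr (by linear_combination -h)
  rcases hcc with h | h
  · left
    rw [ae_eq_empty]
    rw [hc, Complex.ofReal_eq_zero] at h
    exact (measureReal_eq_zero_iff).1 h
  · right
    rw [ae_eq_univ]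
    have h' : (μ.prod μ).real A = 1 := by rw [hc] at h; exact_mod_cast h
    have := probReal_compl_eq_one_sub (μ := μ.prod μ) hA
    rw [h', sub_self] at this
    exact (measureReal_eq_zero_iff).1 this

end cwmDense


/-- the prime Chacon map is weakly mixing: `T × T` is ergodic for
`μ ⊗ μ`. -/
theorem primeChacon_weaklyMixing
    {X : Type*} [MeasurableSpace X] (μ : Measure X) [IsProbabilityMeasure μ]
    (C : ChaconMap μ (fun j => Nat.nth Nat.Prime (j - 1))) :
    Ergodic (fun x : X × X => (C.T x.1, C.T x.2)) (μ.prod μ) := by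
  exact cwm_main C (fun i => by simp)
end
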